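/- (Kac–Moody–Wakimoto, level 2 for E₁₀.) Let g = g(A_{E10}) be the Serre-presented Lie algebra of the E₁₀ generalized Cartan matrix. For every c : Fin 10 → ℕ with c₁ = 2 (level 2) and (α|α) ≤ 0 where α = ∑_i c_i α_i, one has mult(α) = ξ(3 − (α|α)/2). -/

import Mathlib

/-! Serre presentation of the Kac–Moody Lie algebra `g(A)` of a generalized Cartan
matrix `A`. -/

/-- Generators `e i`, `f i`, `h i` of the Serre presentation. -/
inductive ChevalleyGen (ℓ : ℕ) : Type
  | e : Fin ℓ → ChevalleyGen ℓ
  | f : Fin ℓ → ChevalleyGen ℓ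
  | h : Fin ℓ → ChevalleyGen ℓ

namespace KacMoody

variable {ℓ : ℕ}

/-- The free Lie algebra over `ℂ` on the generators. -/
abbrev FreeLie (ℓ : ℕ) : Type := FreeLieAlgebra ℂ (ChevalleyGen ℓ)

noncomputable def E (i : Fin ℓ) : FreeLie ℓ := FreeLieAlgebra.of ℂ (ChevalleyGen.e i)
noncomputable def F (i : Fin ℓ) : FreeLie ℓ := FreeLieAlgebra.of ℂ (ChevalleyGen.f i)
noncomputable def H (i : Fin ℓ) : FreeLie ℓ := FreeLieAlgebra.of ℂ (ChevalleyGen.h i)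

open LieAlgebra in
/-- The defining relations of the Serre presentation: `⁅h i, h j⁆ = 0`,
`⁅e i, f j⁆ = δ_{ij} h i`, `⁅h i, e j⁆ = A i j • e j`, `⁅h i, f j⁆ = −A i j • f j`, and the
Serre relations `(ad (e i))^(1 − A i j) (e j) = 0`, `(ad (f i))^(1 − A i j) (f j) = 0` for
`i ≠ j`. -/
noncomputable def serreRelations (A : Matrix (Fin ℓ) (Fin ℓ) ℤ) : Set (FreeLie ℓ) :=
  {x : FreeLie ℓ | ∃ i j : Fin ℓ, x = ⁅H i, H j⁆} ∪
  {x : FreeLie ℓ | ∃ i j : Fin ℓ, x = ⁅E i, F j⁆ - if i = j then H i else 0} ∪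
  {x : FreeLie ℓ | ∃ i j : Fin ℓ, x = ⁅H i, E j⁆ - (A i j : ℂ) • E j} ∪
  {x : FreeLie ℓ | ∃ i j : Fin ℓ, x = ⁅H i, F j⁆ + (A i j : ℂ) • F j} ∪
  {x : FreeLie ℓ | ∃ i j : Fin ℓ, i ≠ j ∧ x = ((ad ℂ (FreeLie ℓ) (E i)) ^ (1 - A i j).toNat) (E j)} ∪
  {x : FreeLie ℓ | ∃ i j : Fin ℓ, i ≠ j ∧ x = ((ad ℂ (FreeLie ℓ) (F i)) ^ (1 - A i j).toNat) (F j)}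

/-- The Lie ideal of the free Lie algebra generated by the Serre relations. -/
noncomputable def serreIdeal (A : Matrix (Fin ℓ) (Fin ℓ) ℤ) : LieIdeal ℂ (FreeLie ℓ) :=
  LieSubmodule.lieSpan ℂ (FreeLie ℓ) (serreRelations A)

/-- The Serre-presented Lie algebra `g(A)` of a generalized Cartan matrix `A`: the quotient
of the free Lie algebra on the generators `e i`, `f i`, `h i` by the ideal generated by
the defining relations. -/
abbrev gA (A : Matrix (Fin ℓ) (Fin ℓ) ℤ) : Type := FreeLie ℓ ⧸ serreIdeal A

/-- The image of `h i` in `g(A)`. -/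
noncomputable def Hbar (A : Matrix (Fin ℓ) (Fin ℓ) ℤ) (i : Fin ℓ) : gA A :=
  LieSubmodule.Quotient.mk' (serreIdeal A) (H i)

open LieAlgebra in
/-- The root space `g_α` for `α = ∑ c i • α i`: all `x` with
`⁅h i, x⁆ = (∑ j, A i j * c j) • x` for every `i`. -/
noncomputable def rootSpace (A : Matrix (Fin ℓ) (Fin ℓ) ℤ) (c : Fin ℓ → ℤ) :
    Submodule ℂ (gA A) :=
  ⨅ i : Fin ℓ, Module.End.eigenspace (ad ℂ (gA A) (Hbar A i)) ((∑ j, A i j * c j : ℤ) : ℂ)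

/-- The multiplicity of the root `α = ∑ c i • α i`: the dimension of `g_α`. -/
noncomputable def mult (A : Matrix (Fin ℓ) (Fin ℓ) ℤ) (c : Fin ℓ → ℤ) : ℕ :=
  Module.finrank ℂ (rootSpace A c)

end KacMoody

/-- `p n` is the classical partition function: the number of partitions of `n`. -/
def p (n : ℕ) : ℕ := Fintype.card (Nat.Partition n)

/-- `pColored ℓ n` is the number of `ℓ`-tuples `(λ₁,…,λ_ℓ)` of partitions with
`|λ₁| + ⋯ + |λ_ℓ| = n` (partitions of `n` into parts of `ℓ` colors). -/
def pColored (ℓ n : ℕ) : ℕ :=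
  ∑ k ∈ Finset.Nat.antidiagonalTuple ℓ n, ∏ i, p (k i)

/-- `cCoeff 0 = 0`, and for `m ≥ 1`, `cCoeff m` is the number of finite sets of distinct
positive integers, each `≡ 2 mod 4`, with sum `m` and odd cardinality, minus the number of
such sets with even cardinality.  (Such a set is a subset of `{0, …, m}`.) -/
def cCoeff (m : ℕ) : ℤ :=
  if m = 0 then 0
  else ∑ s ∈ (Finset.range (m + 1)).powerset.filter
      (fun s => (∀ x ∈ s, x % 4 = 2) ∧ s.sum id = m),
    (-1 : ℤ) ^ (s.card + 1)

/-- `ξ(n) = ∑_{m=0}^{n} p^{(8)}(n−m)·c(m)`; equivalently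
`∑_{n≥0} ξ(n)qⁿ = φ(q)^{−8}·(1 − φ(q²)/φ(q⁴))` with `φ(q) = ∏_{n≥1}(1−qⁿ)`. -/
def xi (n : ℕ) : ℤ :=
  ∑ m ∈ Finset.range (n + 1), (pColored 8 (n - m) : ℤ) * cCoeff m

/-- The edges of the `E₁₀` Dynkin diagram (0-indexed): a chain `0–1–2–⋯–8` with the extra
node `9` attached to node `6`.  (In 1-indexed notation, `{1,2},…,{8,9}` and `{7,10}`;
node `1`, here `0`, is the over-extended node.) -/
def e10Edges : List (Fin 10 × Fin 10) :=
  [(0, 1), (1, 2), (2, 3), (3, 4), (4, 5), (5, 6), (6, 7), (7, 8), (6, 9)]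

/-- The generalized Cartan matrix of `E₁₀`. -/
def AE10 : Matrix (Fin 10) (Fin 10) ℤ := fun i j =>
  if i = j then 2 else if (i, j) ∈ e10Edges ∨ (j, i) ∈ e10Edges then -1 else 0

/-- The invariant symmetric bilinear form `(α|α) = ∑_{i,j} c i · A i j · c j` for
`α = ∑ c i • α i`. -/
def normE10 (c : Fin 10 → ℤ) : ℤ := ∑ i, ∑ j, c i * AE10 i j * c j

open scoped TensorProduct
namespace KMW
abbrev I := Option (Fin 10)
/-- extended matrix -/
def AA : I → I → ℤ
  | some i, some j => AE10 i j
  | none, none => 0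
  | _, _ => -1
lemma AA_symm : ∀ i j, AA i j = AA j i := by decide +kernel
lemma AA_diag : ∀ i : Fin 10, AA (some i) (some i) = 2 := by decide +kernel
lemma AE_cases : ∀ i j : Fin 10, i ≠ j → AE10 i j = 0 ∨ AE10 i j = -1 := by
  unfold AE10; decide +kernel

def IsSerre {L : Type*} [LieRing L] (g : I → L) : Prop :=
  ∀ i j : Fin 10, i ≠ j → (AE10 i j = 0 → ⁅g i, g j⁆ = 0) ∧ (AE10 i j = -1 → ⁅g i, ⁅g i, g j⁆⁆ = 0)

structure ND (N : Type) [LieRing N] [LieAlgebra ℂ N] where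
  e : I → N
  serre : IsSerre e
  gen : ∀ S : LieSubalgebra ℂ N, (∀ i, e i ∈ S) → S = ⊤
  lift : ∀ (L : Type) [LieRing L] [LieAlgebra ℂ L] (g : I → L), IsSerre g →
    ∃ f : N →ₗ⁅ℂ⁆ L, ∀ i, f (e i) = g i

section quot
variable {X : Type} {L : Type} [LieRing L] [LieAlgebra ℂ L]
lemma exists_quot_lift (R : Set (FreeLieAlgebra ℂ X)) (g : X → L)
    (h : ∀ x ∈ R, FreeLieAlgebra.lift ℂ g x = 0) :
    ∃ f : (FreeLieAlgebra ℂ X ⧸ LieSubmodule.lieSpan ℂ (FreeLieAlgebra ℂ X) R) →ₗ⁅ℂ⁆ L,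
      ∀ x, f (LieSubmodule.Quotient.mk' _ (FreeLieAlgebra.of ℂ x)) = g x := by
  set J : LieIdeal ℂ (FreeLieAlgebra ℂ X) := LieSubmodule.lieSpan ℂ (FreeLieAlgebra ℂ X) R
  have hJ : J ≤ (FreeLieAlgebra.lift ℂ g).ker := by
    refine LieSubmodule.lieSpan_le.2 fun x hx => ?_
    simpa using h x hx
  let f0 : (FreeLieAlgebra ℂ X ⧸ J) →ₗ[ℂ] L :=
    Submodule.liftQ J.toSubmodule (FreeLieAlgebra.lift ℂ g : FreeLieAlgebra ℂ X →ₗ[ℂ] L)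
      (fun x hx => by simpa using hJ hx)
  have hf0 : ∀ x, f0 (LieSubmodule.Quotient.mk' J x) = FreeLieAlgebra.lift ℂ g x := fun x => rfl
  refine ⟨{ f0 with map_lie' := ?_ }, fun x => ?_⟩
  · intro x y
    obtain ⟨x, rfl⟩ := LieSubmodule.Quotient.surjective_mk' J x
    obtain ⟨y, rfl⟩ := LieSubmodule.Quotient.surjective_mk' J y
    have : ⁅LieSubmodule.Quotient.mk' J x, LieSubmodule.Quotient.mk' J y⁆ =
      LieSubmodule.Quotient.mk' J ⁅x, y⁆ := (LieSubmodule.Quotient.mk_bracket (I := J) x y).symm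
    change f0 _ = ⁅f0 _, f0 _⁆
    rw [this, hf0, hf0, hf0, LieHom.map_lie]
  · exact (hf0 _).trans (by simp)

lemma quot_gen (J : LieIdeal ℂ (FreeLieAlgebra ℂ X))
    (S : LieSubalgebra ℂ (FreeLieAlgebra ℂ X ⧸ J))
    (h : ∀ x, LieSubmodule.Quotient.mk' J (FreeLieAlgebra.of ℂ x) ∈ S) : S = ⊤ := by
  let q : FreeLieAlgebra ℂ X →ₗ⁅ℂ⁆ (FreeLieAlgebra ℂ X ⧸ J) :=
    { (LieSubmodule.Quotient.mk' J : FreeLieAlgebra ℂ X →ₗ[ℂ] _) with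
      map_lie' := fun {x y} => LieSubmodule.Quotient.mk_bracket (I := J) x y }
  let g : FreeLieAlgebra ℂ X →ₗ⁅ℂ⁆ S := FreeLieAlgebra.lift ℂ fun x => ⟨_, h x⟩
  have : S.incl.comp g = q := by
    apply FreeLieAlgebra.hom_ext
    intro x
    simp only [LieHom.comp_apply, g, FreeLieAlgebra.lift_of_apply]
    rfl
  refine eq_top_iff.2 fun y _ => ?_
  obtain ⟨x, rfl⟩ := LieSubmodule.Quotient.surjective_mk' J y
  have h2 := congrArg (fun f => f x) this
  change _ = LieSubmodule.Quotient.mk' J x at h2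
  rw [← h2]
  exact (g x).2
end quot

def NR : Set (FreeLieAlgebra ℂ I) :=
  {x | ∃ i j : Fin 10, i ≠ j ∧ AE10 i j = 0 ∧
    x = ⁅FreeLieAlgebra.of ℂ (some i : I), FreeLieAlgebra.of ℂ (some j)⁆} ∪
  {x | ∃ i j : Fin 10, i ≠ j ∧ AE10 i j = -1 ∧
    x = ⁅FreeLieAlgebra.of ℂ (some i : I), ⁅FreeLieAlgebra.of ℂ (some i : I), FreeLieAlgebra.of ℂ (some j)⁆⁆}
abbrev NN := FreeLieAlgebra ℂ I ⧸ LieSubmodule.lieSpan ℂ (FreeLieAlgebra ℂ I) NR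

noncomputable def nd : ND NN where
  e i := LieSubmodule.Quotient.mk' _ (FreeLieAlgebra.of ℂ i)
  serre i j hij := by
    have key : ∀ x ∈ NR, LieSubmodule.Quotient.mk' (LieSubmodule.lieSpan ℂ (FreeLieAlgebra ℂ I) NR) x = 0 :=
      fun x hx => (LieSubmodule.Quotient.mk_eq_zero _).2 (LieSubmodule.subset_lieSpan hx)
    constructor <;> intro h
    · exact key _ (Or.inl ⟨i, j, hij, h, rfl⟩)
    · exact key _ (Or.inr ⟨i, j, hij, h, rfl⟩)
  gen S h := quot_gen _ S h
  lift L _ _ g hg := exists_quot_lift _ _ (by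
    rintro x (⟨i, j, hij, h, rfl⟩ | ⟨i, j, hij, h, rfl⟩)
    · simpa using (hg i j hij).1 h
    · simpa using (hg i j hij).2 h)
end KMW
open scoped TensorProduct
namespace KMW
open LieAlgebra LieModule.Cohomology
variable {N : Type} [LieRing N] [LieAlgebra ℂ N] (D : ND N)

lemma ND.ext_hom {L : Type} [LieRing L] [LieAlgebra ℂ L] (f g : N →ₗ⁅ℂ⁆ L) (h : ∀ i, f (D.e i) = g (D.e i)) :
    f = g := by
  let S : LieSubalgebra ℂ N :=
    { LinearMap.eqLocus (f : N →ₗ[ℂ] L) (g : N →ₗ[ℂ] L) with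
      lie_mem' := fun {x y} (hx : f x = g x) (hy : f y = g y) => by
        change f ⁅x, y⁆ = g ⁅x, y⁆; simp [hx, hy] }
  have := D.gen S h
  ext x
  exact (show x ∈ S from this ▸ LieSubalgebra.mem_top x)

lemma ND.exists_cocycle {M : Type} [AddCommGroup M] [Module ℂ M] [LieRingModule N M] [LieModule ℂ N M]
    (c : twoCocycle ℂ N M) (v : I → M)
    (h : ∀ i j : Fin 10, i ≠ j →
      (AE10 i j = 0 → (c : N →ₗ[ℂ] N →ₗ[ℂ] M) (D.e i) (D.e j) + ⁅D.e i, v j⁆ - ⁅D.e j, v i⁆ = 0) ∧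
      (AE10 i j = -1 → (c : N →ₗ[ℂ] N →ₗ[ℂ] M) (D.e i) ⁅D.e i, D.e j⁆ + 
         ⁅D.e i, (c : N →ₗ[ℂ] N →ₗ[ℂ] M) (D.e i) (D.e j) + ⁅D.e i, v j⁆ - ⁅D.e j, v i⁆⁆ -
         ⁅⁅D.e i, D.e j⁆, v i⁆ = 0)) :
    ∃ d : N →ₗ[ℂ] M, (∀ i, d (D.e i) = v i) ∧
      ∀ x y, d ⁅x, y⁆ = (c : N →ₗ[ℂ] N →ₗ[ℂ] M) x y + ⁅x, d y⁆ - ⁅y, d x⁆ := by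
  obtain ⟨f, hf⟩ := D.lift (ofTwoCocycle c) (fun i => ofProd c (D.e i, v i)) (by
    intro i j hij
    constructor <;> intro h0
    · simp only [bracket_ofTwoCocycle, Equiv.symm_apply_apply, (h i j hij).1 h0,
        (D.serre i j hij).1 h0]
      exact of_zero c
    · simp only [bracket_ofTwoCocycle, Equiv.symm_apply_apply, (h i j hij).2 h0,
        (D.serre i j hij).2 h0]
      exact of_zero c)
  let pr : ofTwoCocycle c →ₗ⁅ℂ⁆ N := 
    { toFun x := ((ofProd c).symm x).1
      map_add' _ _ := by simp
      map_smul' _ _ := by simp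
      map_lie' {_ _} := by simp [bracket_ofTwoCocycle] }
  have h1 : pr.comp f = LieHom.id := D.ext_hom _ _ fun i => by
    change ((ofProd c).symm (f (D.e i))).1 = D.e i
    rw [hf]; rfl
  have h2 : ∀ x, ((ofProd c).symm (f x)).1 = x := fun x => congrArg (fun g => g x) h1
  refine ⟨{ toFun x := ((ofProd c).symm (f x)).2
            map_add' _ _ := by simp
            map_smul' _ _ := by simp}, fun i => by simp [hf], fun x y => ?_⟩
  simp [bracket_ofTwoCocycle, h2]

lemma ND.exists_d (k : I) : ∃ d : N →ₗ[ℂ] N, (∀ i, d (D.e i) = if i = k then D.e i else 0) ∧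
      ∀ x y, d ⁅x, y⁆ = ⁅d x, y⁆ + ⁅x, d y⁆ := by
  obtain ⟨d, h1, h2⟩ := D.exists_cocycle (0 : twoCocycle ℂ N N) (fun i => if i = k then D.e i else 0) (by
    intro i j hij
    constructor <;> intro h0
    · have h1 := (D.serre i j hij).1 h0
      have h2 : ⁅D.e j, D.e i⁆ = 0 := by rw [← lie_skew, h1, neg_zero]
      simp only [ZeroMemClass.coe_zero]
      split_ifs <;> simp [h1, h2]
    · have h1 := (D.serre i j hij).2 h0
      have h2 : ⁅⁅D.e i, D.e j⁆, D.e i⁆ = 0 := by rw [← lie_skew, h1, neg_zero]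
      have h3 : ⁅D.e i, ⁅D.e j, D.e i⁆⁆ = 0 := by rw [← lie_skew (D.e j), lie_neg, h1, neg_zero]
      simp only [ZeroMemClass.coe_zero]
      split_ifs <;> simp only [LinearMap.zero_apply, zero_add, lie_sub, lie_zero, h1, h2, h3, sub_zero])
  refine ⟨d, h1, fun x y => ?_⟩
  rw [h2, ← lie_skew (d x) y]; simp [sub_eq_add_neg]; abel

noncomputable def ND.d (k : I) : N →ₗ[ℂ] N := (D.exists_d k).choose
lemma ND.d_e (k i : I) : D.d k (D.e i) = if i = k then D.e i else 0 := (D.exists_d k).choose_spec.1 i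
lemma ND.d_lie (k : I) (x y : N) : D.d k ⁅x, y⁆ = ⁅D.d k x, y⁆ + ⁅x, D.d k y⁆ :=
  (D.exists_d k).choose_spec.2 x y

lemma ND.ind (P : Submodule ℂ N) (h : ∀ i, D.e i ∈ P) (h' : ∀ i, ∀ x ∈ P, ⁅D.e i, x⁆ ∈ P) (x : N) : x ∈ P := by
  let S : LieSubalgebra ℂ N := 
    { carrier := {y | ∀ x ∈ P, ⁅y, x⁆ ∈ P}
      add_mem' := fun {a b} ha hb x hx => by rw [add_lie]; exact P.add_mem (ha x hx) (hb x hx)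
      zero_mem' := fun x hx => by rw [zero_lie]; exact P.zero_mem
      smul_mem' := fun t a ha x hx => by rw [smul_lie]; exact P.smul_mem _ (ha x hx)
      lie_mem' := fun {a b} ha hb x hx => by
        rw [lie_lie]; exact P.sub_mem (ha _ (hb _ hx)) (hb _ (ha _ hx)) }
  have hS := D.gen S h'
  let P' : LieSubalgebra ℂ N := { P with lie_mem' := fun {a b} _ hb => (show a ∈ S from hS ▸ LieSubalgebra.mem_top a) b hb }
  have hP := D.gen P' h
  exact (show x ∈ P' from hP ▸ LieSubalgebra.mem_top x)

lemma ND.exists_eps (k : I) : ∃ f : N →ₗ[ℂ] ℂ, (∀ i, f (D.e i) = if i = k then 1 else 0) ∧ ∀ x y : N, f ⁅x, y⁆ = 0 := by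
  letI : LieRing ℂ := LieRing.ofAssociativeRing
  obtain ⟨f, hf⟩ := D.lift ℂ (fun i => if i = k then 1 else 0) (by
    intro i j hij; constructor <;> intro _ <;> simp [LieRing.of_associative_ring_bracket, mul_comm])
  exact ⟨f, hf, fun x y => by simp [LieRing.of_associative_ring_bracket, mul_comm]⟩
noncomputable def ND.eps (k : I) : N →ₗ[ℂ] ℂ := (D.exists_eps k).choose
lemma ND.eps_e (k i : I) : D.eps k (D.e i) = if i = k then 1 else 0 := (D.exists_eps k).choose_spec.1 i
lemma ND.eps_lie (k : I) (x y : N) : D.eps k ⁅x, y⁆ = 0 := (D.exists_eps k).choose_spec.2 x y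
end KMW
open scoped TensorProduct
namespace KMW
open LieAlgebra LieModule.Cohomology
variable {N : Type} [LieRing N] [LieAlgebra ℂ N] (D : ND N)

abbrev Wt := I → ℤ
def B (α γ : Wt) : ℤ := ∑ i, ∑ j, α i * AA i j * γ j
def sr (i : I) : Wt := Pi.single i 1
lemma B_symm (α γ : Wt) : B α γ = B γ α := by
  unfold B; rw [Finset.sum_comm]
  exact Finset.sum_congr rfl fun i _ => Finset.sum_congr rfl fun j _ => by rw [AA_symm j i]; ring
lemma B_add_left (α β γ : Wt) : B (α + β) γ = B α γ + B β γ := by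
  simp [B, add_mul, Finset.sum_add_distrib]
lemma B_add_right (α β γ : Wt) : B α (β + γ) = B α β + B α γ := by
  rw [B_symm, B_add_left, B_symm β, B_symm γ]
lemma B_neg_left (α γ : Wt) : B (-α) γ = - B α γ := by
  simp only [B, Pi.neg_apply, neg_mul, Finset.sum_neg_distrib]
lemma B_sub_left (α β γ : Wt) : B (α - β) γ = B α γ - B β γ := by
  rw [sub_eq_add_neg, B_add_left, B_neg_left, sub_eq_add_neg]
lemma B_sr_sr (i j : I) : B (sr i) (sr j) = AA i j := by
  simp [B, sr, Pi.single_apply]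

noncomputable def ND.W (β : Wt) : Submodule ℂ N := ⨅ i, Module.End.eigenspace (D.d i) (β i : ℂ)
lemma ND.mem_W {β : Wt} {x : N} : x ∈ D.W β ↔ ∀ i, D.d i x = (β i : ℂ) • x := by
  simp [ND.W, Submodule.mem_iInf]
lemma ND.e_mem (i : I) : D.e i ∈ D.W (sr i) := D.mem_W.2 fun k => by
  rw [D.d_e]; by_cases h : i = k
  · subst h; simp [sr]
  · simp [sr, h, Ne.symm h]
lemma ND.lie_mem {α β : Wt} {x y : N} (hx : x ∈ D.W α) (hy : y ∈ D.W β) : ⁅x, y⁆ ∈ D.W (α + β) :=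
  D.mem_W.2 fun k => by
    rw [D.d_lie, D.mem_W.1 hx, D.mem_W.1 hy]; simp [add_smul]

inductive ND.Mono : Wt → N → Prop
  | base (i : I) : Mono (sr i) (D.e i)
  | step (i : I) {β : Wt} {x : N} (h : Mono β x) : Mono (sr i + β) ⁅D.e i, x⁆
variable {D}
lemma ND.Mono.mem {β : Wt} {x : N} (h : D.Mono β x) : x ∈ D.W β := by
  induction h with
  | base i => exact D.e_mem i
  | step i _ ih => exact D.lie_mem (D.e_mem i) ih
lemma sr_nonneg (i : I) : 0 ≤ sr i := Pi.single_nonneg.2 zero_le_one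
lemma ND.Mono.nonneg {β : Wt} {x : N} (h : D.Mono β x) : 0 ≤ β ∧ 1 ≤ ∑ i, β i := by
  have h1 : ∀ i, ∑ k, sr i k = 1 := fun i => by simp [sr]
  induction h with
  | base i => exact ⟨sr_nonneg i, by simp [h1]⟩
  | step i _ ih => exact ⟨add_nonneg (sr_nonneg i) ih.1, by
      simp only [Pi.add_apply, Finset.sum_add_distrib, h1]; omega⟩
variable (D)
lemma ND.mono_ind (P : Submodule ℂ N) (h : ∀ β x, D.Mono β x → x ∈ P) (x : N) : x ∈ P := by
  have : x ∈ Submodule.span ℂ {y | ∃ β, D.Mono β y} := by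
    refine D.ind _ (fun i => Submodule.subset_span (show ∃ β, D.Mono β _ from ⟨_, .base i⟩)) (fun i y hy => ?_) x
    induction hy using Submodule.span_induction with
    | mem y hy => obtain ⟨β, hβ⟩ := hy; exact Submodule.subset_span (show ∃ β, D.Mono β _ from ⟨_, .step i hβ⟩)
    | zero => simp
    | add a b _ _ ha hb => rw [lie_add]; exact add_mem ha hb
    | smul t a _ ha => rw [lie_smul]; exact Submodule.smul_mem _ _ ha
  exact Submodule.span_le.2 (by rintro y ⟨β, hβ⟩; exact h β y hβ) this
lemma ND.mono_ext {M : Type} [AddCommGroup M] [Module ℂ M] (f g : N →ₗ[ℂ] M)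
    (h : ∀ β x, D.Mono β x → f x = g x) (x : N) : f x = g x :=
  D.mono_ind (LinearMap.eqLocus f g) h x

lemma ND.d_comm (i j : I) (x : N) : D.d i (D.d j x) = D.d j (D.d i x) := by
  refine D.mono_ext (D.d i ∘ₗ D.d j) (D.d j ∘ₗ D.d i) (fun β x h => ?_) x
  have := D.mem_W.1 h.mem
  simp [this, smul_smul, mul_comm]

lemma inf_eq_of_indep {J : Type} {M : Type} [AddCommGroup M] [Module ℂ M] {V U : J → Submodule ℂ M}
    (h : ∀ j, V j ≤ U j) (hU : iSupIndep U) (hV : ⨆ j, V j = ⊤) (j : J) : U j = V j := by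
  refine le_antisymm ?_ (h j)
  have h1 : (⊤ : Submodule ℂ M) ≤ V j ⊔ ⨆ k ≠ j, U k := by
    rw [← hV]
    refine iSup_le fun k => ?_
    by_cases hk : k = j
    · subst hk; exact le_sup_left
    · exact le_sup_of_le_right (le_iSup₂_of_le k hk (h k))
  calc U j = (V j ⊔ ⨆ k ≠ j, U k) ⊓ U j := by rw [eq_top_iff.2 h1, top_inf_eq]
    _ = V j ⊔ (⨆ k ≠ j, U k) ⊓ U j := (sup_inf_assoc_of_le _ (h j))
    _ = V j := by rw [(hU j).symm.eq_bot, sup_bot_eq]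
    _ ≤ V j := le_rfl

lemma indep_of_comm {J K : Type} {M : Type} [AddCommGroup M] [Module ℂ M] (f : J → Module.End ℂ M)
    (hc : ∀ i j, Commute (f i) (f j)) (χ : K → J → ℂ) (hχ : Function.Injective χ) :
    iSupIndep fun k => ⨅ i, Module.End.eigenspace (f i) (χ k i) := by
  have h := Module.End.independent_iInf_maxGenEigenspace_of_forall_mapsTo f (fun i j φ =>
    Module.End.mapsTo_maxGenEigenspace_of_comm (hc j i) φ)
  exact (h.comp hχ).mono fun k => iInf_mono fun i => by
    exact (f i).eigenspace_le_maxGenEigenspace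
lemma ND.indep : iSupIndep D.W := by
  refine indep_of_comm D.d (fun i j => LinearMap.ext fun x => D.d_comm i j x)
    (fun (β : Wt) i => (β i : ℂ)) (fun a b h => ?_)
  ext i; have := congrFun h i; simpa using this
lemma ND.W_eq (β : Wt) : D.W β = Submodule.span ℂ {x | D.Mono β x} := by
  refine inf_eq_of_indep (V := fun β => Submodule.span ℂ {x | D.Mono β x}) 
    (fun β => Submodule.span_le.2 fun x hx => hx.mem) D.indep ?_ β
  refine eq_top_iff.2 fun x _ => D.mono_ind _ (fun β x h => ?_) x
  exact Submodule.mem_iSup_of_mem β (Submodule.subset_span h)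
lemma ND.iSup_W : ⨆ β, D.W β = ⊤ := 
  eq_top_iff.2 fun x _ => D.mono_ind _ (fun β _ h => Submodule.mem_iSup_of_mem β h.mem) x
lemma ND.W_bot {β : Wt} (h : ¬ (0 ≤ β ∧ 1 ≤ ∑ i, β i)) : D.W β = ⊥ := by
  rw [D.W_eq, Submodule.span_eq_bot]
  exact fun x hx => absurd hx.nonneg h
lemma ND.mono_fin (n : ℕ) : ∀ β : Wt, ∑ i, β i ≤ n → {x | D.Mono β x}.Finite := by
  induction n with
  | zero => 
    intro β h
    convert Set.finite_empty
    refine Set.eq_empty_iff_forall_notMem.2 fun x hx => ?_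
    have := (show D.Mono β x from hx).nonneg.2; push_cast at h; omega
  | succ n ih =>
    intro β h
    refine Set.Finite.subset (s := Set.range D.e ∪ ⋃ i, (fun x => ⁅D.e i, x⁆) '' {x | D.Mono (β - sr i) x}) ?_ ?_
    · refine (Set.finite_range _).union (Set.finite_iUnion fun i => (ih _ ?_).image _)
      have : ∑ k, sr i k = 1 := by simp [sr]
      simp only [Pi.sub_apply, Finset.sum_sub_distrib, this]; push_cast at h; omega
    · rintro x hx
      rcases hx with ⟨i⟩ | ⟨i, hx⟩
      · exact Or.inl ⟨i, rfl⟩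
      · exact Or.inr (Set.mem_iUnion.2 ⟨i, _, by simpa using hx, rfl⟩)
instance (β : Wt) : Module.Finite ℂ (D.W β) := by
  rw [D.W_eq]
  exact Module.Finite.iff_fg.2 (Submodule.fg_span (D.mono_fin (∑ i, β i).toNat β (Int.self_le_toNat _)))
end KMW
open scoped TensorProduct
namespace KMW
open LieAlgebra LieModule.Cohomology TensorProduct
variable {N : Type} [LieRing N] [LieAlgebra ℂ N] (D : ND N)

lemma exists_cup (d d' : N →ₗ[ℂ] N) (h : ∀ x y, d ⁅x, y⁆ = ⁅d x, y⁆ + ⁅x, d y⁆)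
    (h' : ∀ x y, d' ⁅x, y⁆ = ⁅d' x, y⁆ + ⁅x, d' y⁆) :
    ∃ c : twoCocycle ℂ N (N ⊗[ℂ] N), ∀ x y, (c : N →ₗ[ℂ] N →ₗ[ℂ] N ⊗[ℂ] N) x y =
      d x ⊗ₜ d' y - d y ⊗ₜ d' x := by
  let c0 : N →ₗ[ℂ] N →ₗ[ℂ] N ⊗[ℂ] N := (TensorProduct.mk ℂ N N).compl₁₂ d d' -
    ((TensorProduct.mk ℂ N N).compl₁₂ d d').flip
  have hc : ∀ x y, c0 x y = d x ⊗ₜ d' y - d y ⊗ₜ d' x := fun x y => rfl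
  let c1 : twoCochain ℂ N (N ⊗[ℂ] N) := ⟨c0, fun x => by rw [hc, sub_self]⟩
  have hc1 : ∀ x y, c1 x y = d x ⊗ₜ d' y - d y ⊗ₜ d' x := fun x y => rfl
  refine ⟨⟨c1, (mem_twoCocycle_iff _ _ _ _).2 ?_⟩, hc⟩
  ext x y z
  rw [d₂₃_apply]
  simp only [hc1, h, h', LinearMap.zero_apply, lie_sub, LieModule.lie_tmul_right, add_tmul, tmul_add]
  rw [← lie_skew (d x) y, ← lie_skew (d x) z, ← lie_skew (d y) z, ← lie_skew (d' x) y,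
    ← lie_skew (d' x) z, ← lie_skew (d' y) z]
  simp only [neg_tmul, tmul_neg]
  abel

lemma ND.exists_c : ∃ c : twoCocycle ℂ N (N ⊗[ℂ] N), ∀ α γ : Wt, ∀ x ∈ D.W α, ∀ y ∈ D.W γ,
    (c : N →ₗ[ℂ] N →ₗ[ℂ] N ⊗[ℂ] N) x y = (B α γ : ℂ) • (x ⊗ₜ y - y ⊗ₜ x) := by
  choose c hc using fun i j => exists_cup (D.d i) (D.d j) (D.d_lie i) (D.d_lie j)
  refine ⟨∑ i, ∑ j, (AA i j : ℂ) • c i j, fun α γ x hx y hy => ?_⟩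
  have h1 : (((∑ i, ∑ j, (AA i j : ℂ) • c i j : twoCocycle ℂ N (N ⊗[ℂ] N)) :
      twoCochain ℂ N (N ⊗[ℂ] N)) : N →ₗ[ℂ] N →ₗ[ℂ] N ⊗[ℂ] N) x y
      = ∑ i, ∑ j, (AA i j : ℂ) • ((c i j : N →ₗ[ℂ] N →ₗ[ℂ] N ⊗[ℂ] N) x y) := by
    simp only [Submodule.coe_sum, LinearMap.coe_sum, Finset.sum_apply, Submodule.coe_smul,
      LinearMap.smul_apply]
  rw [h1]
  have h2 : ∀ i j, (AA i j : ℂ) • ((c i j : N →ₗ[ℂ] N →ₗ[ℂ] N ⊗[ℂ] N) x y) =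
     ((α i * AA i j * γ j : ℤ) : ℂ) • (x ⊗ₜ[ℂ] y) - ((γ i * AA i j * α j : ℤ) : ℂ) • (y ⊗ₜ[ℂ] x) := by
    intro i j
    rw [hc, D.mem_W.1 hx, D.mem_W.1 hx, D.mem_W.1 hy, D.mem_W.1 hy]
    simp only [TensorProduct.smul_tmul_smul, smul_sub, smul_smul]
    push_cast; congr 2 <;> ring
  simp only [h2, Finset.sum_sub_distrib, ← Finset.sum_smul]
  rw [smul_sub]
  congr 2
  · simp only [B]; push_cast; rfl
  · rw [B_symm]; simp only [B]; push_cast; rfl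

lemma ND.exists_del : ∃ δ : N →ₗ[ℂ] N ⊗[ℂ] N, (∀ i, δ (D.e i) = 0) ∧ ∀ α γ : Wt, ∀ x ∈ D.W α, ∀ y ∈ D.W γ,
    δ ⁅x, y⁆ = (B α γ : ℂ) • (x ⊗ₜ y - y ⊗ₜ x) + ⁅x, δ y⁆ - ⁅y, δ x⁆ := by
  obtain ⟨c, hc⟩ := D.exists_c
  obtain ⟨δ, h1, h2⟩ := D.exists_cocycle c (fun _ => 0) (by
    intro i j hij
    constructor <;> intro h0
    · rw [hc _ _ _ (D.e_mem i) _ (D.e_mem j), B_sr_sr]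
      simp [AA, h0]
    · rw [hc _ _ _ (D.e_mem i) _ (D.e_mem j), hc _ _ _ (D.e_mem i) _ (D.lie_mem (D.e_mem i) (D.e_mem j)),
        B_add_right, B_sr_sr, B_sr_sr, AA_diag]
      simp [AA, h0, LieModule.lie_tmul_right])
  exact ⟨δ, h1, fun α γ x hx y hy => by rw [h2, hc α γ x hx y hy]⟩
noncomputable def ND.del : N →ₗ[ℂ] N ⊗[ℂ] N := D.exists_del.choose
lemma ND.del_e (i : I) : D.del (D.e i) = 0 := D.exists_del.choose_spec.1 i
lemma ND.del_lie {α γ : Wt} {x y : N} (hx : x ∈ D.W α) (hy : y ∈ D.W γ) : 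
    D.del ⁅x, y⁆ = (B α γ : ℂ) • (x ⊗ₜ y - y ⊗ₜ x) + ⁅x, D.del y⁆ - ⁅y, D.del x⁆ :=
  D.exists_del.choose_spec.2 α γ x hx y hy
lemma ND.del_step (i : I) {γ : Wt} {y : N} (hy : y ∈ D.W γ) : 
    D.del ⁅D.e i, y⁆ = (B (sr i) γ : ℂ) • (D.e i ⊗ₜ y - y ⊗ₜ D.e i) + ⁅D.e i, D.del y⁆ := by
  rw [D.del_lie (D.e_mem i) hy, D.del_e, lie_zero, sub_zero]

lemma ND.del_swap (x : N) : TensorProduct.comm ℂ N N (D.del x) = - D.del x := by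
  have hs : ∀ (z : N) (t : N ⊗[ℂ] N), TensorProduct.comm ℂ N N ⁅z, t⁆ = ⁅z, TensorProduct.comm ℂ N N t⁆ := by
    intro z t
    induction t with
    | zero => simp
    | tmul a b => simp [LieModule.lie_tmul_right, add_comm]
    | add a b ha hb => simp [ha, hb]
  refine D.mono_ext ((TensorProduct.comm ℂ N N).toLinearMap ∘ₗ D.del) (-D.del) (fun β x h => ?_) x
  induction h with
  | base i => simp [D.del_e]
  | step i h ih =>
    simp only [LinearMap.comp_apply, LinearEquiv.coe_coe, LinearMap.neg_apply] at ih ⊢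
    rw [D.del_step i h.mem, map_add, hs, ih]
    simp
    module

lemma ND.bra_del {β : Wt} {x : N} (hx : x ∈ D.W β) :
    LieModule.toModuleHom ℂ N N (D.del x) = ((B β β - ∑ i, β i * AA i i : ℤ) : ℂ) • x := by
  rw [D.W_eq] at hx
  induction hx using Submodule.span_induction with
  | zero => simp
  | add a b _ _ ha hb => simp only [map_add, ha, hb, smul_add]
  | smul t a _ ha => rw [map_smul, map_smul, ha, smul_comm]
  | mem x h =>
    replace h : D.Mono β x := h
    induction h with
    | base i =>
      have : ∑ j, sr i j * AA j j = AA i i := by simp [sr, Pi.single_apply]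
      rw [D.del_e, map_zero, B_sr_sr, this]; simp
    | @step j γ x h ih =>
      rw [D.del_step j h.mem, map_add, LieModuleHom.map_lie, ih, map_smul, map_sub]
      simp only [LieModule.toModuleHom_apply, B_add_left, B_add_right, B_sr_sr, B_symm γ (sr j),
        Pi.add_apply, add_mul, Finset.sum_add_distrib]
      rw [← lie_skew x (D.e j)]
      have : ∑ i, sr j i * AA i i = AA j j := by simp [sr, Pi.single_apply]
      rw [this, lie_smul]; push_cast; module
end KMW
open scoped TensorProduct
namespace KMW
open LieAlgebra TensorProduct
variable {N : Type} [LieRing N] [LieAlgebra ℂ N] (D : ND N)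

noncomputable def ND.m (β : Wt) : ℕ := Module.finrank ℂ (D.W β)
abbrev ND.K := Σ β : Wt, Fin (D.m β)
lemma ND.internal : DirectSum.IsInternal D.W :=
  (DirectSum.isInternal_submodule_iff_iSupIndep_and_iSup_eq_top _).2 ⟨D.indep, D.iSup_W⟩
noncomputable def ND.b : Module.Basis D.K ℂ N := D.internal.collectedBasis fun β => Module.finBasis ℂ (D.W β)
lemma ND.b_mem (k : D.K) : D.b k ∈ D.W k.1 := D.internal.collectedBasis_mem _ k
noncomputable abbrev ND.co (k : D.K) : N →ₗ[ℂ] ℂ := D.b.coord k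
lemma ND.co_ne {β : Wt} {x : N} (hx : x ∈ D.W β) {k : D.K} (h : k.1 ≠ β) : D.co k x = 0 := by
  obtain ⟨j, a⟩ := k
  exact D.internal.collectedBasis_repr_of_mem_ne (fun β => Module.finBasis ℂ (D.W β)) h.symm hx
lemma ND.m_pos (k : D.K) : D.m k.1 ≠ 0 := fun h => by
  have := k.2.2; omega
lemma ND.m_zero {β : Wt} (h : ¬ (0 ≤ β ∧ 1 ≤ ∑ i, β i)) : D.m β = 0 := by
  unfold ND.m; rw [D.W_bot h]; simp
lemma ND.expand {β : Wt} {x : N} (hx : x ∈ D.W β) :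
    ∑ a : Fin (D.m β), D.co ⟨β, a⟩ x • D.b ⟨β, a⟩ = x := by
  apply D.b.ext_elem
  rintro ⟨γ, c⟩
  simp only [map_sum, map_smul, Finsupp.coe_finsetSum, Finset.sum_apply, Finsupp.smul_apply, Module.Basis.repr_self]
  by_cases h : γ = β
  · subst h
    rw [Finset.sum_eq_single c]
    · simp
    · intro a _ hac; rw [Finsupp.single_eq_of_ne (by simpa using hac.symm)]; simp
    · simp
  · have := D.co_ne hx (k := ⟨γ, c⟩) h
    rw [Module.Basis.coord_apply] at this
    rw [this, Finset.sum_eq_zero]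
    intro a _; rw [Finsupp.single_eq_of_ne (by intro h'; exact h (congrArg Sigma.fst h'))]; simp

noncomputable def ND.co2 (k l : D.K) : N ⊗[ℂ] N →ₗ[ℂ] ℂ :=
  LinearMap.mul' ℂ ℂ ∘ₗ TensorProduct.map (D.co k) (D.co l)
@[simp] lemma ND.co2_tmul (k l : D.K) (x y : N) : D.co2 k l (x ⊗ₜ y) = D.co k x * D.co l y := by
  simp [ND.co2]
lemma ND.co2_comm (k l : D.K) (t : N ⊗[ℂ] N) : D.co2 k l (TensorProduct.comm ℂ N N t) = D.co2 l k t := by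
  induction t with
  | zero => simp
  | tmul a b => simp [mul_comm]
  | add a b ha hb => simp only [map_add, ha, hb]
lemma ND.co_b (k l : D.K) : D.co k (D.b l) = if k = l then 1 else 0 := by
  classical
  rw [Module.Basis.coord_apply, Module.Basis.repr_self, Finsupp.single_apply]; simp [eq_comm]
lemma ND.del_swap2 (k l : D.K) (x : N) : D.co2 k l (D.del x) = - D.co2 l k (D.del x) := by
  rw [← D.co2_comm, D.del_swap]; simp

noncomputable def ND.T (α γ : Wt) : ℂ := ∑ a : Fin (D.m α), ∑ c : Fin (D.m γ),
  D.co2 ⟨α, a⟩ ⟨γ, c⟩ (D.del ⁅D.b ⟨α, a⟩, D.b ⟨γ, c⟩⁆)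
lemma ND.T_symm (α γ : Wt) : D.T α γ = D.T γ α := by
  unfold ND.T; rw [Finset.sum_comm]
  refine Finset.sum_congr rfl fun c _ => Finset.sum_congr rfl fun a _ => ?_
  rw [D.del_swap2, ← lie_skew, map_neg, map_neg, neg_neg]
lemma ND.T_left {α γ : Wt} (h : D.m α = 0) : D.T α γ = 0 := by
  have : IsEmpty (Fin (D.m α)) := by rw [h]; infer_instance
  simp [ND.T]
lemma ND.T_add {α γ : Wt} (h : D.m (α + γ) = 0) : D.T α γ = 0 := by
  refine Finset.sum_eq_zero fun a _ => Finset.sum_eq_zero fun c _ => ?_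
  have h1 := D.lie_mem (D.b_mem ⟨α, a⟩) (D.b_mem ⟨γ, c⟩)
  rw [Submodule.finrank_eq_zero.1 (show Module.finrank ℂ (D.W (α + γ)) = 0 from h), Submodule.mem_bot] at h1
  rw [h1]; simp
lemma ND.co_lie (k u : D.K) : D.co k ⁅D.b k, D.b u⁆ = 0 := by
  refine D.co_ne (D.lie_mem (D.b_mem k) (D.b_mem u)) fun h => D.m_pos u (D.m_zero ?_)
  rw [left_eq_add.1 h]; simp
lemma ND.term1 (α γ : Wt) (a : Fin (D.m α)) (c : Fin (D.m γ)) (t : N ⊗[ℂ] N) :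
    D.co2 ⟨α, a⟩ ⟨γ, c⟩ ⁅D.b ⟨α, a⟩, t⁆ = ∑ v : Fin (D.m (γ - α)),
      D.co ⟨γ, c⟩ ⁅D.b ⟨α, a⟩, D.b ⟨γ - α, v⟩⁆ * D.co2 ⟨α, a⟩ ⟨γ - α, v⟩ t := by
  let f : N ⊗[ℂ] N →ₗ[ℂ] ℂ := D.co2 ⟨α, a⟩ ⟨γ, c⟩ ∘ₗ (LieModule.toEnd ℂ N (N ⊗[ℂ] N) (D.b ⟨α, a⟩))
  let g : N ⊗[ℂ] N →ₗ[ℂ] ℂ := ∑ v : Fin (D.m (γ - α)),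
      D.co ⟨γ, c⟩ ⁅D.b ⟨α, a⟩, D.b ⟨γ - α, v⟩⁆ • D.co2 ⟨α, a⟩ ⟨γ - α, v⟩
  have : f = g := by
    refine (D.b.tensorProduct D.b).ext ?_
    rintro ⟨k, l⟩
    simp only [f, g, LinearMap.comp_apply, Module.Basis.tensorProduct_apply, LieModule.toEnd_apply_apply,
      LieModule.lie_tmul_right, map_add, D.co2_tmul, D.co_lie, zero_mul, zero_add, D.co_b,
      LinearMap.sum_apply, LinearMap.smul_apply, smul_eq_mul]
    by_cases hk : (⟨α, a⟩ : D.K) = k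
    · subst hk
      simp only [if_true, one_mul]
      obtain ⟨μ, l⟩ := l
      by_cases hl : μ = γ - α
      · subst hl; simp
      · rw [D.co_ne (D.lie_mem (D.b_mem _) (D.b_mem _)) (by
          simp only [ne_eq]; intro h; apply hl; rw [h]; abel), Finset.sum_eq_zero]
        intro v _; rw [if_neg]; · simp
        intro h; exact hl (congrArg Sigma.fst h).symm
    · simp [hk]
  have h2 := congrArg (fun f => f t) this
  simpa [f, g] using h2
lemma ND.term1_sum (α γ : Wt) : ∑ a : Fin (D.m α), ∑ c : Fin (D.m γ),
    D.co2 ⟨α, a⟩ ⟨γ, c⟩ ⁅D.b ⟨α, a⟩, D.del (D.b ⟨γ, c⟩)⁆ = D.T α (γ - α) := by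
  unfold ND.T
  refine Finset.sum_congr rfl fun a _ => ?_
  simp only [D.term1]
  rw [Finset.sum_comm]
  refine Finset.sum_congr rfl fun v _ => ?_
  conv_rhs => rw [← D.expand (β := γ) (x := ⁅D.b ⟨α, a⟩, D.b ⟨γ - α, v⟩⁆) (by
    have := D.lie_mem (D.b_mem ⟨α, a⟩) (D.b_mem ⟨γ - α, v⟩)
    simpa using this)]
  simp [map_sum]
lemma ND.T_rec (α γ : Wt) : D.T α γ = D.T α (γ - α) + D.T (α - γ) γ +
    B α γ * (D.m α * D.m γ - if α = γ then (D.m α : ℂ) else 0) := by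
  have h1 := D.term1_sum α γ
  have h2 := D.term1_sum γ α
  rw [D.T_symm (α - γ), ← h1, ← h2, Finset.sum_comm (s := (Finset.univ : Finset (Fin (D.m γ)))),
    ← Finset.sum_add_distrib]
  have h3 : (B α γ * (D.m α * D.m γ - if α = γ then (D.m α : ℂ) else 0) : ℂ) = 
     ∑ a : Fin (D.m α), ∑ c : Fin (D.m γ), (B α γ : ℂ) * (1 - if (⟨α, a⟩ : D.K) = ⟨γ, c⟩ then 1 else 0) := by
    simp only [← Finset.mul_sum, Finset.sum_sub_distrib]
    congr 1
    by_cases h : α = γ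
    · subst h; simp
    · have : ∀ a c, ¬ ((⟨α, a⟩ : D.K) = ⟨γ, c⟩) := fun a c h' => h (congrArg Sigma.fst h')
      simp [h, this]
  rw [h3, ← Finset.sum_add_distrib]
  refine Finset.sum_congr rfl fun a _ => ?_
  rw [← Finset.sum_add_distrib, ← Finset.sum_add_distrib]
  refine Finset.sum_congr rfl fun c _ => ?_
  rw [D.del_lie (D.b_mem _) (D.b_mem _)]
  have h4 : D.co2 ⟨γ, c⟩ ⟨α, a⟩ ⁅D.b ⟨γ, c⟩, D.del (D.b ⟨α, a⟩)⁆ = 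
     - D.co2 ⟨α, a⟩ ⟨γ, c⟩ ⁅D.b ⟨γ, c⟩, D.del (D.b ⟨α, a⟩)⁆ := by
    have hs : ∀ (z : N) (t : N ⊗[ℂ] N), TensorProduct.comm ℂ N N ⁅z, t⁆ = ⁅z, TensorProduct.comm ℂ N N t⁆ := by
      intro z t
      induction t with
      | zero => simp
      | tmul a b => simp [LieModule.lie_tmul_right, add_comm]
      | add a b ha hb => simp [ha, hb]
    rw [← D.co2_comm, hs, D.del_swap]; simp
  rw [h4]
  simp only [map_sub, map_add, map_smul, D.co2_tmul, D.co_b, smul_eq_mul, if_true]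
  have h5 : ((⟨γ, c⟩ : D.K) = ⟨α, a⟩) ↔ ((⟨α, a⟩ : D.K) = ⟨γ, c⟩) := eq_comm
  simp only [h5]
  split_ifs <;> ring
lemma ND.T_sum (β : Wt) : ∑ α ∈ Finset.Icc 0 β, D.T α (β - α) = 
    ((B β β - ∑ i, β i * AA i i : ℤ) : ℂ) * D.m β := by
  have key : ∀ (c : Fin (D.m β)) (t : N ⊗[ℂ] N), D.co ⟨β, c⟩ (LieModule.toModuleHom ℂ N N t) =
      ∑ α ∈ Finset.Icc 0 β, ∑ a : Fin (D.m α), ∑ v : Fin (D.m (β - α)),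
        D.co ⟨β, c⟩ ⁅D.b ⟨α, a⟩, D.b ⟨β - α, v⟩⁆ * D.co2 ⟨α, a⟩ ⟨β - α, v⟩ t := by
    intro c t
    let f : N ⊗[ℂ] N →ₗ[ℂ] ℂ := D.co ⟨β, c⟩ ∘ₗ (LieModule.toModuleHom ℂ N N).toLinearMap
    let g : N ⊗[ℂ] N →ₗ[ℂ] ℂ := ∑ α ∈ Finset.Icc 0 β, ∑ a : Fin (D.m α), ∑ v : Fin (D.m (β - α)),
        D.co ⟨β, c⟩ ⁅D.b ⟨α, a⟩, D.b ⟨β - α, v⟩⁆ • D.co2 ⟨α, a⟩ ⟨β - α, v⟩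
    have : f = g := by
      refine (D.b.tensorProduct D.b).ext ?_
      rintro ⟨⟨μ, k⟩, ⟨ν, l⟩⟩
      simp only [f, g, LinearMap.comp_apply, Module.Basis.tensorProduct_apply, D.co2_tmul, D.co_b,
        LinearMap.sum_apply, LinearMap.smul_apply, smul_eq_mul, LieModuleHom.coe_toLinearMap,
        LieModule.toModuleHom_apply]
      have hμ := not_not.1 (mt D.m_zero (D.m_pos ⟨μ, k⟩))
      have hν := not_not.1 (mt D.m_zero (D.m_pos ⟨ν, l⟩))
      by_cases h : ν = β - μ
      · subst h
        rw [Finset.sum_eq_single μ]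
        · simp
        · intro α _ hα
          refine Finset.sum_eq_zero fun a _ => Finset.sum_eq_zero fun v _ => ?_
          rw [if_neg (fun h' => hα (congrArg Sigma.fst h'))]; simp
        · intro h; exact absurd (Finset.mem_Icc.2 ⟨hμ.1, sub_nonneg.1 hν.1⟩) h
      · rw [D.co_ne (D.lie_mem (D.b_mem _) (D.b_mem _)) (by
          simp only [ne_eq]; intro h'; apply h; rw [h']; abel)]
        symm
        refine Finset.sum_eq_zero fun α _ => Finset.sum_eq_zero fun a _ => Finset.sum_eq_zero fun v _ => ?_
        by_cases h1 : (⟨α, a⟩ : D.K) = ⟨μ, k⟩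
        · have h2 : ¬ (⟨β - α, v⟩ : D.K) = ⟨ν, l⟩ := fun h2 => h (by
            have e1 := congrArg Sigma.fst h1
            have e2 := congrArg Sigma.fst h2
            dsimp only at e1 e2; rw [← e1, ← e2])
          simp [h2]
        · simp [h1]
    have h2 := congrArg (fun f => f t) this
    simpa [f, g] using h2
  have h1 : ((B β β - ∑ i, β i * AA i i : ℤ) : ℂ) * D.m β =
      ∑ c : Fin (D.m β), D.co ⟨β, c⟩ (LieModule.toModuleHom ℂ N N (D.del (D.b ⟨β, c⟩))) := by
    have : ∀ c : Fin (D.m β), D.co ⟨β, c⟩ (LieModule.toModuleHom ℂ N N (D.del (D.b ⟨β, c⟩))) = 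
       ((B β β - ∑ i, β i * AA i i : ℤ) : ℂ) := fun c => by
      rw [D.bra_del (D.b_mem _), map_smul, D.co_b]; simp
    rw [Finset.sum_congr rfl fun c _ => this c, Finset.sum_const, Finset.card_univ,
      Fintype.card_fin, nsmul_eq_mul, mul_comm]
  rw [h1]
  simp only [key]
  rw [Finset.sum_comm]
  refine Finset.sum_congr rfl fun α _ => ?_
  rw [Finset.sum_comm]
  refine Finset.sum_congr rfl fun a _ => ?_
  rw [Finset.sum_comm]
  refine Finset.sum_congr rfl fun v _ => ?_
  conv_lhs => rw [← D.expand (β := β) (x := ⁅D.b ⟨α, a⟩, D.b ⟨β - α, v⟩⁆) (by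
    have := D.lie_mem (D.b_mem ⟨α, a⟩) (D.b_mem ⟨β - α, v⟩)
    simpa using this)]
  simp [map_sum]
end KMW
open scoped TensorProduct
namespace KMW
open LieAlgebra TensorProduct
variable {N : Type} [LieRing N] [LieAlgebra ℂ N] (D : ND N)

lemma ND.W_ind {β : Wt} {x : N} (hx : x ∈ D.W β) (P : Submodule ℂ N) (h : ∀ x, D.Mono β x → x ∈ P) : x ∈ P := by
  rw [D.W_eq] at hx
  exact Submodule.span_le.2 h hx

noncomputable def ND.F (i : I) : N →ₗ[ℂ] N :=
  (TensorProduct.lid ℂ N).toLinearMap ∘ₗ TensorProduct.map (D.eps i) LinearMap.id ∘ₗ D.del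
lemma ND.F_lie (i j : I) {β : Wt} {x : N} (hx : x ∈ D.W β) : D.F i ⁅D.e j, x⁆ =
    ⁅D.e j, D.F i x⁆ + (B (sr j) β : ℂ) • ((if j = i then x else 0) - D.eps i x • D.e j) := by
  have h : ∀ t : N ⊗[ℂ] N, TensorProduct.lid ℂ N (TensorProduct.map (D.eps i) LinearMap.id ⁅D.e j, t⁆) =
      ⁅D.e j, TensorProduct.lid ℂ N (TensorProduct.map (D.eps i) LinearMap.id t)⁆ := by
    intro t
    induction t with
    | zero => simp
    | tmul a b => simp [LieModule.lie_tmul_right, D.eps_lie]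
    | add a b ha hb => simp only [lie_add, map_add, ha, hb]
  simp only [ND.F, LinearMap.comp_apply, LinearEquiv.coe_coe]
  rw [D.del_step j hx, map_add, map_add, h, add_comm, map_smul, map_smul, map_sub, map_sub]
  simp [D.eps_e]
lemma ND.eps_zero (i : I) {β : Wt} {x : N} (hx : x ∈ D.W β) (h : β ≠ sr i) : D.eps i x = 0 := by
  refine D.W_ind hx (LinearMap.ker (D.eps i)) fun x hm => ?_
  rw [LinearMap.mem_ker]
  cases hm with
  | base j => rw [D.eps_e, if_neg]; rintro rfl; exact h rfl
  | step j _ => rw [D.eps_lie]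
lemma ND.F_lie' (i j : I) {β : Wt} {x : N} (hx : x ∈ D.W β) (h : β ≠ sr i) : D.F i ⁅D.e j, x⁆ =
    ⁅D.e j, D.F i x⁆ + if j = i then (B (sr j) β : ℂ) • x else 0 := by
  rw [D.F_lie i j hx, D.eps_zero i hx h]; split_ifs <;> simp
lemma ND.F_e (i j : I) : D.F i (D.e j) = 0 := by simp [ND.F, D.del_e]
lemma ND.F_mem (i : I) {β : Wt} {x : N} (hx : x ∈ D.W β) : D.F i x ∈ D.W (β - sr i) := by
  refine D.W_ind hx ((D.W (β - sr i)).comap (D.F i)) fun x hm => ?_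
  rw [Submodule.mem_comap]
  clear hx
  induction hm with
  | base j => rw [D.F_e]; exact zero_mem _
  | @step j γ x h ih =>
    rw [D.F_lie i j h.mem]
    refine add_mem ?_ (Submodule.smul_mem _ _ (sub_mem ?_ ?_))
    · have := D.lie_mem (D.e_mem j) ih; rwa [← add_sub_assoc] at this
    · split_ifs with hj
      · subst hj; simpa using h.mem
      · exact zero_mem _
    · by_cases h0 : γ = sr i
      · subst h0; simpa using Submodule.smul_mem _ _ (D.e_mem j)
      · rw [D.eps_zero i h.mem h0, zero_smul]; exact zero_mem _

lemma sl2_inj {M : Type} [AddCommGroup M] [Module ℂ M] (V : ℤ → Submodule ℂ M) [∀ k, Module.Finite ℂ (V k)]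
    (E F : Module.End ℂ M) (h0 : ℤ) (hE : ∀ k, ∀ x ∈ V k, E x ∈ V (k + 1)) (hF : ∀ k, ∀ x ∈ V k, F x ∈ V (k - 1))
    (hFE : ∀ k, ∀ x ∈ V k, F (E x) = E (F x) + ((h0 + 2 * k : ℤ) : ℂ) • x)
    (nF : ∀ k, ∀ x ∈ V k, ∃ n : ℕ, (F ^ n) x = 0) (k : ℤ) (p : ℕ) (hp : h0 + 2 * k = - p) :
    Module.finrank ℂ (V k) ≤ Module.finrank ℂ (V (k + p)) := by
  have hEn : ∀ (n : ℕ) k, ∀ x ∈ V k, (E ^ n) x ∈ V (k + n) := by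
    intro n; induction n with
    | zero => intro k x hx; simpa using hx
    | succ n ih => intro k x hx; rw [pow_succ']; have := hE _ _ (ih k x hx); push_cast; rwa [← add_assoc]
  have hFn : ∀ (n : ℕ) k, ∀ x ∈ V k, (F ^ n) x ∈ V (k - n) := by
    intro n; induction n with
    | zero => intro k x hx; simpa using hx
    | succ n ih => intro k x hx; rw [pow_succ']; have := hF _ _ (ih k x hx); push_cast; rwa [← sub_sub]
  have key : ∀ (j : ℕ), ∀ x ∈ V k, F ((E ^ (j + 1)) x) = (E ^ (j + 1)) (F x) + (((j + 1) * (j - p) : ℤ) : ℂ) • (E ^ j) x := by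
    intro j x hx
    induction j with
    | zero => simp [hFE k x hx, hp]
    | succ j ih =>
      rw [pow_succ', Module.End.mul_apply, hFE _ _ (hEn (j + 1) k x hx), ih, Module.End.mul_apply,
        map_add, map_smul, ← Module.End.mul_apply E (E ^ j), ← pow_succ', add_assoc, ← add_smul]
      congr 2
      have : h0 + 2 * (k + (j + 1 : ℕ)) = - p + 2 * (j + 1) := by push_cast; linarith
      rw [this]; push_cast; ring
  have hinj : V k ⊓ LinearMap.ker (E ^ p) = ⊥ := by
    by_contra hU
    set U := V k ⊓ LinearMap.ker (E ^ p) with hUdef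
    have hC : ∀ x ∈ U, (E * F) x ∈ U := by
      rintro x ⟨hx, hx'⟩
      refine ⟨?_, ?_⟩
      · have := hE _ _ (hF _ _ hx); simpa using this
      · rw [SetLike.mem_coe, LinearMap.mem_ker] at hx' ⊢
        rcases p with _ | q
        · simp at hx'; simp [hx']
        · have := key q x hx
          rw [hx', map_zero] at this
          rw [← Module.End.mul_apply, ← mul_assoc, ← pow_succ, pow_succ', mul_assoc, Module.End.mul_apply, Module.End.mul_apply,
            eq_neg_of_add_eq_zero_left this.symm, map_neg, map_smul, ← Module.End.mul_apply, ← pow_succ', hx']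
          simp
    have : Nontrivial U := Submodule.nontrivial_iff_ne_bot.2 hU
    have : Module.Finite ℂ U := Submodule.finiteDimensional_of_le (inf_le_left : U ≤ V k)
    obtain ⟨lam, hl⟩ := Module.End.exists_eigenvalue ((E * F).restrict hC)
    obtain ⟨⟨x, hx⟩, hx1⟩ := hl.exists_hasEigenvector
    have hx0 : x ≠ 0 := fun h => hx1.2 (by simpa using h)
    have hlam : E (F x) = lam • x := by
      have := congrArg Subtype.val hx1.apply_eq_smul
      simpa using this
    have h1 : ∃ j : ℕ, (E ^ (j + 1)) x = 0 ∧ (E ^ j) x ≠ 0 ∧ j < p := by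
      have hex : ∃ n, (E ^ n) x = 0 := ⟨p, hx.2⟩
      classical
      obtain ⟨j, hj⟩ : ∃ j, Nat.find hex = j + 1 := Nat.exists_eq_succ_of_ne_zero (fun h => hx0 (by
        have := Nat.find_spec hex; rw [h] at this; simpa using this))
      refine ⟨j, hj ▸ Nat.find_spec hex, Nat.find_min hex (by omega), ?_⟩
      have := Nat.find_min' hex hx.2; omega
    have h2 : ∃ r : ℕ, (F ^ (r + 1)) x = 0 ∧ (F ^ r) x ≠ 0 := by
      have hex := nF k x hx.1
      classical
      obtain ⟨j, hj⟩ : ∃ j, Nat.find hex = j + 1 := Nat.exists_eq_succ_of_ne_zero (fun h => hx0 (by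
        have := Nat.find_spec hex; rw [h] at this; simpa using this))
      exact ⟨j, hj ▸ Nat.find_spec hex, Nat.find_min hex (by omega)⟩
    obtain ⟨j, hj1, hj2, hj3⟩ := h1
    obtain ⟨r, hr1, hr2⟩ := h2
    have e1 : lam + (((j + 1) * (j - p) : ℤ) : ℂ) = 0 := by
      have := key j x hx.1
      rw [hj1, map_zero, pow_succ, Module.End.mul_apply, hlam, map_smul, ← add_smul] at this
      exact (smul_eq_zero.1 this.symm).resolve_right hj2
    have e2 : ∀ r : ℕ, E ((F ^ (r + 1)) x) = (lam + ((r * (p + r + 1) : ℤ) : ℂ)) • (F ^ r) x := by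
      intro r
      induction r with
      | zero => simp [hlam]
      | succ r ih =>
        have := hFE _ _ (hFn (r + 1) k x hx.1)
        rw [ih, map_smul, ← Module.End.mul_apply F, ← Module.End.mul_apply F, ← pow_succ', ← pow_succ'] at this
        rw [eq_comm, ← eq_sub_iff_add_eq] at this
        rw [this, ← sub_smul]
        congr 1
        have : h0 + 2 * (k - (r + 1 : ℕ)) = - p - 2 * (r + 1) := by push_cast; linarith
        rw [this]; push_cast; ring
    have e3 := e2 r
    rw [hr1, map_zero] at e3
    have e4 := (smul_eq_zero.1 e3.symm).resolve_right hr2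
    have e5 : (((j + 1) * (j - p) : ℤ) : ℂ) = ((r * (p + r + 1) : ℤ) : ℂ) := by linear_combination e1 - e4
    have e6 : ((j : ℤ) + 1) * (j - p) = r * (p + r + 1) := by exact_mod_cast e5
    have e7 : ((j : ℤ) + 1) * (j - p) < 0 := mul_neg_of_pos_of_neg (by positivity) (by omega)
    have e8 : (0 : ℤ) ≤ r * (p + r + 1) := by positivity
    omega
  refine LinearMap.finrank_le_finrank_of_injective (f := (E ^ p).restrict (hEn p k)) ?_
  rw [← LinearMap.ker_eq_bot, eq_bot_iff]
  rintro ⟨x, hx⟩ hx'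
  have : x ∈ V k ⊓ LinearMap.ker (E ^ p) := ⟨hx, by simpa [LinearMap.restrict_apply] using hx'⟩
  rw [hinj] at this
  simpa using this
end KMW
open scoped TensorProduct
namespace KMW
open LieAlgebra TensorProduct
variable {N : Type} [LieRing N] [LieAlgebra ℂ N] (D : ND N)

lemma sr_apply (i j : I) : sr i j = if j = i then 1 else 0 := by simp [sr, Pi.single_apply]
lemma ND.mono_mult (i : I) {β : Wt} {x : N} (h : D.Mono β x) (hk : ∀ k, k ≠ i → β k = 0) : (β = sr i ∧ x = D.e i) ∨ x = 0 := by
  induction h with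
  | base j =>
    by_cases hj : j = i
    · subst hj; exact Or.inl ⟨rfl, rfl⟩
    · have := hk j hj; rw [sr_apply, if_pos rfl] at this; omega
  | @step j γ x h ih =>
    right
    have hg := h.nonneg.1
    have h1 : ∀ k, k ≠ i → sr j k = 0 ∧ γ k = 0 := fun k hk' => by
      have a := hk k hk'; have b := sr_nonneg j k; have c := hg k
      simp only [Pi.add_apply, Pi.zero_apply] at a b c; omega
    have hj : j = i := by
      by_contra hj; have := (h1 j hj).1; rw [sr_apply, if_pos rfl] at this; omega
    subst hj
    rcases ih fun k hk => (h1 k hk).2 with ⟨-, rfl⟩ | rfl <;> simp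
lemma ND.e_ne (i : I) : D.e i ≠ 0 := fun h => by
  have := D.eps_e i i; rw [h] at this; simp at this
lemma ND.m_sr (i : I) : D.m (sr i) = 1 := by
  have : D.W (sr i) = Submodule.span ℂ {D.e i} := by
    refine le_antisymm (fun x hx => ?_) (by rw [Submodule.span_singleton_le_iff_mem]; exact D.e_mem i)
    refine D.W_ind hx _ fun x hm => ?_
    rcases D.mono_mult i hm fun k hk => by rw [sr_apply, if_neg hk] with ⟨-, rfl⟩ | rfl
    · exact Submodule.mem_span_singleton_self _
    · exact zero_mem _
  rw [ND.m, this, finrank_span_singleton (D.e_ne i)]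
lemma ND.m_mult (i : I) {β : Wt} (hk : ∀ k, k ≠ i → β k = 0) (h : β ≠ sr i) : D.m β = 0 := by
  have : D.W β = ⊥ := by
    rw [eq_bot_iff]; intro x hx
    refine D.W_ind hx _ fun x hm => ?_
    rcases D.mono_mult i hm hk with ⟨h', rfl⟩ | rfl
    · exact absurd h' h
    · exact zero_mem _
  rw [ND.m, this, finrank_bot]
lemma ND.E_nil (i : Fin 10) {β : Wt} (h0 : β none = 0) {x : N} (hx : x ∈ D.W β) : ∃ n : ℕ, ((ad ℂ N (D.e (some i))) ^ n) x = 0 := by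
  rw [← LieSubalgebra.mem_engel_iff]
  refine D.W_ind hx (LieSubalgebra.engel ℂ (D.e (some i))).toSubmodule fun x hm => ?_
  clear hx
  have he : ∀ j : I, j ≠ none → D.e j ∈ LieSubalgebra.engel ℂ (D.e (some i)) := by
    intro j hj
    obtain ⟨j, rfl⟩ := Option.ne_none_iff_exists'.1 hj
    rw [LieSubalgebra.mem_engel_iff]
    by_cases hij : i = j
    · subst hij; exact ⟨1, by simp⟩
    · rcases AE_cases i j hij with h | h
      · exact ⟨1, by simpa using (D.serre i j hij).1 h⟩
      · exact ⟨2, by simpa [pow_two] using (D.serre i j hij).2 h⟩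
  induction hm with
  | base j => exact he j (by rintro rfl; simp [sr_apply] at h0)
  | @step j γ x h ih =>
    have a := h.nonneg.1 none; have b := sr_nonneg j none
    simp only [Pi.add_apply, Pi.zero_apply] at a b h0
    exact LieSubalgebra.lie_mem _ (he j (by rintro rfl; rw [sr_apply, if_pos rfl] at h0; omega)) (ih (by omega))

lemma B_smul_right (α γ : Wt) (k : ℤ) : B α (k • γ) = k * B α γ := by
  simp only [B, Pi.smul_apply, smul_eq_mul, Finset.mul_sum]; refine Finset.sum_congr rfl fun i _ => Finset.sum_congr rfl fun j _ => by ring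

lemma ND.refl_le (i : Fin 10) {β : Wt} (h0 : β none = 0) (hk : ∃ k, k ≠ some i ∧ β k ≠ 0) :
    D.m β ≤ D.m (β - B (sr (some i)) β • sr (some i)) := by
  obtain ⟨k0, hk0, hk1⟩ := hk
  have hne : ∀ k : ℤ, β + k • sr (some i) ≠ sr (some i) := fun k h => hk1 (by
    have := congrFun h k0; simpa [sr_apply, hk0] using this)
  have hB : ∀ k : ℤ, B (sr (some i)) (β + k • sr (some i)) = B (sr (some i)) β + 2 * k := fun k => by
    rw [B_add_right, B_smul_right, B_sr_sr, AA_diag]; ring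
  have hn : ∀ k : ℤ, (β + k • sr (some i)) none = 0 := fun k => by simp [sr_apply, h0]
  have hE : ∀ k : ℤ, ∀ x ∈ D.W (β + k • sr (some i)), ad ℂ N (D.e (some i)) x ∈ D.W (β + (k + 1) • sr (some i)) := fun k x hx => by
    have := D.lie_mem (D.e_mem (some i)) hx
    rw [show β + (k + 1) • sr (some i) = sr (some i) + (β + k • sr (some i)) by module]; exact this
  have hF : ∀ k : ℤ, ∀ x ∈ D.W (β + k • sr (some i)), D.F (some i) x ∈ D.W (β + (k - 1) • sr (some i)) := fun k x hx => by
    have := D.F_mem (some i) hx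
    rw [show β + (k - 1) • sr (some i) = (β + k • sr (some i)) - sr (some i) by module]; exact this
  have hFE : ∀ k : ℤ, ∀ x ∈ D.W (β + k • sr (some i)), D.F (some i) (ad ℂ N (D.e (some i)) x) = 
      ad ℂ N (D.e (some i)) (D.F (some i) x) + ((B (sr (some i)) β + 2 * k : ℤ) : ℂ) • x := fun k x hx => by
    rw [ad_apply, D.F_lie' _ _ hx (hne k), if_pos rfl, hB, ad_apply]
  have nF : ∀ k : ℤ, ∀ x ∈ D.W (β + k • sr (some i)), ∃ n : ℕ, ((D.F (some i) : Module.End ℂ N) ^ n) x = 0 := fun k x hx => by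
    have hFn : ∀ (n : ℕ), ((D.F (some i) : Module.End ℂ N) ^ n) x ∈ D.W (β + (k - n) • sr (some i)) := by
      intro n; induction n with
      | zero => simpa using hx
      | succ n ih => rw [pow_succ']; have := hF _ _ ih; push_cast; rwa [← sub_sub]
    refine ⟨(β (some i) + k + 1).toNat, ?_⟩
    have := hFn (β (some i) + k + 1).toNat
    rw [D.W_bot] at this
    · simpa using this
    · rintro ⟨h, -⟩
      have := h (some i)
      simp [sr_apply] at this; omega
  rcases le_total (B (sr (some i)) β) 0 with h | h
  · obtain ⟨p, hp⟩ := Int.eq_ofNat_of_zero_le (neg_nonneg.2 h)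
    have : D.m (β + (0 : ℤ) • sr (some i)) ≤ D.m (β + (0 + p : ℤ) • sr (some i)) := sl2_inj (fun k : ℤ => D.W (β + k • sr (some i))) _ _ _ hE hF hFE nF 0 p (by omega)
    simp only [zero_smul, add_zero, zero_add] at this
    rw [← hp, neg_smul, ← sub_eq_add_neg] at this
    exact this
  · obtain ⟨p, hp⟩ := Int.eq_ofNat_of_zero_le h
    have : D.m (β + (-0 : ℤ) • sr (some i)) ≤ D.m (β + (-(0 + p) : ℤ) • sr (some i)) := sl2_inj (fun k : ℤ => D.W (β + (-k) • sr (some i))) (D.F (some i)) (ad ℂ N (D.e (some i))) (-B (sr (some i)) β)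
      (fun k x hx => by rw [neg_add, ← sub_eq_add_neg]; exact hF _ _ hx)
      (fun k x hx => by rw [neg_sub, sub_eq_neg_add]; exact hE _ _ hx)
      (fun k x hx => by rw [hFE _ _ hx, add_assoc, ← add_smul]; push_cast; ring_nf; simp)
      (fun k x hx => D.E_nil i (hn _) hx) 0 p (by omega)
    simp only [neg_zero, zero_smul, add_zero, zero_add] at this
    rw [← hp, neg_smul, ← sub_eq_add_neg] at this
    exact this
lemma ND.refl (i : Fin 10) {β : Wt} (h0 : β none = 0) (hk : ∃ k, k ≠ some i ∧ β k ≠ 0) :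
    D.m (β - B (sr (some i)) β • sr (some i)) = D.m β := by
  refine le_antisymm ?_ (D.refl_le i h0 hk)
  obtain ⟨k, hk0, hk1⟩ := hk
  have := D.refl_le i (β := β - B (sr (some i)) β • sr (some i)) (by simp [sr_apply, h0]) ⟨k, hk0, by simp [sr_apply, hk0, hk1]⟩
  refine this.trans_eq ?_
  congr 1
  rw [sub_eq_add_neg β, ← neg_smul, B_add_right, B_smul_right, B_sr_sr, AA_diag]
  module
end KMW
open scoped TensorProduct
namespace KMW
set_option linter.unusedVariables false
open LieAlgebra TensorProduct

lemma AE_symm : ∀ i j : Fin 10, AE10 i j = AE10 j i := fun i j => AA_symm (some i) (some j)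
lemma AE_diag (i : Fin 10) : AE10 i i = 2 := AA_diag i
section chev
variable {L : Type} [LieRing L] [LieAlgebra ℂ L] {e f h : Fin 10 → L}
lemma chev0 (hef : ∀ i j, ⁅e i, f j⁆ = if i = j then h i else 0) (hf : ∀ i j, ⁅h i, f j⁆ = -((AE10 i j : ℂ) • f j))
    (k i j : Fin 10) (hij : i ≠ j) (ha : AE10 i j = 0) : ⁅e k, ⁅f i, f j⁆⁆ = 0 := by
  have ha' := AE_symm i j ▸ ha
  rw [leibniz_lie, hef, hef]
  split_ifs with h1 h2 h2
  · exact absurd (h1.symm.trans h2) hij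
  · subst h1; rw [hf, ha]; simp
  · subst h2; rw [← lie_skew (f i) (h k), hf, ha']; simp
  · simp
lemma chev1 (hef : ∀ i j, ⁅e i, f j⁆ = if i = j then h i else 0) (hf : ∀ i j, ⁅h i, f j⁆ = -((AE10 i j : ℂ) • f j))
    (k i j : Fin 10) (hij : i ≠ j) (ha : AE10 i j = -1) : ⁅e k, ⁅f i, ⁅f i, f j⁆⁆⁆ = 0 := by
  have ha' := AE_symm i j ▸ ha
  rw [leibniz_lie, leibniz_lie (e k), hef, hef]
  split_ifs with h1 h2 h2
  · exact absurd (h1.symm.trans h2) hij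
  · subst h1; rw [leibniz_lie, hf, hf, ha, AE_diag]; simp; module
  · subst h2; rw [← lie_skew (f i) (h k), hf, ha']; simp
  · simp
end chev

variable {N : Type} [LieRing N] [LieAlgebra ℂ N] (D : ND N)
inductive ND.Mono1 : Wt → N → Prop
  | base : Mono1 (sr none) (D.e none)
  | step (i : Fin 10) {β : Wt} {x : N} (h : Mono1 β x) : Mono1 (sr (some i) + β) ⁅D.e (some i), x⁆
variable {D}
lemma ND.Mono1.mono {β : Wt} {x : N} (h : D.Mono1 β x) : D.Mono β x := by
  induction h with
  | base => exact .base none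
  | step i _ ih => exact .step _ ih
lemma ND.Mono1.none {β : Wt} {x : N} (h : D.Mono1 β x) : β none = 1 := by
  induction h with
  | base => simp [sr_apply]
  | step i _ ih => simp [sr_apply, ih]
lemma ND.Mono1.ne {β : Wt} {x : N} (h : D.Mono1 β x) (i : Fin 10) : β ≠ sr (some i) := by
  rintro rfl; have := h.none; simp [sr_apply] at this
variable (D)
def ND.M : Submodule ℂ N := Submodule.span ℂ {x | ∃ β, D.Mono1 β x}
lemma ND.M_ind (P : Submodule ℂ N) (h : ∀ β x, D.Mono1 β x → x ∈ P) {x : N} (hx : x ∈ D.M) : x ∈ P :=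
  Submodule.span_le.2 (by rintro x ⟨β, hx⟩; exact h β x hx) hx
lemma ND.M_mem {β : Wt} {x : N} (h : D.Mono1 β x) : x ∈ D.M := Submodule.subset_span ⟨β, h⟩
lemma ND.ME (i : Fin 10) : ∀ x ∈ D.M, ad ℂ N (D.e (some i)) x ∈ D.M := fun x hx =>
  D.M_ind (D.M.comap _) (fun β x h => D.M_mem (h.step i)) hx
lemma ND.MF (i : Fin 10) : ∀ x ∈ D.M, D.F (some i) x ∈ D.M := fun x hx =>
  D.M_ind (D.M.comap _) (fun β x h => by
    rw [Submodule.mem_comap]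
    induction h with
    | base => rw [D.F_e]; exact zero_mem _
    | step j h ih =>
      rw [D.F_lie' _ _ h.mono.mem (h.ne i)]
      refine add_mem (D.ME j _ ih) ?_
      split_ifs
      · exact Submodule.smul_mem _ _ (D.M_mem h)
      · exact zero_mem _) hx
noncomputable def ND.Hop (i : Fin 10) : N →ₗ[ℂ] N := ∑ j : I, (AA (some i) j : ℂ) • D.d j
lemma ND.Hop_mem (i : Fin 10) {β : Wt} {x : N} (hx : x ∈ D.W β) : D.Hop i x = (B (sr (some i)) β : ℂ) • x := by
  have : B (sr (some i)) β = ∑ j, AA (some i) j * β j := by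
    rw [B, Finset.sum_eq_single (some i)]
    · exact Finset.sum_congr rfl fun j _ => by rw [sr_apply, if_pos rfl, one_mul]
    · intro k _ hk; refine Finset.sum_eq_zero fun j _ => by rw [sr_apply, if_neg hk]; ring
    · simp
  rw [this, ND.Hop, LinearMap.sum_apply, Int.cast_sum, Finset.sum_smul]
  refine Finset.sum_congr rfl fun j _ => ?_
  rw [LinearMap.smul_apply, D.mem_W.1 hx, smul_smul]; push_cast; rfl
lemma ND.MH (i : Fin 10) : ∀ x ∈ D.M, D.Hop i x ∈ D.M := fun x hx =>
  D.M_ind (D.M.comap _) (fun β x h => by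
    rw [Submodule.mem_comap, D.Hop_mem i h.mono.mem]; exact Submodule.smul_mem _ _ (D.M_mem h)) hx
noncomputable def ND.rE (i : Fin 10) : Module.End ℂ D.M := (ad ℂ N (D.e (some i))).restrict (D.ME i)
noncomputable def ND.rF (i : Fin 10) : Module.End ℂ D.M := -((D.F (some i)).restrict (D.MF i))
noncomputable def ND.rH (i : Fin 10) : Module.End ℂ D.M := (D.Hop i).restrict (D.MH i)
@[simp] lemma ND.rE_apply (i : Fin 10) (x : D.M) : (D.rE i x : N) = ⁅D.e (some i), (x : N)⁆ := rfl
@[simp] lemma ND.rF_apply (i : Fin 10) (x : D.M) : (D.rF i x : N) = - D.F (some i) x := rfl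
@[simp] lemma ND.rH_apply (i : Fin 10) (x : D.M) : (D.rH i x : N) = D.Hop i x := rfl
lemma ND.M_ext (f g : Module.End ℂ D.M) (h : ∀ β x (hx : D.Mono1 β x), (f ⟨x, D.M_mem hx⟩ : N) = g ⟨x, D.M_mem hx⟩) : f = g := by
  ext ⟨x, hx⟩
  have := D.M_ind ((LinearMap.eqLocus f g).map D.M.subtype) (fun β x h' => ⟨⟨x, D.M_mem h'⟩, Subtype.ext (h β x h'), rfl⟩) hx
  obtain ⟨⟨y, hy⟩, h1, h2⟩ := this
  simp only [Submodule.subtype_apply] at h2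
  subst h2
  exact congrArg Subtype.val h1
lemma ND.rHH (i j : Fin 10) : ⁅D.rH i, D.rH j⁆ = 0 := by
  refine D.M_ext _ _ fun β x hx => ?_
  simp [LieRing.of_associative_ring_bracket, D.Hop_mem _ hx.mono.mem, smul_smul, mul_comm]
lemma ND.rEF (i j : Fin 10) : ⁅D.rE i, D.rF j⁆ = if i = j then D.rH i else 0 := by
  refine D.M_ext _ _ fun β x hx => ?_
  simp only [LieRing.of_associative_ring_bracket, LinearMap.sub_apply, Module.End.mul_apply, AddSubgroupClass.coe_sub, ND.rE_apply, ND.rF_apply]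
  rw [D.F_lie' _ _ hx.mono.mem (hx.ne j)]
  by_cases h : i = j
  · subst h; simp [D.Hop_mem _ hx.mono.mem]
  · simp [h]
lemma ND.rHE (i j : Fin 10) : ⁅D.rH i, D.rE j⁆ = (AE10 i j : ℂ) • D.rE j := by
  refine D.M_ext _ _ fun β x hx => ?_
  have := D.lie_mem (D.e_mem (some j)) hx.mono.mem
  simp [LieRing.of_associative_ring_bracket, D.Hop_mem _ hx.mono.mem, D.Hop_mem _ this, B_add_right, B_sr_sr, AA, add_smul]
lemma ND.rHF (i j : Fin 10) : ⁅D.rH i, D.rF j⁆ = -((AE10 i j : ℂ) • D.rF j) := by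
  refine D.M_ext _ _ fun β x hx => ?_
  have := D.F_mem (some j) hx.mono.mem
  rw [sub_eq_add_neg] at this
  simp [LieRing.of_associative_ring_bracket, D.Hop_mem _ hx.mono.mem, D.Hop_mem _ this, B_add_right, B_symm _ (-sr _), B_neg_left, B_sr_sr, AA, add_smul, AE_symm j i]
lemma ND.rF_serre (Gop : Module.End ℂ D.M) (hG : ∀ k, ⁅D.rE k, Gop⁆ = 0) (h0 : Gop ⟨D.e none, D.M_mem .base⟩ = 0) : Gop = 0 := by
  refine D.M_ext _ _ fun β x hx => ?_
  simp only [LinearMap.zero_apply, ZeroMemClass.coe_zero]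
  suffices Gop ⟨x, D.M_mem hx⟩ = 0 by rw [this]; rfl
  induction hx with
  | base => exact h0
  | step i h ih =>
    have := LinearMap.congr_fun (hG i) ⟨_, D.M_mem h⟩
    simp only [LieRing.of_associative_ring_bracket, LinearMap.sub_apply, Module.End.mul_apply, ih, map_zero, zero_sub, LinearMap.zero_apply, neg_eq_zero] at this
    exact this
lemma ND.rF0 (i : Fin 10) : D.rF i ⟨D.e none, D.M_mem .base⟩ = 0 := Subtype.ext (by simp [D.F_e])
instance : LieRing (Module.End ℂ D.M) := LieRing.ofAssociativeRing
instance : LieAlgebra ℂ (Module.End ℂ D.M) := LieAlgebra.ofAssociativeAlgebra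
lemma ND.rF_s0 (i j : Fin 10) (hij : i ≠ j) (ha : AE10 i j = 0) : ⁅D.rF i, D.rF j⁆ = 0 := 
  D.rF_serre _ (fun k => chev0 (e := D.rE) (f := D.rF) (h := D.rH) D.rEF D.rHF k i j hij ha) (by simp [LieRing.of_associative_ring_bracket, D.rF0])
lemma ND.rF_s1 (i j : Fin 10) (hij : i ≠ j) (ha : AE10 i j = -1) : ⁅D.rF i, ⁅D.rF i, D.rF j⁆⁆ = 0 := 
  D.rF_serre _ (fun k => chev1 (e := D.rE) (f := D.rF) (h := D.rH) D.rEF D.rHF k i j hij ha) (by simp [LieRing.of_associative_ring_bracket, D.rF0])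
lemma ND.rE_lie (i : Fin 10) (f : Module.End ℂ D.M) (x : N) (h : ∀ y : D.M, (f y : N) = ⁅x, (y : N)⁆) (y : D.M) :
    (⁅D.rE i, f⁆ y : N) = ⁅⁅D.e (some i), x⁆, (y : N)⁆ := by
  simp [LieRing.of_associative_ring_bracket, h]
lemma ND.rE_s0 (i j : Fin 10) (hij : i ≠ j) (ha : AE10 i j = 0) : ⁅D.rE i, D.rE j⁆ = 0 := by
  ext y
  rw [D.rE_lie i _ _ (D.rE_apply j), (D.serre i j hij).1 ha]; simp
lemma ND.rE_s1 (i j : Fin 10) (hij : i ≠ j) (ha : AE10 i j = -1) : ⁅D.rE i, ⁅D.rE i, D.rE j⁆⁆ = 0 := by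
  ext y
  rw [D.rE_lie i _ _ (D.rE_lie i _ _ (D.rE_apply j)), (D.serre i j hij).2 ha]; simp
end KMW
open scoped TensorProduct
namespace KMW
open LieAlgebra TensorProduct
set_option linter.unusedVariables false
abbrev G := KacMoody.gA AE10
noncomputable def gg (x : ChevalleyGen 10) : G := LieSubmodule.Quotient.mk' (KacMoody.serreIdeal AE10) (FreeLieAlgebra.of ℂ x)
noncomputable abbrev ge (i : Fin 10) : G := gg (.e i)
noncomputable abbrev gf (i : Fin 10) : G := gg (.f i)
noncomputable abbrev gh (i : Fin 10) : G := gg (.h i)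
lemma g_rel (x) (hx : x ∈ KacMoody.serreRelations AE10) : LieSubmodule.Quotient.mk' (KacMoody.serreIdeal AE10) x = 0 :=
  (LieSubmodule.Quotient.mk_eq_zero _).2 (LieSubmodule.subset_lieSpan hx)
lemma g_hh (i j) : ⁅gh i, gh j⁆ = 0 := g_rel ⁅KacMoody.H i, KacMoody.H j⁆ (by
  refine Or.inl (Or.inl (Or.inl (Or.inl (Or.inl ⟨i, j, rfl⟩)))))
lemma g_ef (i j) : ⁅ge i, gf j⁆ = if i = j then gh i else 0 := by
  have := g_rel (⁅KacMoody.E i, KacMoody.F j⁆ - if i = j then KacMoody.H i else 0) (Or.inl (Or.inl (Or.inl (Or.inl (Or.inr ⟨i, j, rfl⟩)))))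
  rw [map_sub, sub_eq_zero] at this
  split_ifs at this ⊢ <;> exact this
lemma g_he (i j) : ⁅gh i, ge j⁆ = (AE10 i j : ℂ) • ge j := by
  have := g_rel (⁅KacMoody.H i, KacMoody.E j⁆ - (AE10 i j : ℂ) • KacMoody.E j) (Or.inl (Or.inl (Or.inl (Or.inr ⟨i, j, rfl⟩))))
  rw [map_sub, sub_eq_zero] at this
  exact this
lemma g_hf (i j) : ⁅gh i, gf j⁆ = - ((AE10 i j : ℂ) • gf j) := by
  have := g_rel (⁅KacMoody.H i, KacMoody.F j⁆ + (AE10 i j : ℂ) • KacMoody.F j) (Or.inl (Or.inl (Or.inr ⟨i, j, rfl⟩)))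
  rw [map_add] at this
  exact eq_neg_of_add_eq_zero_left this
lemma g_es : IsSerre (fun k : I => k.elim 0 ge) := by
  intro i j hij
  have := g_rel _ (Or.inl (Or.inr ⟨i, j, hij, rfl⟩))
  constructor <;> intro h <;> rw [h] at this
  · simp at this; exact this
  · simp [pow_two] at this; exact this
lemma g_fs : IsSerre (fun k : I => k.elim 0 gf) := by
  intro i j hij
  have := g_rel _ (Or.inr ⟨i, j, hij, rfl⟩)
  constructor <;> intro h <;> rw [h] at this
  · simp at this; exact this
  · simp [pow_two] at this; exact this

variable {N : Type} [LieRing N] [LieAlgebra ℂ N] (D : ND N)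
noncomputable def ND.pe : N →ₗ⁅ℂ⁆ G := (D.lift G _ g_es).choose
lemma ND.pe_e (i : I) : D.pe (D.e i) = i.elim 0 ge := (D.lift G _ g_es).choose_spec i
noncomputable def ND.pf : N →ₗ⁅ℂ⁆ G := (D.lift G _ g_fs).choose
lemma ND.pf_e (i : I) : D.pf (D.e i) = i.elim 0 gf := (D.lift G _ g_fs).choose_spec i

section half
variable (e f h : Fin 10 → G) (hef : ∀ i j, ⁅e i, f j⁆ = if i = j then h i else 0)
   (he : ∀ i j, ⁅h i, e j⁆ = (AE10 i j : ℂ) • e j) (b : N →ₗ⁅ℂ⁆ G) (hb : ∀ i, b (D.e i) = i.elim 0 e)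
lemma ND.half_h (he : ∀ i j, ⁅h i, e j⁆ = (AE10 i j : ℂ) • e j) (hb : ∀ i, b (D.e i) = i.elim 0 e) (i : Fin 10) {β : Wt} {x : N} (hm : D.Mono β x) : ⁅h i, b x⁆ = ((∑ j, AE10 i j * β (some j) : ℤ) : ℂ) • b x := by
  induction hm with
  | base k =>
    rw [hb]
    cases k with
    | none => simp
    | some k => 
      have : ∑ j, AE10 i j * sr (some k) (some j) = AE10 i k := by simp [sr_apply]
      rw [this]; exact he i k
  | @step k β x hm ih =>
    rw [LieHom.map_lie, leibniz_lie, ih, hb]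
    cases k with
    | none => simp
    | some k => 
      have : ∑ j, AE10 i j * (sr (some k) + β) (some j) = AE10 i k + ∑ j, AE10 i j * β (some j) := by simp [sr_apply, mul_add, Finset.sum_add_distrib]
      rw [this]; simp [he, add_smul]
lemma ND.half_f (hef : ∀ i j, ⁅e i, f j⁆ = if i = j then h i else 0)
   (he : ∀ i j, ⁅h i, e j⁆ = (AE10 i j : ℂ) • e j) (hb : ∀ i, b (D.e i) = i.elim 0 e) (Q : Submodule ℂ G) (hQ : ∀ i, h i ∈ Q) (hQe : ∀ i, ∀ q ∈ Q, ⁅e i, q⁆ ∈ b.toLinearMap.range) (i : Fin 10)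
    (x : N) : ⁅f i, b x⁆ ∈ b.toLinearMap.range ⊔ Q := by
  refine D.mono_ind ((b.toLinearMap.range ⊔ Q).comap (ad ℂ G (f i) ∘ₗ b.toLinearMap)) (fun β x hm => ?_) x
  rw [Submodule.mem_comap]
  change ⁅f i, b x⁆ ∈ _
  induction hm with
  | base k =>
    rw [hb]
    cases k with
    | none => simp
    | some k =>
      simp only [Option.elim_some]
      rw [← lie_skew, hef]
      refine neg_mem ?_
      split_ifs
      · exact Submodule.mem_sup_right (hQ k)
      · exact zero_mem _
  | @step k β x hm ih =>
    rw [LieHom.map_lie, leibniz_lie, hb]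
    cases k with
    | none => simp
    | some k =>
      simp only [Option.elim_some]
      refine add_mem ?_ ?_
      · rw [← lie_skew (f i) (e k), hef, neg_lie]
        refine neg_mem ?_
        split_ifs
        · rw [D.half_h e h b he hb k hm]; exact Submodule.mem_sup_left (Submodule.smul_mem _ _ ⟨x, rfl⟩)
        · simp
      · obtain ⟨_, ⟨u, rfl⟩, q, hq, hu⟩ := Submodule.mem_sup.1 ih
        rw [← hu, lie_add]
        refine Submodule.mem_sup_left (add_mem ⟨⁅D.e (some k), u⁆, ?_⟩ (hQe k q hq))
        simp [hb]
lemma ND.half_none (hb : ∀ i, b (D.e i) = i.elim 0 e) {β : Wt} {x : N} (hm : D.Mono β x) (h0 : β none ≠ 0) : b x = 0 := by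
  induction hm with
  | base k => cases k with
    | none => simp [hb]
    | some k => simp [sr_apply] at h0
  | @step k β x hm ih =>
    rw [LieHom.map_lie, hb]
    cases k with
    | none => simp
    | some k => rw [ih (by simpa [sr_apply] using h0), lie_zero]
end half
noncomputable def HQ : Submodule ℂ G := Submodule.span ℂ (Set.range gh)
lemma HQ_ind (P : Submodule ℂ G) (h : ∀ i, gh i ∈ P) {x : G} (hx : x ∈ HQ) : x ∈ P :=
  Submodule.span_le.2 (by rintro x ⟨i, hx, rfl⟩; exact h i) hx
lemma gh_mem (i) : gh i ∈ HQ := Submodule.subset_span ⟨i, rfl⟩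
lemma ND.Qe (i) (q) (hq : q ∈ HQ) : ⁅ge i, q⁆ ∈ D.pe.toLinearMap.range := by
  refine HQ_ind (D.pe.toLinearMap.range.comap (ad ℂ G (ge i))) (fun j => ?_) hq
  rw [Submodule.mem_comap, ad_apply, ← lie_skew, g_he]
  exact neg_mem (Submodule.smul_mem _ _ ⟨D.e (some i), D.pe_e _⟩)
lemma ND.Qf (i) (q) (hq : q ∈ HQ) : ⁅gf i, q⁆ ∈ D.pf.toLinearMap.range := by
  refine HQ_ind (D.pf.toLinearMap.range.comap (ad ℂ G (gf i))) (fun j => ?_) hq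
  rw [Submodule.mem_comap, ad_apply, ← lie_skew, g_hf, neg_neg]
  exact (Submodule.smul_mem _ _ ⟨D.e (some i), D.pf_e _⟩)
lemma Qh (i) (q) (hq : q ∈ HQ) : ⁅gh i, q⁆ = 0 := by
  refine LinearMap.mem_ker.1 (HQ_ind (LinearMap.ker (ad ℂ G (gh i))) (fun j => ?_) hq)
  simp [g_hh]
lemma g_fe (i j) : ⁅gf i, ge j⁆ = if i = j then -gh i else 0 := by
  rw [← lie_skew, g_ef]; by_cases h : i = j
  · subst h; simp
  · simp [h, Ne.symm h]
lemma g_nhf (i j) : ⁅-gh i, gf j⁆ = ((AE10 i j : ℂ) • gf j) := by rw [neg_lie, g_hf, neg_neg]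

lemma ND.top : D.pe.toLinearMap.range ⊔ HQ ⊔ D.pf.toLinearMap.range = ⊤ := by
  set P := D.pe.toLinearMap.range ⊔ HQ ⊔ D.pf.toLinearMap.range with hP
  have hPe : ∀ x, D.pe x ∈ P := fun x => Submodule.mem_sup_left (Submodule.mem_sup_left ⟨x, rfl⟩)
  have hPf : ∀ x, D.pf x ∈ P := fun x => Submodule.mem_sup_right ⟨x, rfl⟩
  have hPh : ∀ x ∈ HQ, x ∈ P := fun x hx => Submodule.mem_sup_left (Submodule.mem_sup_right hx)
  have hle1 : D.pe.toLinearMap.range ⊔ HQ ≤ P := le_sup_left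
  have hle2 : D.pf.toLinearMap.range ⊔ HQ ≤ P := sup_le le_sup_right (le_sup_right.trans le_sup_left)
  have hst : ∀ g : G, (∀ x, ⁅g, D.pe x⁆ ∈ P) → (∀ x, ⁅g, D.pf x⁆ ∈ P) → (∀ x ∈ HQ, ⁅g, x⁆ ∈ P) → ∀ x ∈ P, ⁅g, x⁆ ∈ P := by
    intro g h1 h2 h3
    have : P ≤ P.comap (ad ℂ G g) := by
      rw [hP]; refine sup_le (sup_le ?_ ?_) ?_ <;> rw [← hP]
      · rintro _ ⟨x, rfl⟩; exact h1 x
      · exact h3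
      · rintro _ ⟨x, rfl⟩; exact h2 x
    exact this
  have hgen : ∀ g : ChevalleyGen 10, ∀ x ∈ P, ⁅gg g, x⁆ ∈ P := by
    intro g
    cases g with
    | e i => 
      refine hst _ (fun x => ?_) (fun x => ?_) (fun x hx => ?_)
      · have := hPe ⁅D.e (some i), x⁆; rw [LieHom.map_lie, D.pe_e] at this; exact this
      · exact hle2 (D.half_f gf ge (fun i => -gh i) D.pf g_fe g_nhf D.pf_e HQ (fun i => neg_mem (gh_mem i)) D.Qf i x)
      · exact Submodule.mem_sup_left (Submodule.mem_sup_left (D.Qe i x hx))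
    | f i =>
      refine hst _ (fun x => ?_) (fun x => ?_) (fun x hx => ?_)
      · exact hle1 (D.half_f ge gf gh D.pe g_ef g_he D.pe_e HQ gh_mem D.Qe i x)
      · have := hPf ⁅D.e (some i), x⁆; rw [LieHom.map_lie, D.pf_e] at this; exact this
      · exact Submodule.mem_sup_right (D.Qf i x hx)
    | h i =>
      refine hst _ (fun x => ?_) (fun x => ?_) (fun x hx => ?_)
      · refine D.mono_ind (P.comap (ad ℂ G (gh i) ∘ₗ D.pe.toLinearMap)) (fun β x hm => ?_) x
        rw [Submodule.mem_comap]
        change ⁅gh i, D.pe x⁆ ∈ P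
        rw [D.half_h ge gh D.pe g_he D.pe_e i hm]; exact Submodule.smul_mem _ _ (hPe x)
      · refine D.mono_ind (P.comap (ad ℂ G (gh i) ∘ₗ D.pf.toLinearMap)) (fun β x hm => ?_) x
        rw [Submodule.mem_comap]
        change ⁅gh i, D.pf x⁆ ∈ P
        rw [← neg_neg (gh i), neg_lie, D.half_h gf (fun i => -gh i) D.pf g_nhf D.pf_e i hm]; exact neg_mem (Submodule.smul_mem _ _ (hPf x))
      · rw [Qh i x hx]; exact zero_mem _
  let S : LieSubalgebra ℂ G :=
    { carrier := {g | ∀ x ∈ P, ⁅g, x⁆ ∈ P}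
      add_mem' := fun {a b} ha hb x hx => by rw [add_lie]; exact add_mem (ha x hx) (hb x hx)
      zero_mem' := fun x hx => by rw [zero_lie]; exact zero_mem _
      smul_mem' := fun c a ha x hx => by rw [smul_lie]; exact Submodule.smul_mem _ _ (ha x hx)
      lie_mem' := fun {a b} ha hb x hx => by rw [lie_lie]; exact sub_mem (ha _ (hb x hx)) (hb _ (ha x hx)) }
  have hS : S = ⊤ := quot_gen _ S hgen
  have hS' : ∀ g : G, ∀ x ∈ P, ⁅g, x⁆ ∈ P := fun g => by
    have : g ∈ S := by rw [hS]; trivial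
    exact this
  let S2 : LieSubalgebra ℂ G := { P with lie_mem' := fun {a b} ha hb => hS' a b hb }
  have hS2 : S2 = ⊤ := quot_gen _ S2 (fun x => by
    change gg x ∈ P
    cases x with
    | e i => have := hPe (D.e (some i)); rw [D.pe_e] at this; exact this
    | f i => have := hPf (D.e (some i)); rw [D.pf_e] at this; exact this
    | h i => exact hPh _ (gh_mem i))
  rw [eq_top_iff]; intro x _
  have : x ∈ S2 := by rw [hS2]; trivial
  exact this
end KMW
open scoped TensorProduct
namespace KMW
open LieAlgebra TensorProduct
set_option linter.unusedVariables false
def ext (c : Fin 10 → ℤ) : Wt := fun k => k.elim 0 c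
@[simp] lemma ext_some (c) (i : Fin 10) : ext c (some i) = c i := rfl
@[simp] lemma ext_none (c) : ext c none = 0 := rfl
variable {N : Type} [LieRing N] [LieAlgebra ℂ N] (D : ND N)
noncomputable def ND.V (c : Fin 10 → ℤ) : Submodule ℂ G :=
  (D.W (ext c)).map D.pe.toLinearMap ⊔ (D.W (ext (-c))).map D.pf.toLinearMap ⊔ if c = 0 then HQ else ⊥
lemma root_mem {c : Fin 10 → ℤ} {x : G} : x ∈ KacMoody.rootSpace AE10 c ↔ ∀ i, ⁅gh i, x⁆ = ((∑ j, AE10 i j * c j : ℤ) : ℂ) • x := by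
  simp only [KacMoody.rootSpace, Submodule.mem_iInf, Module.End.mem_eigenspace_iff]; rfl
lemma ND.V_le (c : Fin 10 → ℤ) : D.V c ≤ KacMoody.rootSpace AE10 c := by
  refine sup_le (sup_le ?_ ?_) ?_
  · rw [Submodule.map_le_iff_le_comap]; intro x hx
    refine D.W_ind hx _ fun x hm => ?_
    rw [Submodule.mem_comap, root_mem]
    intro i
    have := D.half_h ge gh D.pe g_he D.pe_e i hm
    simp only [ext_some] at this
    exact this
  · rw [Submodule.map_le_iff_le_comap]; intro x hx
    refine D.W_ind hx _ fun x hm => ?_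
    rw [Submodule.mem_comap, root_mem]
    intro i
    have := D.half_h gf (fun i => -gh i) D.pf g_nhf D.pf_e i hm
    rw [neg_lie, neg_eq_iff_eq_neg] at this
    change ⁅gh i, D.pf x⁆ = _ • D.pf x
    rw [this, ← neg_smul, ← Int.cast_neg, ← Finset.sum_neg_distrib]
    simp only [ext_some, Pi.neg_apply, mul_neg, neg_neg]
  · split_ifs with h
    · subst h; intro x hx; rw [root_mem]; intro i; rw [Qh i x hx]; simp
    · exact bot_le
lemma ND.V_top : ⨆ c, D.V c = ⊤ := by
  have hext : ∀ β : Wt, β none = 0 → ext (fun i => β (some i)) = β := fun β h => by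
    funext k; cases k <;> simp [ext, h]
  rw [eq_top_iff, ← D.top]
  refine sup_le (sup_le ?_ ?_) ?_
  · rintro _ ⟨x, rfl⟩
    refine D.mono_ind ((⨆ c, D.V c).comap D.pe.toLinearMap) (fun β x hm => ?_) x
    rw [Submodule.mem_comap]
    by_cases h0 : β none = 0
    · refine Submodule.mem_iSup_of_mem (fun i => β (some i)) (Submodule.mem_sup_left (Submodule.mem_sup_left ⟨x, ?_, rfl⟩))
      rw [hext β h0]; exact hm.mem
    · have : D.pe.toLinearMap x = 0 := D.half_none ge D.pe D.pe_e hm h0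
      rw [this]; exact zero_mem _
  · exact le_iSup_of_le 0 (le_sup_of_le_right (by simp))
  · rintro _ ⟨x, rfl⟩
    refine D.mono_ind ((⨆ c, D.V c).comap D.pf.toLinearMap) (fun β x hm => ?_) x
    rw [Submodule.mem_comap]
    by_cases h0 : β none = 0
    · refine Submodule.mem_iSup_of_mem (-fun i => β (some i)) (Submodule.mem_sup_left (Submodule.mem_sup_right ⟨x, ?_, rfl⟩))
      rw [neg_neg, hext β h0]; exact hm.mem
    · have : D.pf.toLinearMap x = 0 := D.half_none gf D.pf D.pf_e hm h0
      rw [this]; exact zero_mem _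
lemma AE_mat : ∀ i j : Fin 10, AE10 i j = (![![2,-1,0,0,0,0,0,0,0,0], ![-1,2,-1,0,0,0,0,0,0,0], ![0,-1,2,-1,0,0,0,0,0,0],
    ![0,0,-1,2,-1,0,0,0,0,0], ![0,0,0,-1,2,-1,0,0,0,0], ![0,0,0,0,-1,2,-1,0,0,0], ![0,0,0,0,0,-1,2,-1,0,-1],
    ![0,0,0,0,0,0,-1,2,-1,0], ![0,0,0,0,0,0,0,-1,2,0], ![0,0,0,0,0,0,-1,0,0,2]] : Fin 10 → Fin 10 → ℤ) i j := by unfold AE10; decide +kernel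
def rowE (c : Fin 10 → ℤ) : Fin 10 → ℤ := ![2 * c 0 - c 1, - c 0 + 2 * c 1 - c 2, - c 1 + 2 * c 2 - c 3, - c 2 + 2 * c 3 - c 4, - c 3 + 2 * c 4 - c 5,
  - c 4 + 2 * c 5 - c 6, - c 5 + 2 * c 6 - c 7 - c 9, - c 6 + 2 * c 7 - c 8, - c 7 + 2 * c 8, -c 6 + 2 * c 9]
lemma row_eq (c : Fin 10 → ℤ) (i : Fin 10) : ∑ j, AE10 i j * c j = rowE c i := by
  simp only [AE_mat]
  fin_cases i <;> simp [Fin.sum_univ_succ, rowE] <;> ring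
lemma AE_inj (c c' : Fin 10 → ℤ) (h : ∀ i, ∑ j, AE10 i j * c j = ∑ j, AE10 i j * c' j) : c = c' := by
  simp only [row_eq] at h
  have h0 := h 0; have h1 := h 1; have h2 := h 2; have h3 := h 3; have h4 := h 4
  have h5 := h 5; have h6 := h 6; have h7 := h 7; have h8 := h 8; have h9 := h 9
  simp [rowE] at h0 h1 h2 h3 h4 h5 h6 h7 h8 h9
  funext i
  fin_cases i <;> simp only [Fin.zero_eta, Fin.mk_one, Fin.reduceFinMk]
  · linear_combination (0) * h0 + (-1) * h1 + (-2) * h2 + (-3) * h3 + (-4) * h4 + (-5) * h5 + (-6) * h6 + (-4) * h7 + (-2) * h8 + (-3) * h9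
  · linear_combination (-1) * h0 + (-2) * h1 + (-4) * h2 + (-6) * h3 + (-8) * h4 + (-10) * h5 + (-12) * h6 + (-8) * h7 + (-4) * h8 + (-6) * h9
  · linear_combination (-2) * h0 + (-4) * h1 + (-6) * h2 + (-9) * h3 + (-12) * h4 + (-15) * h5 + (-18) * h6 + (-12) * h7 + (-6) * h8 + (-9) * h9
  · linear_combination (-3) * h0 + (-6) * h1 + (-9) * h2 + (-12) * h3 + (-16) * h4 + (-20) * h5 + (-24) * h6 + (-16) * h7 + (-8) * h8 + (-12) * h9
  · linear_combination (-4) * h0 + (-8) * h1 + (-12) * h2 + (-16) * h3 + (-20) * h4 + (-25) * h5 + (-30) * h6 + (-20) * h7 + (-10) * h8 + (-15) * h9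
  · linear_combination (-5) * h0 + (-10) * h1 + (-15) * h2 + (-20) * h3 + (-25) * h4 + (-30) * h5 + (-36) * h6 + (-24) * h7 + (-12) * h8 + (-18) * h9
  · linear_combination (-6) * h0 + (-12) * h1 + (-18) * h2 + (-24) * h3 + (-30) * h4 + (-36) * h5 + (-42) * h6 + (-28) * h7 + (-14) * h8 + (-21) * h9
  · linear_combination (-4) * h0 + (-8) * h1 + (-12) * h2 + (-16) * h3 + (-20) * h4 + (-24) * h5 + (-28) * h6 + (-18) * h7 + (-9) * h8 + (-14) * h9
  · linear_combination (-2) * h0 + (-4) * h1 + (-6) * h2 + (-8) * h3 + (-10) * h4 + (-12) * h5 + (-14) * h6 + (-9) * h7 + (-4) * h8 + (-7) * h9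
  · linear_combination (-3) * h0 + (-6) * h1 + (-9) * h2 + (-12) * h3 + (-15) * h4 + (-18) * h5 + (-21) * h6 + (-14) * h7 + (-7) * h8 + (-10) * h9
lemma root_indep : iSupIndep (KacMoody.rootSpace AE10) := by
  refine indep_of_comm (fun i => ad ℂ G (KacMoody.Hbar AE10 i)) (fun i j => ?_)
    (fun (c : Fin 10 → ℤ) i => ((∑ j, AE10 i j * c j : ℤ) : ℂ)) (fun c c' h => AE_inj c c' fun i => ?_)
  · refine LinearMap.ext fun x => ?_
    change ⁅gh i, ⁅gh j, x⁆⁆ = ⁅gh j, ⁅gh i, x⁆⁆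
    rw [leibniz_lie, g_hh, zero_lie, zero_add]
  · have := congrFun h i
    simp only [Int.cast_inj] at this
    exact this
lemma ND.root_eq (c : Fin 10 → ℤ) : KacMoody.rootSpace AE10 c = D.V c := inf_eq_of_indep D.V_le root_indep D.V_top c
lemma ND.exists_rep : ∃ ρ : G →ₗ⁅ℂ⁆ Module.End ℂ D.M, ∀ i, ρ (ge i) = D.rE i := by
  obtain ⟨f, hf⟩ := exists_quot_lift (L := Module.End ℂ D.M) (KacMoody.serreRelations AE10) (fun x => match x with | .e i => D.rE i | .f i => D.rF i | .h i => D.rH i) (by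
    have h0 : ∀ n : ℤ, n = 0 → (1 - n).toNat = 1 := by omega
    have h1 : ∀ n : ℤ, n = -1 → (1 - n).toNat = 2 := by omega
    rintro x (((((⟨i, j, rfl⟩ | ⟨i, j, rfl⟩) | ⟨i, j, rfl⟩) | ⟨i, j, rfl⟩) | ⟨i, j, hij, rfl⟩) | ⟨i, j, hij, rfl⟩)
    · simp only [LieHom.map_lie, KacMoody.H, FreeLieAlgebra.lift_of_apply]; exact D.rHH i j
    · simp only [map_sub, LieHom.map_lie, KacMoody.E, KacMoody.F, FreeLieAlgebra.lift_of_apply]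
      rw [sub_eq_zero]; refine (D.rEF i j).trans ?_
      split_ifs <;> simp [KacMoody.H]
    · simp only [map_sub, LieHom.map_lie, map_smul, KacMoody.H, KacMoody.E, FreeLieAlgebra.lift_of_apply]
      rw [sub_eq_zero]; exact D.rHE i j
    · simp only [map_add, LieHom.map_lie, map_smul, KacMoody.H, KacMoody.F, FreeLieAlgebra.lift_of_apply]
      rw [add_eq_zero_iff_eq_neg]; exact D.rHF i j
    · rcases AE_cases i j hij with h | h
      · rw [h0 _ h, pow_one, ad_apply]; simp only [LieHom.map_lie, KacMoody.E, FreeLieAlgebra.lift_of_apply]; exact D.rE_s0 i j hij h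
      · rw [h1 _ h, pow_two, Module.End.mul_apply, ad_apply, ad_apply]; simp only [LieHom.map_lie, KacMoody.E, FreeLieAlgebra.lift_of_apply]; exact D.rE_s1 i j hij h
    · rcases AE_cases i j hij with h | h
      · rw [h0 _ h, pow_one, ad_apply]; simp only [LieHom.map_lie, KacMoody.F, FreeLieAlgebra.lift_of_apply]; exact D.rF_s0 i j hij h
      · rw [h1 _ h, pow_two, Module.End.mul_apply, ad_apply, ad_apply]; simp only [LieHom.map_lie, KacMoody.F, FreeLieAlgebra.lift_of_apply]; exact D.rF_s1 i j hij h)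
  exact ⟨f, fun i => hf _⟩
lemma ND.pe_inj {β : Wt} (h0 : β none = 0) {x : N} (hx : x ∈ D.W β) (hb : D.pe x = 0) : x = 0 := by
  obtain ⟨ρ, hρ⟩ := D.exists_rep
  have key : ∀ y : D.M, (ρ (D.pe x) y : N) = ⁅x, (y : N)⁆ := by
    intro y
    rw [← lie_skew]
    refine D.W_ind hx (LinearMap.eqLocus (D.M.subtype ∘ₗ (LinearMap.applyₗ y) ∘ₗ ρ.toLinearMap ∘ₗ D.pe.toLinearMap) (-(ad ℂ N (y : N)))) fun x hm => ?_
    rw [LinearMap.mem_eqLocus]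
    change (ρ (D.pe x) y : N) = -⁅(y : N), x⁆
    rw [lie_skew]
    clear hx hb
    induction hm generalizing y with
    | base k =>
      cases k with
      | none => simp [sr_apply] at h0
      | some k => rw [D.pe_e]; simp only [Option.elim_some]; rw [hρ]; rfl
    | @step k γ x hm ih =>
      have a := hm.nonneg.1 none
      cases k with
      | none => simp [sr_apply] at h0 a; omega
      | some k =>
        have h0' : γ none = 0 := by simpa [sr_apply] using h0
        rw [LieHom.map_lie, LieHom.map_lie, D.pe_e]; simp only [Option.elim_some]; rw [hρ]
        exact D.rE_lie k _ x (ih h0') y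
  have h1 := key ⟨D.e none, D.M_mem .base⟩
  rw [hb, map_zero] at h1
  simp only [LinearMap.zero_apply, ZeroMemClass.coe_zero] at h1
  have hne : β ≠ sr none := by rintro rfl; simp [sr_apply] at h0
  have h2 := D.F_lie' none none hx hne
  rw [← lie_skew, ← h1, if_pos rfl] at h2
  have h3 := D.F_mem none hx
  rw [D.W_bot (fun h => by have := h.1 none; simp [sr_apply, h0] at this), Submodule.mem_bot] at h3
  rw [h3] at h2
  by_contra hx0
  have hc : 0 ≤ β ∧ 1 ≤ ∑ i, β i := by
    by_contra hc
    rw [D.W_bot hc] at hx; exact hx0 hx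
  have hB : B (sr none) β = - ∑ i, β i := by
    rw [B, Finset.sum_eq_single none]
    · rw [Fintype.sum_option, Fintype.sum_option]; simp [sr_apply, AA, h0]
    · intro k _ hk; refine Finset.sum_eq_zero fun j _ => by rw [sr_apply, if_neg hk]; ring
    · simp
  simp only [neg_zero, map_zero, lie_zero, zero_add] at h2
  rcases smul_eq_zero.1 h2.symm with h | h
  · have : B (sr none) β = 0 := by exact_mod_cast h
    omega
  · exact hx0 h
lemma ND.mult_eq (c : Fin 10 → ℤ) (hc : 0 ≤ c) (hc0 : c ≠ 0) : KacMoody.mult AE10 c = D.m (ext c) := by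
  have : D.W (ext (-c)) = ⊥ := D.W_bot fun h => hc0 (by
    funext i
    have h1 := h.1 (some i); have h2 := hc i
    simp [ext] at h1 h2 ⊢; omega)
  have hV : D.V c = (D.W (ext c)).map D.pe.toLinearMap := by
    rw [ND.V, this, if_neg hc0]; simp
  rw [KacMoody.mult, D.root_eq, hV, ND.m]
  rw [← LinearMap.range_domRestrict]
  refine LinearMap.finrank_range_of_inj ?_
  rw [← LinearMap.ker_eq_bot, eq_bot_iff]
  rintro ⟨x, hx⟩ hx'
  have : x = 0 := D.pe_inj (β := ext c) rfl hx (by simpa using hx')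
  simpa using this
end KMW
namespace KMW
set_option linter.unusedVariables false
abbrev Q := Fin 10 → ℤ
def bb (x y : Q) : ℤ := ∑ i, x i * rowE y i
def ht (x : Q) : ℤ := ∑ i, x i
def al (i : Fin 10) : Q := Pi.single i 1
noncomputable def mu (β : Q) : ℤ := nd.m (ext β)
noncomputable def TT (α γ : Q) : ℂ := nd.T (ext α) (ext γ)
lemma B_ext (x y : Q) : B (ext x) (ext y) = bb x y := by
  rw [B, bb, Fintype.sum_option]
  simp only [ext_none, zero_mul, Finset.sum_const_zero, zero_add, ext_some]
  refine Finset.sum_congr rfl fun i _ => ?_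
  rw [← row_eq, Fintype.sum_option, Finset.mul_sum]
  simp only [ext_none, mul_zero, zero_add, ext_some]
  exact Finset.sum_congr rfl fun j _ => by simp only [AA]; ring
lemma ext_add (x y : Q) : ext (x + y) = ext x + ext y := by funext k; cases k <;> simp
lemma ext_sub (x y : Q) : ext (x - y) = ext x - ext y := by funext k; cases k <;> simp
lemma ext_al (i) : ext (al i) = sr (some i) := by
  funext k; cases k with
  | none => simp [sr_apply]
  | some k => simp [sr_apply, al, Pi.single_apply]
lemma ext_inj {x y : Q} : ext x = ext y ↔ x = y := ⟨fun h => funext fun i => congrFun h (some i), fun h => h ▸ rfl⟩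
lemma ext_nonneg {x : Q} : 0 ≤ ext x ↔ 0 ≤ x := ⟨fun h i => h (some i), fun h k => by cases k; exact le_rfl; exact h _⟩
lemma ext_smul (k : ℤ) (x : Q) : ext (k • x) = k • ext x := by funext k; cases k <;> simp
lemma ext_sum (x : Q) : ∑ k, ext x k = ht x := by rw [Fintype.sum_option]; simp [ht]
lemma mu_ne {β : Q} (h : mu β ≠ 0) : 0 ≤ β ∧ 1 ≤ ht β := by
  by_contra hc
  rw [← ext_nonneg, ← ext_sum] at hc
  exact h (by rw [mu, nd.m_zero hc]; rfl)
lemma mu_nonneg (β : Q) : 0 ≤ mu β := by rw [mu]; positivity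
lemma mu_zero : mu 0 = 0 := by by_contra h; have := (mu_ne h).2; simp [ht] at this
lemma mu_al (i) : mu (al i) = 1 := by rw [mu, ext_al, nd.m_sr]; rfl
lemma mu_mult (i) {β : Q} (h : ∀ k, k ≠ i → β k = 0) (h' : β ≠ al i) : mu β = 0 := by
  rw [mu, nd.m_mult (some i)]; rfl
  · intro k hk; cases k with
    | none => rfl
    | some k => exact h k (by simpa using hk)
  · rwa [← ext_al, Ne, ext_inj]
lemma mu_refl (i) {β : Q} (h : ∃ k, k ≠ i ∧ β k ≠ 0) : mu (β - rowE β i • al i) = mu β := by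
  have hB : B (sr (some i)) (ext β) = rowE β i := by
    rw [← ext_al, B_ext, bb]; simp [al, Pi.single_apply]
  obtain ⟨k, h1, h2⟩ := h
  have := nd.refl i (β := ext β) rfl ⟨some k, by simpa using h1, h2⟩
  rw [mu, ext_sub, ext_smul, ext_al, ← hB, this, mu]
lemma TT_symm (α γ : Q) : TT α γ = TT γ α := nd.T_symm _ _
lemma TT_left {α γ : Q} (h : mu α = 0) : TT α γ = 0 := nd.T_left (by simpa [mu] using h)
lemma TT_right {α γ : Q} (h : mu γ = 0) : TT α γ = 0 := by rw [TT_symm, TT_left h]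
lemma TT_add {α γ : Q} (h : mu (α + γ) = 0) : TT α γ = 0 := nd.T_add (by rw [← ext_add]; simpa [mu] using h)
lemma TT_rec (α γ : Q) : TT α γ = TT α (γ - α) + TT (α - γ) γ + ((bb α γ * (mu α * mu γ - if α = γ then mu α else 0) : ℤ) : ℂ) := by
  rw [TT, nd.T_rec, TT, TT, ext_sub, ext_sub, B_ext]
  simp only [mu, ext_inj]
  split_ifs <;> push_cast <;> rfl
lemma TT_sum (β : Q) : ∑ᶠ α, TT α (β - α) = (((bb β β - 2 * ht β) * mu β : ℤ) : ℂ) := by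
  have h := nd.T_sum (ext β)
  have h1 : ∑ i, ext β i * AA i i = 2 * ht β := by
    rw [Fintype.sum_option, ht, Finset.mul_sum]
    simp only [ext_none, zero_mul, zero_add, ext_some, AA_diag]
    exact Finset.sum_congr rfl fun j _ => mul_comm _ _
  rw [h1, B_ext] at h
  rw [finsum_eq_sum_of_support_subset (s := Finset.Icc 0 β)]
  · rw [mu]; push_cast at h ⊢; rw [← h]
    refine Finset.sum_bij_ne_zero (fun a _ _ => ext a) ?_ ?_ ?_ ?_
    · intro a ha _; rw [Finset.mem_Icc] at ha ⊢
      refine ⟨ext_nonneg.2 ha.1, ?_⟩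
      rw [← sub_nonneg, ← ext_sub]; exact ext_nonneg.2 (sub_nonneg.2 ha.2)
    · intro a _ _ a' _ _ h; exact ext_inj.1 h
    · intro a ha hn
      rw [Finset.mem_Icc] at ha
      have h0 : a none = 0 := le_antisymm (ha.2 none) (ha.1 none)
      have : ext (fun i => a (some i)) = a := by funext k; cases k <;> simp [h0]
      refine ⟨fun i => a (some i), ?_, ?_, this⟩
      · rw [Finset.mem_Icc]; exact ⟨fun i => ha.1 (some i), fun i => ha.2 (some i)⟩
      · rw [TT, ext_sub, this]; exact hn
    · intro a _ _; rw [TT, ext_sub]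
  · intro a ha
    rw [Function.mem_support] at ha
    have h1 := (mu_ne (fun h => ha (TT_left h))).1
    have h2 := (mu_ne (fun h => ha (TT_right h))).1
    rw [Finset.coe_Icc]; exact ⟨h1, sub_nonneg.1 h2⟩
lemma mult_mu (c : Q) (hc : 0 ≤ c) (hc0 : c ≠ 0) : (KacMoody.mult AE10 c : ℤ) = mu c := by rw [nd.mult_eq c hc hc0, mu]
lemma norm_bb (c : Q) : normE10 c = bb c c := by
  rw [normE10, bb]; refine Finset.sum_congr rfl fun i _ => ?_
  rw [← row_eq, Finset.mul_sum]; exact Finset.sum_congr rfl fun j _ => by ring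
end KMW
namespace KMW
set_option linter.unusedVariables false
def dl : Q := ![0,1,2,3,4,5,6,4,2,3]
lemma bb_eq (x y : Q) : bb x y = x 0 * (2*y 0 - y 1) + x 1 * (-y 0+2*y 1-y 2) + x 2 * (-y 1+2*y 2-y 3) + x 3 * (-y 2+2*y 3-y 4)
    + x 4 * (-y 3+2*y 4-y 5) + x 5 * (-y 4+2*y 5-y 6) + x 6 * (-y 5+2*y 6-y 7-y 9) + x 7 * (-y 6+2*y 7-y 8)
    + x 8 * (-y 7+2*y 8) + x 9 * (-y 6+2*y 9) := by
  simp [bb, rowE, Fin.sum_univ_succ]; ring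
lemma ht_eq (x : Q) : ht x = x 0 + x 1 + x 2 + x 3 + x 4 + x 5 + x 6 + x 7 + x 8 + x 9 := by
  simp [ht, Fin.sum_univ_succ]; ring
lemma bb_comm (x y : Q) : bb x y = bb y x := by simp only [bb_eq]; ring
lemma bb_add (x y z : Q) : bb x (y + z) = bb x y + bb x z := by simp only [bb_eq, Pi.add_apply]; ring
lemma bb_sub (x y z : Q) : bb x (y - z) = bb x y - bb x z := by simp only [bb_eq, Pi.sub_apply]; ring
lemma bb_smul (k : ℤ) (x y : Q) : bb x (k • y) = k * bb x y := by simp only [bb_eq, Pi.smul_apply, smul_eq_mul]; ring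
lemma bb_neg (x y : Q) : bb x (-y) = - bb x y := by simp only [bb_eq, Pi.neg_apply]; ring
lemma add_bb (x y z : Q) : bb (y + z) x = bb y x + bb z x := by simp only [bb_eq, Pi.add_apply]; ring
lemma sub_bb (x y z : Q) : bb (y - z) x = bb y x - bb z x := by simp only [bb_eq, Pi.sub_apply]; ring
lemma neg_bb (x y : Q) : bb (-y) x = - bb y x := by simp only [bb_eq, Pi.neg_apply]; ring
lemma smul_bb (k : ℤ) (x y : Q) : bb (k • y) x = k * bb y x := by simp only [bb_eq, Pi.smul_apply, smul_eq_mul]; ring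
lemma ht_add (x y : Q) : ht (x + y) = ht x + ht y := by simp only [ht_eq, Pi.add_apply]; ring
lemma ht_sub (x y : Q) : ht (x - y) = ht x - ht y := by simp only [ht_eq, Pi.sub_apply]; ring
lemma ht_smul (k : ℤ) (y : Q) : ht (k • y) = k * ht y := by simp only [ht_eq, Pi.smul_apply, smul_eq_mul]; ring
lemma ht_nonneg {x : Q} (h : 0 ≤ x) : 0 ≤ ht x := Finset.sum_nonneg fun i _ => h i
lemma bb_al (x : Q) (i) : bb (al i) x = rowE x i := by simp [bb, al, Pi.single_apply]
lemma al_bb (x : Q) (i) : bb x (al i) = rowE x i := by rw [bb_comm, bb_al]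
lemma ht_al (i) : ht (al i) = 1 := by simp [ht, al]
lemma bb_dl (x : Q) : bb x dl = - x 0 := by simp [bb_eq, dl]
lemma dl_bb (x : Q) : bb dl x = - x 0 := by rw [bb_comm, bb_dl]
lemma ht_dl : ht dl = 30 := by simp [ht_eq, dl]
lemma dl0 : dl 0 = 0 := rfl
lemma dl1 : dl 1 = 1 := rfl
/-- doubled `D8` coordinates of the finite part -/
def X (x : Q) : Fin 8 → ℤ := ![- x 1 - x 6 + 2 * x 8 + x 9, - x 1 - x 6 + 2 * x 7 - 2 * x 8 + x 9, - x 1 + x 6 - 2 * x 7 + x 9,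
  - x 1 + 2 * x 5 - x 6 - x 9, - x 1 + 2 * x 4 - 2 * x 5 + x 6 - x 9, - x 1 + 2 * x 3 - 2 * x 4 + x 6 - x 9,
  - x 1 + 2 * x 2 - 2 * x 3 + x 6 - x 9, - x 1 + 2 * x 2 - x 6 + x 9]
lemma X_form (x : Q) : 4 * bb x x = 8 * x 0 ^ 2 - 8 * x 0 * x 1 + ∑ i, X x i ^ 2 := by
  simp [bb_eq, X, Fin.sum_univ_succ]; ring
def rhoX : Fin 8 → ℤ := ![25,23,21,17,15,13,11,-9]
lemma V_eq (x : Q) : ∑ i, (30 * X x i + x 0 * rhoX i) ^ 2 = 120 * (2 * x 0 * ht x - 62 * x 0 ^ 2 + 30 * bb x x) + 2480 * x 0 ^ 2 := by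
  simp [bb_eq, X, rhoX, ht_eq, Fin.sum_univ_succ]; ring
def sr' (i : Fin 10) (x : Q) : Q := x - rowE x i • al i
lemma sr'_norm (i) (x : Q) : bb (sr' i x) (sr' i x) = bb x x := by
  have : rowE (al i) i = 2 := by fin_cases i <;> rfl
  simp only [sr', bb_sub, sub_bb, bb_smul, smul_bb]; rw [al_bb, al_bb, bb_al, this]; ring
lemma sr'_ht (i) (x : Q) : ht (sr' i x) = ht x - rowE x i := by simp only [sr', ht_sub, ht_smul, ht_al]; ring
lemma sr'_ne (i k) (h : k ≠ i) (x : Q) : sr' i x k = x k := by simp [sr', al, h]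
lemma sum_marks (x : Q) : rowE x 1 + 2 * rowE x 2 + 3 * rowE x 3 + 4 * rowE x 4 + 5 * rowE x 5 + 6 * rowE x 6 + 4 * rowE x 7
    + 2 * rowE x 8 + 3 * rowE x 9 = - x 0 := by simp [rowE]; ring
/-- Weyl descent at positive level -/
lemma descent {l : ℤ} (hl : 0 < l) (P : Q → Prop) (hP : ∀ β i, i ≠ 0 → β 0 = l → P (sr' i β) → P β)
    (hA : ∀ β, β 0 = l → (∀ i, i ≠ 0 → rowE β i ≤ 0) → P β) (β : Q) (hβ : β 0 = l) : P β := by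
  suffices H : ∀ n : ℕ, ∀ β : Q, β 0 = l → (∑ i, (30 * X β i + β 0 * rhoX i) ^ 2).toNat < n → P β from H _ β hβ (Nat.lt_succ_self _)
  intro n
  induction n with
  | zero => intro β _ h; omega
  | succ n ih =>
    intro β hβ hn
    by_cases h : ∀ i, i ≠ 0 → rowE β i ≤ 0
    · exact hA β hβ h
    · push Not at h
      obtain ⟨i, hi, hr⟩ := h
      have h0 : sr' i β 0 = l := by rw [sr'_ne _ _ (Ne.symm hi), hβ]
      refine hP β i hi hβ (ih _ h0 ?_)
      have p1 : 0 ≤ ∑ i, (30 * X β i + β 0 * rhoX i) ^ 2 := Finset.sum_nonneg fun i _ => sq_nonneg _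
      have p2 : ∑ j, (30 * X (sr' i β) j + sr' i β 0 * rhoX j) ^ 2 < ∑ i, (30 * X β i + β 0 * rhoX i) ^ 2 := by
        rw [V_eq, V_eq, sr'_norm, sr'_ht, h0, hβ]; nlinarith
      have p3 : 0 ≤ ∑ j, (30 * X (sr' i β) j + sr' i β 0 * rhoX j) ^ 2 := Finset.sum_nonneg fun i _ => sq_nonneg _
      omega
lemma solve_rows {x y : Q} (h : x 0 = y 0) (h1 : x 1 = y 1) (hr : ∀ i, i ≠ 0 → rowE x i = rowE y i) : x = y := by
  have a1 := hr 1 (by decide); have a2 := hr 2 (by decide); have a3 := hr 3 (by decide); have a4 := hr 4 (by decide)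
  have a5 := hr 5 (by decide); have a6 := hr 6 (by decide); have a7 := hr 7 (by decide); have a8 := hr 8 (by decide)
  have a9 := hr 9 (by decide)
  simp [rowE] at a1 a2 a3 a4 a5 a6 a7 a8 a9
  have b2 : x 2 = y 2 := by linarith
  have b3 : x 3 = y 3 := by linarith
  have b4 : x 4 = y 4 := by linarith
  have b5 : x 5 = y 5 := by linarith
  have b6 : x 6 = y 6 := by linarith
  have b9 : x 9 = y 9 := by linarith
  have b7 : x 7 = y 7 := by linarith
  have b8 : x 8 = y 8 := by linarith
  funext i; fin_cases i <;> assumption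
lemma X_inj {x y : Q} (h : x 0 = y 0) (h1 : x 1 = y 1) (hr : X x = X y) : x = y := by
  have a0 := congrFun hr 0; have a1 := congrFun hr 1; have a2 := congrFun hr 2; have a3 := congrFun hr 3
  have a4 := congrFun hr 4; have a5 := congrFun hr 5; have a6 := congrFun hr 6; have a7 := congrFun hr 7
  simp [X] at a0 a1 a2 a3 a4 a5 a6 a7
  funext i; fin_cases i
  · exact h
  · exact h1
  all_goals simp; linarith
/-- affine part with zero norm -/
lemma lv0_null {x : Q} (h0 : x 0 = 0) (h : bb x x ≤ 0) : x = x 1 • dl := by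
  have h1 := X_form x
  rw [h0] at h1
  have h2 : ∑ i, X x i ^ 2 = 0 := le_antisymm (by linarith) (Finset.sum_nonneg fun i _ => sq_nonneg _)
  rw [Finset.sum_eq_zero_iff_of_nonneg fun i _ => sq_nonneg _] at h2
  refine X_inj (by simp [h0, dl]) (by simp [dl]) ?_
  funext i
  have := h2 i (Finset.mem_univ _)
  rw [pow_eq_zero_iff two_ne_zero.symm.symm] at this
  rw [this]; fin_cases i <;> simp [X, dl] <;> ring
end KMW
namespace KMW
set_option linter.unusedVariables false
lemma bb_even (x : Q) : ∃ k, bb x x = 2 * k := ⟨x 0 * (x 0 - x 1) + x 1 * (x 1 - x 2) + x 2 * (x 2 - x 3) + x 3 * (x 3 - x 4)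
  + x 4 * (x 4 - x 5) + x 5 * (x 5 - x 6) + x 6 * (x 6 - x 7 - x 9) + x 7 * (x 7 - x 8) + x 8 * x 8 + x 9 * x 9, by rw [bb_eq]; ring⟩
lemma lv0_nonneg {x : Q} (h0 : x 0 = 0) : 0 ≤ bb x x := by
  have h1 := X_form x
  have h2 : 0 ≤ ∑ i, X x i ^ 2 := Finset.sum_nonneg fun i _ => sq_nonneg _
  rw [h0] at h1; linarith
lemma bb_disj {x y : Q} (hx : 0 ≤ x) (hy : 0 ≤ y) (h : ∀ i, x i * y i = 0) : bb x y ≤ 0 := by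
  have p : ∀ i j, 0 ≤ x i * y j := fun i j => mul_nonneg (hx i) (hy j)
  rw [bb_eq]
  linarith [h 0, h 1, h 2, h 3, h 4, h 5, h 6, h 7, h 8, h 9, p 0 1, p 1 0, p 1 2, p 2 1, p 2 3, p 3 2, p 3 4, p 4 3, p 4 5, p 5 4,
    p 5 6, p 6 5, p 6 7, p 7 6, p 7 8, p 8 7, p 6 9, p 9 6]
lemma coh {α : Q} (h0 : α 0 = 0) (h : bb α α = 2) : 0 ≤ α ∨ α ≤ 0 := by
  set x : Q := fun i => max (α i) 0 with hx
  set y : Q := fun i => max (-α i) 0 with hy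
  have ha : α = x - y := by
    funext i; simp only [hx, hy, Pi.sub_apply]; rcases le_total (α i) 0 with h | h
    · rw [max_eq_right h, max_eq_left (by linarith)]; ring
    · rw [max_eq_left h, max_eq_right (by linarith)]; ring
  have px : 0 ≤ x := fun i => le_max_right _ _
  have py : 0 ≤ y := fun i => le_max_right _ _
  have hd : ∀ i, x i * y i = 0 := fun i => by
    simp only [hx, hy]; rcases le_total (α i) 0 with h | h
    · rw [max_eq_right h, zero_mul]
    · rw [max_eq_right (a := -α i) (by linarith), mul_zero]
  have hb := bb_disj px py hd
  have x0 : x 0 = 0 := by simp [hx, h0]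
  have y0 : y 0 = 0 := by simp [hy, h0]
  have e : bb α α = bb x x + bb y y - 2 * bb x y := by
    rw [ha, sub_bb, bb_sub, bb_sub, bb_comm y x]; ring
  obtain ⟨k, hk⟩ := bb_even x
  obtain ⟨m, hm⟩ := bb_even y
  have n1 := lv0_nonneg x0
  have n2 := lv0_nonneg y0
  have dpos : ∀ i, i ≠ 0 → 0 < dl i := by decide +kernel
  have key : ∀ z w : Q, z 0 = 0 → w 0 = 0 → 0 ≤ z → bb z z ≤ 0 → (∀ i, z i * w i = 0) → 0 < bb w w → z = 0 := by
    intro z w hz hw pz hzz hd hww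
    have hz1 := lv0_null hz hzz
    have : z 1 = 0 := by
      by_contra hne
      have hw0 : w = 0 := by
        funext i
        by_cases hi : i = 0
        · rw [hi, hw]; rfl
        · have h1 := hd i
          rw [hz1] at h1
          simp only [Pi.smul_apply, smul_eq_mul, mul_eq_zero, hne, false_or, (dpos i hi).ne'] at h1
          exact h1
      rw [hw0] at hww; simp [bb_eq] at hww
    rw [hz1, this, zero_smul]
  rcases le_or_gt (bb y y) 0 with hyy | hyy
  · left
    have : y = 0 := by
      rcases le_or_gt (bb x x) 0 with hxx | hxx
      · exfalso
        have hx1 := lv0_null x0 hxx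
        have : bb x y = 0 := by rw [hx1, smul_bb, dl_bb, y0]; simp
        omega
      · exact key y x y0 x0 py hyy (fun i => by rw [mul_comm]; exact hd i) hxx
    rw [ha, this, sub_zero]; exact px
  · right
    have : x = 0 := key x y x0 y0 px (by omega) hd hyy
    rw [ha, this, zero_sub]; exact neg_nonpos.2 py
lemma only_i {α : Q} {i : Fin 10} (h : ∀ k, k ≠ i → α k = 0) : α = α i • al i := by
  funext k; by_cases hk : k = i
  · subst hk; simp [al]
  · simp [al, hk, h k hk]
lemma row_al (i) : rowE (al i) i = 2 := by fin_cases i <;> rfl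
lemma real_ind (P : Q → Prop) (h1 : ∀ i, i ≠ 0 → P (al i))
    (h2 : ∀ α i, i ≠ 0 → 0 ≤ α → α 0 = 0 → 0 < rowE α i → (∃ k, k ≠ i ∧ α k ≠ 0) → P (sr' i α) → P α)
    (α : Q) (hp : 0 ≤ α) (h0 : α 0 = 0) (hn : bb α α = 2) : P α := by
  suffices H : ∀ n : ℕ, ∀ α : Q, 0 ≤ α → α 0 = 0 → bb α α = 2 → ht α < n → P α from
    H (ht α + 1).toNat α hp h0 hn (by have := ht_nonneg hp; omega)
  intro n
  induction n with
  | zero => intro α hp _ _ h; have := ht_nonneg hp; simp at h; omega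
  | succ n ih =>
    intro α hp h0 hn hh
    obtain ⟨i, hi, hr⟩ : ∃ i, i ≠ 0 ∧ 0 < rowE α i := by
      by_contra hc
      push Not at hc
      have : bb α α ≤ 0 := by
        refine Finset.sum_nonpos fun i _ => ?_
        by_cases hi : i = 0
        · rw [hi, h0, zero_mul]
        · exact mul_nonpos_of_nonneg_of_nonpos (hp i) (hc i hi)
      omega
    by_cases hk : ∃ k, k ≠ i ∧ α k ≠ 0
    · refine h2 α i hi hp h0 hr hk (ih _ ?_ ?_ ?_ ?_)
      · have hs0 : sr' i α 0 = 0 := by rw [sr'_ne _ _ (Ne.symm hi), h0]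
        rcases coh hs0 (by rw [sr'_norm, hn]) with h | h
        · exact h
        · obtain ⟨k, hk, hk'⟩ := hk
          have := h k; rw [sr'_ne i k hk] at this
          exact absurd (le_antisymm this (hp k)) hk'
      · rw [sr'_ne _ _ (Ne.symm hi), h0]
      · rw [sr'_norm, hn]
      · rw [sr'_ht]; push_cast at hh; omega
    · push Not at hk
      have ha := only_i hk
      have hb : bb α α = 2 * α i ^ 2 := by rw [ha, bb_smul, smul_bb, bb_al, row_al]; simp [al]; ring
      have h3 := hp i
      simp only [Pi.zero_apply] at h3
      have : α i = 1 := by nlinarith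
      rw [ha, this, one_smul]; exact h1 i hi
lemma mu_real {α : Q} (hp : 0 ≤ α) (h0 : α 0 = 0) (hn : bb α α = 2) : mu α = 1 :=
  real_ind (fun α => mu α = 1) (fun i _ => mu_al i) (fun α i _ _ _ _ hk h => by rw [← h]; exact (mu_refl i hk).symm) α hp h0 hn
lemma lv0_supp {α : Q} (h0 : α 0 = 0) (hm : mu α ≠ 0) : bb α α = 2 ∨ α = α 1 • dl := by
  suffices H : ∀ n : ℕ, ∀ α : Q, α 0 = 0 → mu α ≠ 0 → ht α < n → bb α α = 2 ∨ bb α α ≤ 0 by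
    exact (H (ht α + 1).toNat α h0 hm (by have := (mu_ne hm).2; omega)).imp_right (lv0_null h0)
  intro n
  induction n with
  | zero => intro α _ hm h; have := (mu_ne hm).2; simp at h; omega
  | succ n ih =>
    intro α h0 hm hh
    obtain ⟨hp, _⟩ := mu_ne hm
    by_cases hc : ∃ i, i ≠ 0 ∧ 0 < rowE α i
    · obtain ⟨i, hi, hr⟩ := hc
      by_cases hk : ∃ k, k ≠ i ∧ α k ≠ 0
      · rw [← sr'_norm i α]
        refine ih _ ?_ ?_ ?_
        · rw [sr'_ne _ _ (Ne.symm hi), h0]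
        · rw [sr', mu_refl i hk]; exact hm
        · rw [sr'_ht]; push_cast at hh; omega
      · push Not at hk
        left
        by_cases ha : α = al i
        · rw [ha, bb_al, row_al]
        · exact absurd (mu_mult i hk ha) hm
    · push Not at hc
      right
      refine Finset.sum_nonpos fun i _ => ?_
      by_cases hi : i = 0
      · rw [hi, h0, zero_mul]
      · exact mul_nonpos_of_nonneg_of_nonpos (hp i) (hc i hi)
/-- codes of the 120 positive roots -/
def posL : List ℕ := [1, 10, 100, 110, 1000, 1001, 1100, 1101, 1110, 1111, 10000, 11000, 11001, 11100, 11101, 11110, 11111, 12101, 12111, 12211, 100000, 110000, 111000, 111001, 111100, 111101, 111110, 111111, 112101, 112111, 112211, 122101, 122111, 122211, 123211, 123212, 1000000, 1100000, 1110000, 1111000, 1111001, 1111100, 1111101, 1111110, 1111111, 1112101, 1112111, 1112211, 1122101, 1122111, 1122211, 1123211, 1123212, 1222101, 1222111, 1222211, 1223211, 1223212, 1233211, 1233212, 1234212, 1234312, 1234322, 10000000, 11000000, 11100000, 11110000, 11111000, 11111001, 11111100, 11111101, 11111110, 11111111, 11112101, 11112111, 11112211, 11122101, 11122111, 11122211,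 11123211, 11123212, 11222101, 11222111, 11222211, 11223211, 11223212, 11233211, 11233212, 11234212, 11234312, 11234322, 12222101, 12222111, 12222211, 12223211, 12223212, 12233211, 12233212, 12234212, 12234312, 12234322, 12333211, 12333212, 12334212, 12334312, 12334322, 12344212, 12344312, 12344322, 12345312, 12345313, 12345322, 12345323, 12345422, 12345423, 12346423, 12356423, 12456423, 13456423, 23456423]
def dec (c : ℕ) : Q := ![0, 0, (c / 10000000 % 10 : ℕ), (c / 1000000 % 10 : ℕ), (c / 100000 % 10 : ℕ), (c / 10000 % 10 : ℕ),
  (c / 1000 % 10 : ℕ), (c / 100 % 10 : ℕ), (c / 10 % 10 : ℕ), (c % 10 : ℕ)]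
lemma posL_nodup : posL.Nodup := by decide +kernel
lemma posL_norm : ∀ c ∈ posL, bb (dec c) (dec c) = 2 := by decide +kernel
lemma posL_al : ∀ i : Fin 10, 2 ≤ i → ∃ c ∈ posL, dec c = al i := by decide +kernel
lemma posL_step : ∀ c ∈ posL, ∀ i : Fin 10, 2 ≤ i → rowE (dec c) i < 0 →
    rowE (dec c) i = -1 ∧ c + 10 ^ (9 - (i : ℕ)) ∈ posL ∧ dec (c + 10 ^ (9 - (i : ℕ))) = dec c + al i := by decide +kernel
lemma posL_complete {γ : Q} (hp : 0 ≤ γ) (h0 : γ 0 = 0) (h1 : γ 1 = 0) (hn : bb γ γ = 2) : ∃ c ∈ posL, dec c = γ := by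
  refine real_ind (fun γ => γ 1 = 0 → ∃ c ∈ posL, dec c = γ) ?_ ?_ γ hp h0 hn h1
  · intro i hi h
    refine posL_al i ?_
    revert h; revert hi; revert i; decide +kernel
  · intro α i hi hp h0 hr hk ih h1
    have i2 : 2 ≤ i := by
      by_contra hc
      have : i = 1 := (by decide : ∀ i : Fin 10, i ≠ 0 → ¬ 2 ≤ i → i = 1) i hi hc
      subst this
      have h2 := hp 2; simp at h2
      simp [rowE, h0, h1] at hr
      linarith
    obtain ⟨c, hc, he⟩ := ih (by rw [sr'_ne i 1 (by rintro rfl; revert i2; decide), h1])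
    have hs : rowE (dec c) i = - rowE α i := by
      rw [he, ← al_bb, sr', sub_bb, smul_bb, al_bb, bb_al, row_al]; ring
    obtain ⟨e1, e2, e3⟩ := posL_step c hc i i2 (by omega)
    refine ⟨_, e2, ?_⟩
    rw [e3, he, sr', show rowE α i = 1 by omega, one_smul, sub_add_cancel]
end KMW
namespace KMW
set_option linter.unusedVariables false
set_option linter.unusedSimpArgs false
lemma posL_nodup' : (posL.map dec).Nodup := by decide +kernel
def PF : Finset Q := ⟨(posL.map dec : List Q), posL_nodup'⟩
lemma mem_PF {γ : Q} : γ ∈ PF ↔ ∃ c ∈ posL, dec c = γ := by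
  change γ ∈ ((posL.map dec : List Q) : Multiset Q) ↔ _
  simp
lemma PF_card : PF.card = 120 := rfl
lemma PF_prop {γ : Q} (h : γ ∈ PF) : γ 0 = 0 ∧ γ 1 = 0 ∧ 0 ≤ γ ∧ bb γ γ = 2 := by
  obtain ⟨c, hc, rfl⟩ := mem_PF.1 h
  refine ⟨rfl, rfl, ?_, posL_norm c hc⟩
  intro i; fin_cases i <;> simp [dec] <;> omega
attribute [irreducible] PF
lemma dl_nonneg : 0 ≤ dl := fun i => by fin_cases i <;> simp [dl]
lemma nrm_add {γ : Q} (h0 : γ 0 = 0) (u : ℤ) : bb (u • dl + γ) (u • dl + γ) = bb γ γ := by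
  simp [-zsmul_eq_mul, bb_add, add_bb, bb_smul, smul_bb, bb_dl, dl_bb, h0, dl0]
lemma nrm_sub {γ : Q} (h0 : γ 0 = 0) (u : ℤ) : bb (u • dl - γ) (u • dl - γ) = bb γ γ := by
  simp [-zsmul_eq_mul, bb_sub, sub_bb, bb_smul, smul_bb, bb_dl, dl_bb, h0, dl0]
lemma PF_complete {γ : Q} (h0 : γ 0 = 0) (h1 : γ 1 = 0) (hn : bb γ γ = 2) : γ ∈ PF ∨ -γ ∈ PF := by
  rcases coh h0 hn with h | h
  · exact Or.inl (mem_PF.2 (posL_complete h h0 h1 hn))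
  · exact Or.inr (mem_PF.2 (posL_complete (neg_nonneg.2 h) (by simp [h0]) (by simp [h1]) (by rw [neg_bb, bb_neg, neg_neg, hn])))
lemma PF_add {γ : Q} (h : γ ∈ PF) (u : ℤ) : mu (u • dl + γ) = if 0 ≤ u then 1 else 0 := by
  obtain ⟨h0, h1, hp, hn⟩ := PF_prop h
  split_ifs with hu
  · refine mu_real ?_ (by simp [h0, dl0]) ?_
    · exact add_nonneg (smul_nonneg hu dl_nonneg) hp
    · simp [-zsmul_eq_mul, bb_add, add_bb, bb_smul, smul_bb, bb_dl, dl_bb, h0, hn, dl0]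
  · by_contra hm
    have := (mu_ne hm).1 1
    simp [h1, dl1] at this; omega
lemma PF_sub {γ : Q} (h : γ ∈ PF) (u : ℤ) : mu (u • dl - γ) = if 1 ≤ u then 1 else 0 := by
  obtain ⟨h0, h1, hp, hn⟩ := PF_prop h
  have hn' : bb (u • dl - γ) (u • dl - γ) = 2 := by
    simp [-zsmul_eq_mul, bb_sub, sub_bb, bb_smul, smul_bb, bb_dl, dl_bb, h0, hn, dl0]
  have h0' : (u • dl - γ) 0 = 0 := by simp [h0, dl0]
  split_ifs with hu
  · refine mu_real ?_ h0' hn'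
    rcases coh h0' hn' with h | h
    · exact h
    · have := h 1; simp [h1, dl1] at this; omega
  · by_contra hm
    have h3 := (mu_ne hm).1 1
    simp [h1, dl1] at h3
    have : u = 0 := by omega
    subst this
    have h4 := (mu_ne hm).1
    have h5 : γ = 0 := le_antisymm (by simpa using h4) hp
    rw [h5] at hn; simp [-zsmul_eq_mul, bb_eq] at hn
lemma mu_dl_neg {u : ℤ} (h : u ≤ 0) : mu (u • dl) = 0 := by
  by_contra hm
  have := (mu_ne hm).2
  rw [ht_smul, ht_dl] at this; omega
lemma L0sum {A : Type*} [AddCommMonoid A] (F : Q → A) (M : ℕ) (hF : ∀ α, F α ≠ 0 → α 0 = 0 ∧ mu α ≠ 0 ∧ α 1 < M) :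
    ∑ᶠ α, F α = ∑ u ∈ Finset.range M, (F ((u:ℤ) • dl) + ∑ γ ∈ PF, (F ((u:ℤ) • dl + γ) + F ((u:ℤ) • dl - γ))) := by
  have key : ∀ G : Q → A, G 0 + ∑ γ ∈ PF, (G γ + G (-γ)) = ∑ γ ∈ insert 0 (PF ∪ PF.image Neg.neg), G γ := by
    intro G
    rw [Finset.sum_insert, Finset.sum_union, Finset.sum_image, Finset.sum_add_distrib]
    · intro a _ b _ h; exact neg_injective h
    · rw [Finset.disjoint_left]
      intro a ha hb
      obtain ⟨b, hb', rfl⟩ := Finset.mem_image.1 hb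
      have h1 := PF_prop ha
      have h2 := PF_prop hb'
      have : b = 0 := le_antisymm (by simpa using h1.2.2.1) h2.2.2.1
      rw [this] at h2; simp [-zsmul_eq_mul, bb_eq] at h2
    · intro h
      rw [Finset.mem_union] at h
      rcases h with h | h
      · have h1 := PF_prop h; simp [-zsmul_eq_mul, bb_eq] at h1
      · obtain ⟨b, hb, h2⟩ := Finset.mem_image.1 h
        have h1 := PF_prop hb; rw [neg_eq_zero.1 h2] at h1; simp [-zsmul_eq_mul, bb_eq] at h1
  have h2 : ∀ u : ℕ, F ((u:ℤ) • dl) + ∑ γ ∈ PF, (F ((u:ℤ) • dl + γ) + F ((u:ℤ) • dl - γ)) =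
      ∑ γ ∈ insert 0 (PF ∪ PF.image Neg.neg), F ((u:ℤ) • dl + γ) := fun u => by
    rw [← key]; simp [sub_eq_add_neg]
  rw [Finset.sum_congr rfl fun u _ => h2 u, ← Finset.sum_product']
  have hz : ∀ γ ∈ insert (0:Q) (PF ∪ PF.image Neg.neg), γ 1 = 0 := by
    intro γ h
    rw [Finset.mem_insert, Finset.mem_union, Finset.mem_image] at h
    rcases h with rfl | h | ⟨b, hb, rfl⟩
    · rfl
    · exact (PF_prop h).2.1
    · simp [(PF_prop hb).2.1]
  rw [← Finset.sum_image (g := fun z : ℕ × Q => (z.1:ℤ) • dl + z.2) (f := F)]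
  · refine finsum_eq_sum_of_support_subset _ fun α hα => ?_
    obtain ⟨h0, hm, h1⟩ := hF α hα
    have hpos := (mu_ne hm).1 1
    simp only [Pi.zero_apply] at hpos
    rw [Finset.mem_coe, Finset.mem_image]
    have hc : (((α 1).toNat : ℕ) : ℤ) = α 1 := Int.toNat_of_nonneg hpos
    refine ⟨((α 1).toNat, α - α 1 • dl), ?_, by simp only [hc]; abel⟩
    rw [Finset.mem_product, Finset.mem_range]
    refine ⟨by simp only; omega, ?_⟩
    simp only [Finset.mem_insert, Finset.mem_union, Finset.mem_image]
    rcases lv0_supp h0 hm with h | h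
    · right
      have h5 : bb (α - α 1 • dl) (α - α 1 • dl) = 2 := by
        simp [-zsmul_eq_mul, bb_sub, sub_bb, bb_smul, smul_bb, bb_dl, dl_bb, h0, h, dl0]
      rcases PF_complete (by simp [h0, dl0]) (by simp [dl1]) h5 with h6 | h6
      · exact Or.inl h6
      · exact Or.inr ⟨_, h6, neg_neg _⟩
    · left; rw [← h, sub_self]
  · rintro ⟨u, γ⟩ h ⟨u', γ'⟩ h' he
    rw [Finset.mem_coe, Finset.mem_product] at h h'
    simp only at he
    have e1 := congrFun he 1
    simp only [Pi.add_apply, Pi.smul_apply, dl1, hz γ h.2, hz γ' h'.2, smul_eq_mul] at e1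
    have e2 : u = u' := by omega
    subst e2
    rw [add_right_inj] at he; rw [he]
lemma TT_dl (k l : ℤ) : TT (k • dl) (l • dl) = 0 := by
  suffices H : ∀ n : ℕ, ∀ k l : ℤ, k + l < n → TT (k • dl) (l • dl) = 0 from H (k + l + 1).toNat k l (by omega)
  intro n
  induction n with
  | zero =>
    intro k l h
    rcases le_or_gt k 0 with hk | hk
    · exact TT_left (mu_dl_neg hk)
    · exact TT_right (mu_dl_neg (by simp at h; omega))
  | succ n ih =>
    intro k l h
    rcases le_or_gt k 0 with hk | hk
    · exact TT_left (mu_dl_neg hk)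
    rcases le_or_gt l 0 with hl | hl
    · exact TT_right (mu_dl_neg hl)
    rw [TT_rec, ← sub_smul, ← sub_smul, ih _ _ (by push_cast at h; omega), ih _ _ (by push_cast at h; omega), bb_smul, bb_dl]
    simp [dl0]
lemma TT_real {α α' : Q} (h0 : α 0 = 0) (hn : bb α α = 2) (hm : mu α = 1) (hm' : mu α' = 1) {n : ℤ} (h : α + α' = n • dl) :
    TT α α' = -2 := by
  have e : α' = n • dl - α := by rw [← h]; abel
  have h8 : bb (n • dl - α - α) (n • dl - α - α) = 8 := by
    simp [-zsmul_eq_mul, bb_sub, sub_bb, bb_smul, smul_bb, bb_dl, dl_bb, h0, hn, dl0]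
  have hz : ∀ x : Q, x 0 = 0 → bb x x = 8 → mu x = 0 := by
    intro x hx h8; by_contra hm
    rcases lv0_supp hx hm with h | h
    · omega
    · rw [h, bb_smul, smul_bb, bb_dl, dl0] at h8; omega
  have hb : bb α α' = -2 := by simp [-zsmul_eq_mul, e, bb_sub, bb_smul, bb_dl, h0, hn]
  have hne : α ≠ α' := by intro h; rw [← h, hn] at hb; omega
  rw [TT_rec, TT_right, TT_left, hm, hm', hb, if_neg hne]
  · norm_num
  · rw [e]; refine hz _ (by simp [h0, dl0]) ?_
    rw [← h8, show α - (n • dl - α) = -(n • dl - α - α) by abel, neg_bb, bb_neg, neg_neg]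
  · rw [e]; exact hz _ (by simp [h0, dl0]) h8
lemma mu_dl {n : ℤ} (hn : 1 ≤ n) : mu (n • dl) = 8 := by
  have h := TT_sum (n • dl)
  obtain ⟨N, rfl⟩ : ∃ N : ℕ, n = N := ⟨n.toNat, by omega⟩
  rw [L0sum _ (N + 1)] at h
  · have key : ∀ u ∈ Finset.range (N + 1), (TT ((u:ℤ) • dl) ((N:ℤ) • dl - (u:ℤ) • dl) + ∑ γ ∈ PF, (TT ((u:ℤ) • dl + γ) ((N:ℤ) • dl - ((u:ℤ) • dl + γ))
        + TT ((u:ℤ) • dl - γ) ((N:ℤ) • dl - ((u:ℤ) • dl - γ)))) = 120 * ((if u ≠ N then -2 else 0) + (if u ≠ 0 then -2 else 0)) := by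
      intro u hu
      rw [Finset.mem_range] at hu
      rw [← sub_smul, TT_dl, zero_add]
      have : (120 : ℂ) = (PF.card : ℂ) := by rw [PF_card]; norm_num
      rw [this, ← nsmul_eq_mul, ← Finset.sum_const]
      refine Finset.sum_congr rfl fun γ hγ => ?_
      obtain ⟨h0, h1, hp, hg⟩ := PF_prop hγ
      congr 1
      · have e : (N:ℤ) • dl - ((u:ℤ) • dl + γ) = ((N:ℤ) - u) • dl - γ := by rw [sub_smul]; abel
        rw [e]
        split_ifs with hc
        · refine TT_real (n := N) (by simp [h0, dl0]) ?_ ?_ ?_ ?_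
          · rw [nrm_add h0, hg]
          · rw [PF_add hγ, if_pos (by omega)]
          · rw [PF_sub hγ, if_pos (by omega)]
          · rw [sub_smul]; abel
        · exact TT_right (by rw [PF_sub hγ, if_neg (by omega)])
      · have e : (N:ℤ) • dl - ((u:ℤ) • dl - γ) = ((N:ℤ) - u) • dl + γ := by rw [sub_smul]; abel
        rw [e]
        split_ifs with hc
        · refine TT_real (n := N) (by simp [h0, dl0]) ?_ ?_ ?_ ?_
          · rw [nrm_sub h0, hg]
          · rw [PF_sub hγ, if_pos (by omega)]
          · rw [PF_add hγ, if_pos (by omega)]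
          · rw [sub_smul]; abel
        · exact TT_left (by rw [PF_sub hγ, if_neg (by omega)])
    rw [Finset.sum_congr rfl key, ← Finset.mul_sum, Finset.sum_add_distrib, Finset.sum_range_succ] at h
    have h1 : ∑ x ∈ Finset.range N, (if x ≠ N then (-2:ℂ) else 0) = -2 * N := by
      rw [Finset.sum_congr rfl (g := fun _ => (-2:ℂ))]
      · simp; ring
      · intro x hx; rw [if_pos]; rw [Finset.mem_range] at hx; omega
    rw [h1, Finset.sum_range_succ'] at h
    simp only [ne_eq, not_true_eq_false, if_false, Nat.succ_ne_zero, not_false_eq_true, if_true, Finset.sum_const, Finset.card_range,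
      bb_smul, smul_bb, bb_dl, Pi.smul_apply, dl0, ht_smul, ht_dl, smul_zero] at h
    have h3 : (120 * ((-2 * N + 0) + (N * (-2) + 0)) : ℤ) = ((N:ℤ) * -0 - 2 * (N * 30)) * mu ((N:ℤ) • dl) := by
      rw [← Int.cast_inj (α := ℂ)]; rw [← h]; push_cast; simp
    have h4 : (N:ℤ) ≠ 0 := by omega
    have h5 : (N:ℤ) * (60 * (mu ((N:ℤ) • dl) - 8)) = 0 := by linear_combination h3
    rcases mul_eq_zero.1 h5 with h | h
    · exact absurd h h4
    · omega
  · intro α hα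
    have h1 : mu α ≠ 0 := fun h => hα (TT_left h)
    have h2 : mu ((N:ℤ) • dl - α) ≠ 0 := fun h => hα (TT_right h)
    have h3 := (mu_ne h1).1
    have h4 := (mu_ne h2).1
    have a0 := h3 0; have b0 := h4 0; have b1 := h4 1
    simp [dl0, dl1] at a0 b0 b1
    exact ⟨by omega, h1, by push_cast; omega⟩
end KMW
namespace KMW
set_option linter.unusedVariables false
set_option linter.unusedSimpArgs false
/-- the recursion operator -/
noncomputable def Hs (B : Q) (K : ℕ) (g : Q → ℤ) (β : Q) : ℤ :=
  ∑ α ∈ (Finset.Icc 0 B).filter (fun α => α 0 = 0), ∑ k ∈ Finset.range K, mu α * (bb α (β - ((k:ℤ)+1) • α) * g (β - ((k:ℤ)+1) • α))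
def qq (β : Q) : ℤ := bb β β - 2 * ht β
lemma not_nonneg_far {α β : Q} (hm : mu α ≠ 0) {k : ℤ} (h3 : 0 ≤ k) (hk : ht β < k) : ¬ 0 ≤ β - k • α := by
  intro h
  have h1 := ht_nonneg h
  have h2 := (mu_ne hm).2
  rw [ht_sub, ht_smul] at h1
  nlinarith
lemma le_of_sub {α β : Q} {k : ℤ} (hk : 1 ≤ k) (ha : 0 ≤ α) (h : 0 ≤ β - k • α) : α ≤ β := by
  intro i
  have h1 := h i; have h2 := ha i
  simp at h1 h2
  nlinarith
lemma T_iter {α μ : Q} (h0 : α 0 = 0) (hm : 1 ≤ μ 0) (K : ℕ) :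
    TT α μ = ((∑ k ∈ Finset.range K, mu α * (bb α (μ - (k:ℤ) • α) * mu (μ - (k:ℤ) • α)) : ℤ) : ℂ) + TT α (μ - (K:ℤ) • α) := by
  induction K with
  | zero => simp
  | succ K ih =>
    rw [ih, TT_rec α (μ - (K:ℤ) • α), Finset.sum_range_succ, TT_left (α := α - (μ - (K:ℤ) • α)), if_neg]
    · rw [show μ - (K:ℤ) • α - α = μ - ((K+1:ℕ):ℤ) • α by push_cast; rw [add_smul, one_smul]; abel]
      push_cast; ring
    · intro h
      have := congrFun h 0
      simp [h0] at this; omega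
    · by_contra h
      have := (mu_ne h).1 0
      simp [h0] at this; omega
lemma T_iter' {α μ : Q} (h0 : α 0 = 0) (hm : 1 ≤ μ 0) {K : ℕ} (hK : ht μ < K) :
    TT α μ = ((∑ k ∈ Finset.range K, mu α * (bb α (μ - (k:ℤ) • α) * mu (μ - (k:ℤ) • α)) : ℤ) : ℂ) := by
  rw [T_iter h0 hm K]
  by_cases h : mu α = 0
  · rw [TT_left h, add_zero]
  · rw [TT_right, add_zero]
    by_contra h2
    exact not_nonneg_far h (by positivity) hK (mu_ne h2).1
lemma fin_supp {A : Type*} [Zero A] {F : Q → A} (β : Q) (h : ∀ α, F α ≠ 0 → 0 ≤ α ∧ α ≤ β) : (Function.support F).Finite :=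
  (Finset.finite_toSet (Finset.Icc 0 β)).subset fun α hα => by rw [Finset.coe_Icc]; exact h α hα
lemma TT_ne {α γ : Q} (h : TT α γ ≠ 0) : mu α ≠ 0 ∧ mu γ ≠ 0 := ⟨fun h' => h (TT_left h'), fun h' => h (TT_right h')⟩
lemma ht_mono {x y : Q} (h : x ≤ y) : ht x ≤ ht y := Finset.sum_le_sum fun i _ => h i
lemma E_split {β B : Q} (hB : β ≤ B) (hl : 1 ≤ β 0) {K : ℕ} (hK : ht B < K) :
    ((qq β * mu β : ℤ) : ℂ) = 2 * (Hs B K mu β : ℂ) + ∑ᶠ α : Q, if 0 < α 0 ∧ α 0 < β 0 then TT α (β - α) else 0 := by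
  rw [qq, ← TT_sum β]
  have fs : ∀ (p : Q → Prop) [DecidablePred p], (Function.support fun α => if p α then TT α (β - α) else 0).Finite := by
    intro p _
    refine fin_supp β fun α h => ?_
    split_ifs at h
    · obtain ⟨h1, h2⟩ := TT_ne h
      exact ⟨(mu_ne h1).1, sub_nonneg.1 (mu_ne h2).1⟩
    · exact absurd rfl h
  have e : ∀ α, TT α (β - α) = (if α 0 = 0 then TT α (β - α) else 0) + (if α 0 = β 0 then TT α (β - α) else 0)
      + if 0 < α 0 ∧ α 0 < β 0 then TT α (β - α) else 0 := by
    intro α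
    by_cases h : TT α (β - α) = 0
    · simp [h]
    · obtain ⟨h1, h2⟩ := TT_ne h
      have a := (mu_ne h1).1 0
      have b := (mu_ne h2).1 0
      simp at a b
      rcases eq_or_lt_of_le a with a' | a'
      · rw [if_pos a'.symm, if_neg (by omega), if_neg (by omega)]; ring
      rcases eq_or_lt_of_le b with b' | b'
      · rw [if_neg (by omega), if_pos b', if_neg (by omega)]; ring
      · rw [if_neg (by omega), if_neg (by omega), if_pos ⟨a', b'⟩]; ring
  rw [finsum_congr e, finsum_add_distrib, finsum_add_distrib]
  rotate_left
  · exact fs _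
  · exact fs _
  · refine (Set.Finite.union (fs fun α => α 0 = 0) (fs fun α => α 0 = β 0)).subset ?_
    exact Function.support_add _ _
  · exact fs _
  have s : ∑ᶠ α, (if α 0 = β 0 then TT α (β - α) else 0) = ∑ᶠ α, (if α 0 = 0 then TT α (β - α) else 0) := by
    rw [← finsum_comp_equiv (Equiv.subLeft β)]
    refine finsum_congr fun α => ?_
    simp only [Equiv.subLeft_apply, sub_sub_cancel, Pi.sub_apply]
    rw [TT_symm]
    congr 1
    simp
  rw [s]
  have t : ∑ᶠ α, (if α 0 = 0 then TT α (β - α) else 0) = (Hs B K mu β : ℂ) := by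
    rw [finsum_eq_sum_of_support_subset (s := (Finset.Icc 0 B).filter (fun α => α 0 = 0)), Hs]
    · push_cast
      refine Finset.sum_congr rfl fun α hα => ?_
      rw [Finset.mem_filter, Finset.mem_Icc] at hα
      rw [if_pos hα.2, T_iter' hα.2 (by simp [hα.2, hl]) (K := K)]
      · push_cast
        refine Finset.sum_congr rfl fun k _ => ?_
        rw [show β - α - (k:ℤ) • α = β - ((k:ℤ)+1) • α by rw [add_smul, one_smul]; abel]
      · rw [ht_sub]; have := ht_nonneg hα.1.1; have := ht_mono hB; omega
    · intro α hα
      rw [Function.mem_support] at hα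
      split_ifs at hα with h
      · obtain ⟨h1, h2⟩ := TT_ne hα
        rw [Finset.mem_coe, Finset.mem_filter, Finset.mem_Icc]
        exact ⟨⟨(mu_ne h1).1, (sub_nonneg.1 (mu_ne h2).1).trans hB⟩, h⟩
      · exact absurd rfl hα
  rw [t]; ring
noncomputable def m1 (μ : Q) : ℤ := if μ 0 = 1 then mu μ else 0
lemma m1_ne {μ : Q} (h : m1 μ ≠ 0) : μ 0 = 1 ∧ 0 ≤ μ := by
  rw [m1] at h; split_ifs at h with h1
  · exact ⟨h1, (mu_ne h).1⟩
  · exact absurd rfl h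
lemma E1 {μ B : Q} (hB : μ ≤ B) {K : ℕ} (hK : ht B < K) : qq μ * m1 μ = 2 * Hs B K m1 μ := by
  by_cases h : μ 0 = 1
  · have e := E_split hB (by omega) hK
    rw [finsum_eq_zero_of_forall_eq_zero, add_zero] at e
    · rw [m1, if_pos h]
      have e2 : Hs B K m1 μ = Hs B K mu μ := by
        refine Finset.sum_congr rfl fun α hα => Finset.sum_congr rfl fun k _ => ?_
        rw [Finset.mem_filter] at hα
        rw [m1, if_pos]
        simp [hα.2, h]
      rw [e2]; exact_mod_cast e
    · intro α; rw [if_neg]; omega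
  · rw [m1, if_neg h, mul_zero, Hs, Finset.sum_eq_zero, mul_zero]
    intro α hα
    refine Finset.sum_eq_zero fun k _ => ?_
    rw [Finset.mem_filter] at hα
    rw [m1, if_neg (by simp [hα.2, h]), mul_zero, mul_zero]
noncomputable def cv (β : Q) : ℤ := ∑ᶠ μ, m1 μ * m1 (β - μ)
lemma fs1 (β : Q) (φ : Q → ℤ) : (Function.support fun μ => φ μ * (m1 μ * m1 (β - μ))).Finite := by
  refine fin_supp β fun α h => ?_
  have h1 := right_ne_zero_of_mul h
  exact ⟨(m1_ne (left_ne_zero_of_mul h1)).2, sub_nonneg.1 (m1_ne (right_ne_zero_of_mul h1)).2⟩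
lemma fs1' (β : Q) : (Function.support fun μ => m1 μ * m1 (β - μ)).Finite := by simpa using fs1 β fun _ => 1
lemma cv_swap (β : Q) (φ : Q → ℤ) : ∑ᶠ μ, φ (β - μ) * (m1 μ * m1 (β - μ)) = ∑ᶠ μ, φ μ * (m1 μ * m1 (β - μ)) := by
  rw [← finsum_comp_equiv (Equiv.subLeft β)]
  refine finsum_congr fun μ => ?_
  simp only [Equiv.subLeft_apply, sub_sub_cancel]; ring
lemma cv_bb (α x : Q) : bb α x * cv x = 2 * ∑ᶠ μ, bb α μ * (m1 μ * m1 (x - μ)) := by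
  rw [two_mul]
  nth_rw 1 [← cv_swap x (bb α)]
  rw [← finsum_add_distrib (fs1 x _) (fs1 x _), cv, mul_finsum' _ _ (fs1' x)]
  refine finsum_congr fun μ => ?_
  rw [bb_sub]; ring
lemma E_cv {β B : Q} (hB : β ≤ B) {K : ℕ} (hK : ht B < K) :
    qq β * cv β = 2 * Hs B K cv β + 2 * ∑ᶠ μ, bb μ (β - μ) * (m1 μ * m1 (β - μ)) := by
  have e1 : qq β * cv β = 2 * ∑ᶠ μ, qq μ * (m1 μ * m1 (β - μ)) + 2 * ∑ᶠ μ, bb μ (β - μ) * (m1 μ * m1 (β - μ)) := by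
    rw [two_mul]
    nth_rw 1 [← cv_swap β qq]
    rw [mul_finsum' _ _ (fs1 β _), ← finsum_add_distrib (fs1 β _) (fs1 β _), ← finsum_add_distrib, cv, mul_finsum' _ _ (fs1' β)]
    · refine finsum_congr fun μ => ?_
      have : qq β = qq (β - μ) + qq μ + 2 * bb μ (β - μ) := by
        simp only [qq, bb_sub, sub_bb, ht_sub, bb_comm β μ]; ring
      rw [this]; ring
    · exact ((fs1 β fun μ => qq (β - μ) + qq μ).subset (by intro μ; simp [add_mul]))
    · exact ((fs1 β fun μ => 2 * bb μ (β - μ)).subset (by intro μ; simp [mul_assoc]))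
  rw [e1]
  congr 2
  have e2 : ∀ μ, qq μ * (m1 μ * m1 (β - μ)) = ∑ α ∈ (Finset.Icc 0 B).filter (fun α => α 0 = 0), ∑ k ∈ Finset.range K,
      2 * mu α * (bb α (μ - ((k:ℤ)+1) • α) * (m1 (μ - ((k:ℤ)+1) • α) * m1 (β - μ))) := by
    intro μ
    by_cases h : m1 (β - μ) = 0
    · simp [h]
    · rw [← mul_assoc, E1 ((sub_nonneg.1 (m1_ne h).2).trans hB) hK, Hs, Finset.mul_sum, Finset.sum_mul]
      refine Finset.sum_congr rfl fun α _ => ?_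
      rw [Finset.mul_sum, Finset.sum_mul]
      exact Finset.sum_congr rfl fun k _ => by ring
  have fs : ∀ (α : Q) (k : ℕ), (Function.support fun μ => bb α (μ - ((k:ℤ)+1) • α) * (m1 (μ - ((k:ℤ)+1) • α) * m1 (β - μ))).Finite := by
    intro α k
    have := (fs1 (β - ((k:ℤ)+1) • α) (bb α)).preimage (f := fun μ => μ - ((k:ℤ)+1) • α) (by intro a _ b _ h; simpa using h)
    refine this.subset fun μ hμ => ?_
    rw [Set.mem_preimage]
    simpa using hμ
  rw [finsum_congr e2, finsum_sum_comm]
  · rw [Hs]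
    refine Finset.sum_congr rfl fun α _ => ?_
    rw [finsum_sum_comm]
    · refine Finset.sum_congr rfl fun k _ => ?_
      rw [← mul_finsum' _ _ (fs α k), cv_bb, ← finsum_comp_equiv (Equiv.subRight (((k:ℤ)+1) • α)).symm]
      simp only [Equiv.subRight_symm_apply, add_sub_cancel_right]
      rw [show (fun μ => bb α μ * (m1 μ * m1 (β - (μ + ((k:ℤ)+1) • α)))) = fun μ => bb α μ * (m1 μ * m1 (β - ((k:ℤ)+1) • α - μ)) from
        funext fun μ => by rw [sub_sub, add_comm μ]]
      ring
    · intro k _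
      exact (fs α k).subset (Function.support_mul_subset_right _ _)
  · intro α _
    refine Set.Finite.subset (Set.Finite.biUnion (Finset.finite_toSet (Finset.range K)) fun k _ => fs α k) ?_
    intro μ hμ
    obtain ⟨k, hk, h⟩ := Finset.exists_ne_zero_of_sum_ne_zero hμ
    exact Set.mem_biUnion hk (right_ne_zero_of_mul h)
end KMW
namespace KMW
set_option linter.unusedVariables false
set_option linter.unusedSimpArgs false
def hf (β : Q) : Q := fun i => β i / 2
lemma hf_two (μ : Q) : hf ((2:ℤ) • μ) = μ := by funext i; simp [hf]
lemma hf_iff {β μ : Q} : β = (2:ℤ) • μ ↔ (2:ℤ) • hf β = β ∧ μ = hf β := by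
  constructor
  · rintro rfl; rw [hf_two]; exact ⟨rfl, rfl⟩
  · rintro ⟨h, rfl⟩; exact h.symm
noncomputable def dd (β : Q) : ℤ := if (2:ℤ) • hf β = β then m1 (hf β) else 0
lemma dd_two (μ : Q) : dd ((2:ℤ) • μ) = m1 μ := by rw [dd, hf_two, if_pos rfl]
noncomputable def GG (β : Q) (K : ℕ) (μ : Q) : ℤ :=
  ∑ k ∈ Finset.range K, mu (β - (2:ℤ) • μ) * (bb (β - (2:ℤ) • μ) (μ - (k:ℤ) • (β - (2:ℤ) • μ)) * m1 (μ - (k:ℤ) • (β - (2:ℤ) • μ)))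
lemma GG_ne {β μ : Q} {K : ℕ} (h2 : β 0 = 2) (h : GG β K μ ≠ 0) : μ 0 = 1 ∧ 0 ≤ μ ∧ μ ≤ β ∧ 0 ≤ β - (2:ℤ) • μ := by
  obtain ⟨k, _, hk⟩ := Finset.exists_ne_zero_of_sum_ne_zero h
  have h1 := (mu_ne (left_ne_zero_of_mul hk)).1
  obtain ⟨h3, h4⟩ := m1_ne (right_ne_zero_of_mul (right_ne_zero_of_mul hk))
  have hp : 0 ≤ μ := by
    have := add_nonneg h4 (smul_nonneg (show (0:ℤ) ≤ k by positivity) h1)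
    rwa [sub_add_cancel] at this
  refine ⟨?_, hp, ?_, h1⟩
  · simp [-nsmul_eq_mul, h2] at h3
    have : (μ 0 - 1) * (1 + 2 * k) = 0 := by linear_combination h3
    rcases mul_eq_zero.1 this with h | h <;> omega
  · intro i; have a := h1 i; have b := hp i
    simp at a b; show μ i ≤ β i; omega
lemma GG_fin {β : Q} {K : ℕ} (h2 : β 0 = 2) : (Function.support (GG β K)).Finite :=
  fin_supp β fun μ h => ⟨(GG_ne h2 h).2.1, (GG_ne h2 h).2.2.1⟩
lemma T_G {β B μ : Q} (h2 : β 0 = 2) (hB : β ≤ B) {K : ℕ} (hK : ht B < K) (h1 : μ 0 = 1) : TT (β - (2:ℤ) • μ) μ = (GG β K μ : ℂ) := by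
  by_cases hm : mu (β - (2:ℤ) • μ) = 0
  · rw [TT_left hm, GG]; simp [-zsmul_eq_mul, -nsmul_eq_mul, hm]
  · have h0 : (β - (2:ℤ) • μ) 0 = 0 := by simp [h1, h2]
    rw [T_iter' h0 (by omega) (K := K), GG]
    · congr 1
      refine Finset.sum_congr rfl fun k _ => ?_
      rw [m1, if_pos]
      rw [Pi.sub_apply, Pi.smul_apply, h0]; simp [h1]
    · have := (mu_ne hm).2; rw [ht_sub, ht_smul] at this
      have := ht_mono hB; omega
lemma E_A {β B : Q} (h2 : β 0 = 2) (hB : β ≤ B) {K : ℕ} (hK : ht B < K) :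
    (∑ᶠ α : Q, if 0 < α 0 ∧ α 0 < β 0 then TT α (β - α) else 0) =
    ((2 * ∑ᶠ μ, GG β K μ + ∑ᶠ μ, bb μ (β - μ) * (m1 μ * m1 (β - μ)) - bb (hf β) (hf β) * dd β : ℤ) : ℂ) := by
  have hd : ∑ᶠ μ, bb μ (β - μ) * (if μ = β - μ then m1 μ else 0) = bb (hf β) (hf β) * dd β := by
    rw [finsum_eq_single _ (hf β)]
    · rw [dd]
      have : hf β = β - hf β ↔ (2:ℤ) • hf β = β := by rw [two_smul, eq_sub_iff_add_eq]
      by_cases h : hf β = β - hf β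
      · rw [if_pos h, if_pos (this.1 h), ← h]
      · rw [if_neg h, if_neg (fun h' => h (this.2 h'))]; simp
    · intro μ hμ
      rw [if_neg, mul_zero]
      intro h
      exact hμ (hf_iff.1 (show β = (2:ℤ) • μ by rw [two_smul]; nth_rw 1 [h]; abel)).2
  have e : ∀ α : Q, (if 0 < α 0 ∧ α 0 < β 0 then TT α (β - α) else 0) =
      ((GG β K α + GG β K (β - α) + bb α (β - α) * (m1 α * m1 (β - α)) - bb α (β - α) * (if α = β - α then m1 α else 0) : ℤ) : ℂ) := by
    intro α
    by_cases h : α 0 = 1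
    · have h' : (β - α) 0 = 1 := by simp [h, h2]
      rw [if_pos (by omega), TT_rec, TT_symm α]
      push_cast
      rw [← T_G h2 hB hK h, ← T_G h2 hB hK h']
      rw [show β - α - α = β - (2:ℤ) • α by rw [two_smul]; abel, show α - (β - α) = β - (2:ℤ) • (β - α) by rw [two_smul]; abel]
      rw [m1, m1, if_pos h, if_pos h']
      push_cast; ring
    · have h' : (β - α) 0 ≠ 1 := by simp [h2]; omega
      rw [if_neg (by omega), m1, if_neg h]
      have g1 : GG β K α = 0 := by by_contra hg; exact h (GG_ne h2 hg).1
      have g2 : GG β K (β - α) = 0 := by by_contra hg; exact h' (GG_ne h2 hg).1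
      rw [g1, g2]; simp
  have f2 : (Function.support fun α => GG β K (β - α)).Finite :=
    (GG_fin h2 (K := K)).preimage (f := fun α => β - α) (by intro a _ b _ h; simpa using h)
  have f4 : (Function.support fun μ => bb μ (β - μ) * (if μ = β - μ then m1 μ else 0)).Finite := by
    refine fin_supp β fun μ h => ?_
    have h1 := right_ne_zero_of_mul h
    split_ifs at h1 with h3
    · have := (m1_ne h1).2
      exact ⟨this, sub_nonneg.1 (h3 ▸ this)⟩
    · exact absurd rfl h1
  have f12 := ((GG_fin h2 (K := K)).union f2).subset (Function.support_add _ _)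
  have f3 := fs1 β fun μ => bb μ (β - μ)
  have f123 := (f12.union f3).subset (Function.support_add _ _)
  have f1234 := (f123.union f4).subset (Function.support_sub _ _)
  rw [finsum_congr e, ← hd]
  have := (Int.castAddHom ℂ).map_finsum f1234
  simp only [Int.coe_castAddHom] at this
  rw [← this]
  congr 1
  rw [finsum_sub_distrib f123 f4, finsum_add_distrib f12 f3, finsum_add_distrib (GG_fin h2) f2]
  have := finsum_comp_equiv (Equiv.subLeft β) (f := GG β K)
  simp only [Equiv.subLeft_apply] at this
  rw [this]
  ring
lemma sum_range_two {f : ℕ → ℤ} (K : ℕ) : ∑ k ∈ Finset.range (2 * K), f k = ∑ k ∈ Finset.range K, f (2 * k) + ∑ k ∈ Finset.range K, f (2 * k + 1) := by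
  induction K with
  | zero => simp
  | succ K ih => rw [show 2 * (K + 1) = 2 * K + 1 + 1 by ring, Finset.sum_range_succ, Finset.sum_range_succ, ih, Finset.sum_range_succ,
      Finset.sum_range_succ]; ring
lemma E_d {β B : Q} (h2 : β 0 = 2) (hp : 0 ≤ β) (hB : β ≤ B) {K : ℕ} (hK : ht B < K) :
    qq β * dd β = 2 * Hs B (2 * K) dd β + 2 * (bb (hf β) (hf β) * dd β) - 4 * ∑ᶠ μ, GG β K μ := by
  have even : ∑ α ∈ (Finset.Icc 0 B).filter (fun α => α 0 = 0), ∑ k ∈ Finset.range K,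
      mu α * (bb α (β - (((2 * k + 1 : ℕ):ℤ)+1) • α) * dd (β - (((2 * k + 1 : ℕ):ℤ)+1) • α)) = qq (hf β) * dd β := by
    by_cases h : (2:ℤ) • hf β = β
    · have hle : hf β ≤ B := le_trans (fun i => by have := hp i; simp [hf] at this ⊢; omega) hB
      have e := E1 hle hK
      rw [dd, if_pos h, e, Hs, Finset.mul_sum]
      refine Finset.sum_congr rfl fun α _ => ?_
      rw [Finset.mul_sum]
      refine Finset.sum_congr rfl fun k _ => ?_
      have : β - (((2 * k + 1 : ℕ):ℤ)+1) • α = (2:ℤ) • (hf β - ((k:ℤ)+1) • α) := by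
        rw [smul_sub, h, smul_smul]; push_cast; congr 2
      rw [this, dd_two, bb_smul]; ring
    · rw [dd, if_neg h, mul_zero]
      refine Finset.sum_eq_zero fun α _ => Finset.sum_eq_zero fun k _ => ?_
      rw [dd, if_neg, mul_zero, mul_zero]
      intro h'
      apply h
      have := (hf_iff (β := β) (μ := hf (β - (((2 * k + 1 : ℕ):ℤ)+1) • α) + ((k:ℤ)+1) • α)).1 (by
        rw [smul_add, h', smul_smul]; push_cast; rw [show (2:ℤ) * (k+1) = 2 * k + 1 + 1 by ring]; abel)
      exact this.1
  have odd : ∑ α ∈ (Finset.Icc 0 B).filter (fun α => α 0 = 0), ∑ k ∈ Finset.range K,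
      mu α * (bb α (β - (((2 * k : ℕ):ℤ)+1) • α) * dd (β - (((2 * k : ℕ):ℤ)+1) • α)) = 2 * ∑ᶠ μ, GG β K μ := by
    rw [finsum_eq_sum_of_support_subset (s := (GG_fin h2 (K := K)).toFinset) _ (by simp), Finset.mul_sum]
    symm
    have hval : ∀ μ : Q, ∑ k ∈ Finset.range K, mu (β - (2:ℤ) • μ) * (bb (β - (2:ℤ) • μ) (β - (((2 * k : ℕ):ℤ)+1) • (β - (2:ℤ) • μ)) *
        dd (β - (((2 * k : ℕ):ℤ)+1) • (β - (2:ℤ) • μ))) = 2 * GG β K μ := by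
      intro μ
      rw [GG, Finset.mul_sum]
      refine Finset.sum_congr rfl fun k _ => ?_
      have : β - (((2 * k : ℕ):ℤ)+1) • (β - (2:ℤ) • μ) = (2:ℤ) • (μ - (k:ℤ) • (β - (2:ℤ) • μ)) := by
        push_cast; module
      rw [this, dd_two, bb_smul]; ring
    refine Finset.sum_bij_ne_zero (fun μ _ _ => β - (2:ℤ) • μ) ?_ ?_ ?_ ?_
    · intro μ hμ hn
      obtain ⟨a, b, c, d⟩ := GG_ne h2 (right_ne_zero_of_mul hn)
      rw [Finset.mem_filter, Finset.mem_Icc]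
      refine ⟨⟨d, le_trans ?_ hB⟩, by simp [a, h2]⟩
      rw [sub_le_self_iff]; exact smul_nonneg (by norm_num) b
    · intro μ _ _ μ' _ _ h
      rw [sub_right_inj] at h
      rw [← hf_two μ, h, hf_two]
    · intro α hα hn
      obtain ⟨k, _, hk⟩ := Finset.exists_ne_zero_of_sum_ne_zero hn
      have hd := right_ne_zero_of_mul (right_ne_zero_of_mul hk)
      rw [dd] at hd
      split_ifs at hd with h3
      · have ha : α = β - (2:ℤ) • (hf (β - (((2 * k : ℕ):ℤ)+1) • α) + (k:ℤ) • α) := by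
          rw [smul_add, h3]; push_cast; module
        have hG := hval (hf (β - (((2 * k : ℕ):ℤ)+1) • α) + (k:ℤ) • α)
        rw [← ha] at hG
        rw [hG] at hn
        exact ⟨_, by simpa using right_ne_zero_of_mul hn, hn, ha.symm⟩
      · exact absurd rfl hd
    · intro μ _ _; exact (hval μ).symm
  have e : Hs B (2 * K) dd β = 2 * ∑ᶠ μ, GG β K μ + qq (hf β) * dd β := by
    rw [← odd, ← even, Hs, ← Finset.sum_add_distrib]
    exact Finset.sum_congr rfl fun α _ => sum_range_two K
  rw [e]
  by_cases h : (2:ℤ) • hf β = β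
  · have : qq β = 2 * qq (hf β) + 2 * bb (hf β) (hf β) := by
      rw [qq, qq]; nth_rw 1 2 3 [← h]; rw [bb_smul, smul_bb, ht_smul]; ring
    rw [this]; ring
  · have : dd β = 0 := by rw [dd, if_neg h]
    rw [this]; ring
noncomputable def YY (β : Q) : ℤ := cv β - dd β - 2 * mu β
lemma YY_eq {β B : Q} (h2 : β 0 = 2) (hp : 0 ≤ β) (hB : β ≤ B) {K : ℕ} (hK : ht B < K) : qq β * YY β = 2 * Hs B (2 * K) YY β := by
  have hK2 : ht B < ((2 * K : ℕ) : ℤ) := by push_cast; omega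
  have e1 := E_split hB (by omega) hK2
  rw [E_A h2 hB hK] at e1
  have e1' : qq β * mu β = 2 * Hs B (2 * K) mu β + (2 * ∑ᶠ μ, GG β K μ + ∑ᶠ μ, bb μ (β - μ) * (m1 μ * m1 (β - μ)) - bb (hf β) (hf β) * dd β) := by
    exact_mod_cast e1
  have e2 := E_cv hB hK2
  have e3 := E_d h2 hp hB hK
  have e4 : Hs B (2 * K) YY β = Hs B (2 * K) cv β - Hs B (2 * K) dd β - 2 * Hs B (2 * K) mu β := by
    simp only [Hs, YY, Finset.mul_sum, ← Finset.sum_sub_distrib]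
    exact Finset.sum_congr rfl fun α _ => Finset.sum_congr rfl fun k _ => by ring
  rw [e4, YY]
  linear_combination e2 - e3 - 2 * e1'
end KMW
namespace KMW
set_option linter.unusedVariables false
set_option linter.unusedSimpArgs false
open PowerSeries in
/-- coefficient at an integer -/
noncomputable def cf (F : PowerSeries ℤ) (z : ℤ) : ℤ := if 0 ≤ z then PowerSeries.coeff z.toNat F else 0
lemma cf_nat (F : PowerSeries ℤ) (n : ℕ) : cf F n = PowerSeries.coeff n F := by simp [cf]
lemma cf_neg (F : PowerSeries ℤ) {z : ℤ} (h : z < 0) : cf F z = 0 := by rw [cf, if_neg (by omega)]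
lemma cf_ne {F : PowerSeries ℤ} {z : ℤ} (h : cf F z ≠ 0) : 0 ≤ z := by
  by_contra h'; exact h (cf_neg F (by omega))
noncomputable def DS (w : ℕ → ℕ → ℤ) : PowerSeries ℤ := PowerSeries.mk fun n => ∑ x ∈ n.divisorsAntidiagonal, w x.1 x.2
lemma DS_swap (w : ℕ → ℕ → ℤ) : DS w = DS fun k b => w b k := by
  ext n
  simp only [DS, PowerSeries.coeff_mk]
  nth_rw 1 [← Nat.map_swap_divisorsAntidiagonal]
  rw [Finset.sum_map]
  rfl
lemma DS_add (w v : ℕ → ℕ → ℤ) : DS (fun k b => w k b + v k b) = DS w + DS v := by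
  ext n; simp [DS, Finset.sum_add_distrib]
lemma DS_coeff (w : ℕ → ℕ → ℤ) (F : PowerSeries ℤ) (N K : ℕ) (hK : N < K) :
    ∑ k ∈ Finset.Icc 1 K, ∑ b ∈ Finset.Icc 1 K, w k b * cf F ((N:ℤ) - k * b) = PowerSeries.coeff N (DS w * F) := by
  rw [PowerSeries.coeff_mul, Finset.Nat.sum_antidiagonal_eq_sum_range_succ_mk]
  simp only [DS, PowerSeries.coeff_mk, Finset.sum_mul]
  rw [← Finset.sum_product', Finset.sum_sigma']
  symm
  refine Finset.sum_bij_ne_zero (fun x _ _ => x.2) ?_ ?_ ?_ ?_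
  · rintro ⟨n, k, b⟩ h _
    simp at h ⊢
    obtain ⟨h1, rfl, h3⟩ := h
    have h4 := mul_ne_zero_iff.1 h3
    have := Nat.le_mul_of_pos_right k (Nat.pos_of_ne_zero h4.2)
    have := Nat.le_mul_of_pos_left b (Nat.pos_of_ne_zero h4.1)
    omega
  · rintro ⟨n, k, b⟩ h _ ⟨n', k', b'⟩ h' _ he
    simp at h h' he
    obtain ⟨rfl, rfl⟩ := he
    have : n = n' := by rw [← h.2.1, ← h'.2.1]
    rw [this]
  · rintro ⟨k, b⟩ h hn
    have := cf_ne (right_ne_zero_of_mul hn)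
    have hle : k * b ≤ N := by zify; simpa using this
    refine ⟨⟨k * b, k, b⟩, ?_, ?_, rfl⟩
    · simp at h ⊢; exact ⟨by omega, by omega, by omega⟩
    · simp only at hn ⊢
      rw [← Nat.cast_mul, ← Nat.cast_sub hle, cf_nat] at hn; exact hn
  · rintro ⟨n, k, b⟩ h _
    simp at h
    obtain ⟨h1, rfl, h3⟩ := h
    simp only
    rw [← Nat.cast_mul, ← Nat.cast_sub (by omega), cf_nat]
/-- root pair contribution -/
lemma W_pair (F : PowerSeries ℤ) (l : ℕ) (hl : 1 ≤ l) (j : ℤ) (hj : j ≤ 0) (hj' : -l ≤ j) (N K : ℕ) (hK : N < K) :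
    (∑ u ∈ Finset.range K, (∑ k ∈ Finset.range K, (2*((k:ℤ)+1) + l * u - j) * cf F (N - ((k:ℤ)+1) * (((k:ℤ)+1) + l * u - j))
      + ∑ k ∈ Finset.range K, (if 1 ≤ u then (2*((k:ℤ)+1) + l * u + j) * cf F (N - ((k:ℤ)+1) * (((k:ℤ)+1) + l * u + j)) else 0)))
    = PowerSeries.coeff N (DS (fun k b => if (l:ℤ) ∣ b - k + j then (k:ℤ) + b else 0) * F) := by
  rw [← DS_coeff _ _ _ _ hK, ← Finset.sum_product', Finset.sum_add_distrib, ← Finset.sum_product', ← Finset.sum_product']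
  rw [← Finset.sum_filter_add_sum_filter_not (Finset.Icc 1 K ×ˢ Finset.Icc 1 K) (fun x => (x.1:ℤ) - j ≤ x.2)]
  congr 1
  · refine Finset.sum_bij_ne_zero (fun x _ _ => (x.2 + 1, (((x.2:ℤ)+1) + l * x.1 - j).toNat)) ?_ ?_ ?_ ?_
    · rintro ⟨u, k⟩ h hn
      have h0 := cf_ne (right_ne_zero_of_mul hn)
      simp at h h0 ⊢
      have : (k:ℤ) + 1 + l * u - j ≤ N := by nlinarith [(show (0:ℤ) ≤ l * u by positivity)]
      have : (0:ℤ) ≤ l * u := by positivity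
      omega
    · rintro ⟨u, k⟩ h hn ⟨u', k'⟩ h' hn' he
      simp at he ⊢
      obtain ⟨rfl, he⟩ := he
      have h1 : (0:ℤ) ≤ l * u := by positivity
      have h2 : (0:ℤ) ≤ l * u' := by positivity
      have : (l:ℤ) * u = l * u' := by omega
      simpa [show l ≠ 0 by omega] using this
    · rintro ⟨k, b⟩ h hn
      have h0 := cf_ne (right_ne_zero_of_mul hn)
      simp at h h0
      simp only at hn
      split_ifs at hn with hd
      · obtain ⟨u, hu⟩ := hd
        have hu0 : 0 ≤ u := by
          have : 0 ≤ (l:ℤ) * u := by omega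
          exact (mul_nonneg_iff_of_pos_left (by omega)).1 this
        lift u to ℕ using hu0
        have hk1 : ((k - 1 : ℕ) : ℤ) + 1 = k := by omega
        have hb : (b:ℤ) = k + l * u - j := by omega
        have hul : (u:ℤ) ≤ l * u := by nlinarith
        refine ⟨(u, k - 1), ?_, ?_, ?_⟩
        · simp; omega
        · simp only [hk1]; rw [← hb]; convert hn using 2; rw [hb]; ring
        · simp; omega
      · simp at hn
    · rintro ⟨u, k⟩ h hn
      have h1 : (0:ℤ) ≤ l * u := by positivity
      simp only
      rw [if_pos]
      · rw [Int.toNat_of_nonneg (by omega)]; push_cast; congr 1; ring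
      · rw [Int.toNat_of_nonneg (by omega)]; push_cast; exact ⟨u, by ring⟩
  · refine Finset.sum_bij_ne_zero (fun x _ _ => ((((x.2:ℤ)+1) + l * x.1 + j).toNat, x.2 + 1)) ?_ ?_ ?_ ?_
    · rintro ⟨u, k⟩ h hn
      simp only at hn
      split_ifs at hn with hu
      · have h0 := cf_ne (right_ne_zero_of_mul hn)
        simp at h h0 ⊢
        have h1 : (l:ℤ) ≤ l * u := by nlinarith
        have : (k:ℤ) + 1 + l * u + j ≤ N := by nlinarith
        omega
      · simp at hn
    · rintro ⟨u, k⟩ h hn ⟨u', k'⟩ h' hn' he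
      simp only at hn hn'
      split_ifs at hn hn' with hu hu'
      · simp at he ⊢
        obtain ⟨he, rfl⟩ := he
        have h1 : (l:ℤ) ≤ l * u := by nlinarith
        have h2 : (l:ℤ) ≤ l * u' := by nlinarith
        have : (l:ℤ) * u = l * u' := by omega
        simpa [show l ≠ 0 by omega] using this
      all_goals simp at hn hn'
    · rintro ⟨k, b⟩ h hn
      have h0 := cf_ne (right_ne_zero_of_mul hn)
      simp at h h0
      simp only at hn
      split_ifs at hn with hd
      · obtain ⟨u, hu⟩ := hd
        have hu0 : 0 < - u := by
          have : 0 < (l:ℤ) * (- u) := by rw [mul_neg, ← hu]; omega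
          exact (mul_pos_iff_of_pos_left (by omega)).1 this
        obtain ⟨v, hv⟩ : ∃ v : ℕ, (v:ℤ) = - u := ⟨(-u).toNat, by omega⟩
        have hv1 : 1 ≤ v := by omega
        have hk1 : ((b - 1 : ℕ) : ℤ) + 1 = b := by omega
        have hb : (k:ℤ) = b + l * v + j := by rw [hv]; linarith
        have hul : (v:ℤ) ≤ l * v := by nlinarith
        have hkN : (k:ℤ) ≤ N := by nlinarith
        refine ⟨(v, b - 1), ?_, ?_, ?_⟩
        · simp
          have : (v:ℤ) < K := by nlinarith
          omega
        · simp only [hk1]; rw [if_pos hv1, ← hb]; convert hn using 2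
          · rw [hb]; ring
          · rw [mul_comm]
        · simp; omega
      · simp at hn
    · rintro ⟨u, k⟩ h hn
      simp only at hn
      split_ifs at hn with hu
      · have h1 : (l:ℤ) ≤ l * u := by nlinarith
        simp only
        rw [if_pos hu, if_pos]
        · rw [Int.toNat_of_nonneg (by omega)]; push_cast; congr 1
          · ring
          · rw [mul_comm]
        · rw [Int.toNat_of_nonneg (by omega)]; push_cast; exact ⟨-u, by ring⟩
      · simp at hn
end KMW
namespace KMW
set_option linter.unusedVariables false
set_option linter.unusedSimpArgs false
lemma nrm_step (β α : Q) (k : ℤ) : bb (β - k • α) (β - k • α) = bb β β - 2 * k * bb α β + k ^ 2 * bb α α := by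
  rw [sub_bb, bb_sub, smul_bb, bb_sub, bb_smul, bb_smul, bb_comm β α]; ring
lemma mu_dl_neg' : mu ((0:ℤ) • dl) = 0 := mu_dl_neg le_rfl
lemma Hs_L0 {g : Q → ℤ} (hg : ∀ β, g β ≠ 0 → 0 ≤ β) {β B : Q} (hp : 0 ≤ β) (hB : β ≤ B) {K : ℕ} (hK : ht B < K) :
    Hs B K g β = ∑ u ∈ Finset.range K,
      ((∑ k ∈ Finset.range K, mu ((u:ℤ) • dl) * (bb ((u:ℤ) • dl) (β - ((k:ℤ)+1) • ((u:ℤ) • dl)) * g (β - ((k:ℤ)+1) • ((u:ℤ) • dl))))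
      + ∑ γ ∈ PF, ((∑ k ∈ Finset.range K, bb ((u:ℤ) • dl + γ) (β - ((k:ℤ)+1) • ((u:ℤ) • dl + γ)) * g (β - ((k:ℤ)+1) • ((u:ℤ) • dl + γ)))
        + ∑ k ∈ Finset.range K, if 1 ≤ u then bb ((u:ℤ) • dl - γ) (β - ((k:ℤ)+1) • ((u:ℤ) • dl - γ)) * g (β - ((k:ℤ)+1) • ((u:ℤ) • dl - γ)) else 0)) := by
  set Φ : Q → ℤ := fun α => ∑ k ∈ Finset.range K, mu α * (bb α (β - ((k:ℤ)+1) • α) * g (β - ((k:ℤ)+1) • α)) with hΦ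
  have hne : ∀ α, Φ α ≠ 0 → 0 ≤ α ∧ α ≤ β ∧ mu α ≠ 0 := by
    intro α h
    obtain ⟨k, _, hk⟩ := Finset.exists_ne_zero_of_sum_ne_zero h
    have h1 := left_ne_zero_of_mul hk
    have h2 := hg _ (right_ne_zero_of_mul (right_ne_zero_of_mul hk))
    exact ⟨(mu_ne h1).1, le_of_sub (by omega) (mu_ne h1).1 h2, h1⟩
  have e : Hs B K g β = ∑ᶠ α : Q, if α 0 = 0 then Φ α else 0 := by
    rw [finsum_eq_sum_of_support_subset (s := Finset.Icc 0 B), Hs, Finset.sum_filter]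
    intro α h
    have h' : Φ α ≠ 0 := by
      intro h0; apply h; simp [h0]
    have := hne α h'
    rw [Finset.coe_Icc]; exact ⟨this.1, this.2.1.trans hB⟩
  rw [e, L0sum _ K]
  · refine Finset.sum_congr rfl fun u _ => ?_
    rw [if_pos (by simp [dl0])]
    refine congrArg₂ (· + ·) rfl ?_
    · refine Finset.sum_congr rfl fun γ hγ => ?_
      have hγ0 := (PF_prop hγ).1
      have a0 : ((u:ℤ) • dl + γ) 0 = 0 := by simp [dl0, hγ0]
      have s0 : ((u:ℤ) • dl - γ) 0 = 0 := by simp [dl0, hγ0]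
      rw [if_pos a0, if_pos s0, hΦ]
      simp only
      rw [PF_add hγ, PF_sub hγ, if_pos (by positivity)]
      simp only [one_mul]
      congr 1
      refine Finset.sum_congr rfl fun k _ => ?_
      by_cases h : 1 ≤ u
      · rw [if_pos h, if_pos (by omega), one_mul]
      · rw [if_neg h, if_neg (by omega), zero_mul]
  · intro α h
    split_ifs at h with h0
    · obtain ⟨a, b, c⟩ := hne α h
      refine ⟨h0, c, ?_⟩
      have h1 : α 1 ≤ β 1 := b 1
      have h2 : β 1 ≤ ht β := Finset.single_le_sum (f := β) (fun i _ => hp i) (Finset.mem_univ 1)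
      have := ht_mono hB
      omega
    · exact absurd rfl h
lemma Hs_eval (F : PowerSeries ℤ) (l : ℕ) (hl : 1 ≤ l) {g : Q → ℤ} (hg : ∀ β, g β ≠ 0 → 0 ≤ β) {β B : Q} (h0 : β 0 = l) (hp : 0 ≤ β)
    (hB : β ≤ B) {K : ℕ} (hK : ht B < K) {N : ℕ} (hN : N < K) (hj : ∀ γ ∈ PF, - (l:ℤ) ≤ bb β γ ∧ bb β γ ≤ 0) {c : ℤ}
    (hc : bb β β = 2 * (c - N)) (hlow : ∀ β' : Q, β' 0 = (l:ℤ) → ∀ z : ℤ, z < N → bb β' β' = 2 * (c - z) → g β' = cf F z) :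
    Hs B K g β = - PowerSeries.coeff N (((8 * l : ℤ) • DS (fun k b => if l ∣ b then (k:ℤ) else 0) +
      ∑ γ ∈ PF, DS (fun k b => if (l:ℤ) ∣ b - k + bb β γ then (k:ℤ) + b else 0)) * F) := by
  have hadd : ∀ γ ∈ PF, ∀ u k : ℕ, bb ((u:ℤ) • dl + γ) (β - ((k:ℤ)+1) • ((u:ℤ) • dl + γ)) * g (β - ((k:ℤ)+1) • ((u:ℤ) • dl + γ))
      = - ((2*((k:ℤ)+1) + l * u - bb β γ) * cf F (N - ((k:ℤ)+1) * (((k:ℤ)+1) + l * u - bb β γ))) := by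
    intro γ hγ u k
    obtain ⟨p0, p1, p2, p3⟩ := PF_prop hγ
    have e1 : bb ((u:ℤ) • dl + γ) β = bb β γ - l * u := by
      rw [add_bb, smul_bb, dl_bb, h0, bb_comm γ]; ring
    have e2 : bb ((u:ℤ) • dl + γ) ((u:ℤ) • dl + γ) = 2 := by
      rw [nrm_add p0, p3]
    rw [hlow _ (by simp [h0, dl0, p0]) (N - ((k:ℤ)+1) * (((k:ℤ)+1) + l * u - bb β γ))]
    · rw [bb_sub, bb_smul, e1, e2]; ring
    · have : (0:ℤ) ≤ l * u := by positivity
      nlinarith [(hj γ hγ).2]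
    · rw [nrm_step, e2, e1, hc]; ring
  have hsub : ∀ γ ∈ PF, ∀ u k : ℕ, 1 ≤ u → bb ((u:ℤ) • dl - γ) (β - ((k:ℤ)+1) • ((u:ℤ) • dl - γ)) * g (β - ((k:ℤ)+1) • ((u:ℤ) • dl - γ))
      = - ((2*((k:ℤ)+1) + l * u + bb β γ) * cf F (N - ((k:ℤ)+1) * (((k:ℤ)+1) + l * u + bb β γ))) := by
    intro γ hγ u k hu
    obtain ⟨p0, p1, p2, p3⟩ := PF_prop hγ
    have e1 : bb ((u:ℤ) • dl - γ) β = - bb β γ - l * u := by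
      rw [sub_bb, smul_bb, dl_bb, h0, bb_comm γ]; ring
    have e2 : bb ((u:ℤ) • dl - γ) ((u:ℤ) • dl - γ) = 2 := by
      rw [nrm_sub p0, p3]
    rw [hlow _ (by simp [h0, dl0, p0]) (N - ((k:ℤ)+1) * (((k:ℤ)+1) + l * u + bb β γ))]
    · rw [bb_sub, bb_smul, e1, e2]; ring
    · have : (l:ℤ) ≤ l * u := by nlinarith
      nlinarith [(hj γ hγ).1]
    · rw [nrm_step, e2, e1, hc]; ring
  have him : ∀ u k : ℕ, mu ((u:ℤ) • dl) * (bb ((u:ℤ) • dl) (β - ((k:ℤ)+1) • ((u:ℤ) • dl)) * g (β - ((k:ℤ)+1) • ((u:ℤ) • dl)))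
      = - ((8 * l) * (u * cf F (N - l * ((k:ℤ)+1) * u))) := by
    intro u k
    by_cases hu : 1 ≤ u
    · rw [mu_dl (by omega)]
      have e1 : bb ((u:ℤ) • dl) β = - l * u := by rw [smul_bb, dl_bb, h0]; ring
      have e2 : bb ((u:ℤ) • dl) ((u:ℤ) • dl) = 0 := by rw [smul_bb, bb_smul, dl_bb, dl0]; ring
      rw [hlow _ (by simp [h0, dl0]) (N - l * ((k:ℤ)+1) * u)]
      · rw [bb_sub, bb_smul, e1, e2]; ring
      · have : (0:ℤ) < l * ((k:ℤ)+1) * u := by positivity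
        linarith
      · rw [nrm_step, e2, e1, hc]; ring
    · obtain rfl : u = 0 := by omega
      simp only [Nat.cast_zero, mu_dl_neg']; ring
  have eim : ∑ u ∈ Finset.range K, ∑ k ∈ Finset.range K, (u * cf F (N - l * ((k:ℤ)+1) * u)) =
      PowerSeries.coeff N (DS (fun k b => if l ∣ b then (k:ℤ) else 0) * F) := by
    rw [← DS_coeff _ _ _ _ hN, ← Finset.sum_product', ← Finset.sum_product']
    refine Finset.sum_bij_ne_zero (fun x _ _ => (x.1, l * (x.2 + 1))) ?_ ?_ ?_ ?_
    · rintro ⟨u, k⟩ h hn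
      have h1 := cf_ne (right_ne_zero_of_mul hn)
      have h2 := left_ne_zero_of_mul hn
      simp at h h1 h2 ⊢
      have h3 : l * (k + 1) * u ≤ N := by zify; exact h1
      have h4 := Nat.le_mul_of_pos_right (l * (k+1)) (show 0 < u by omega)
      have h5 : 1 ≤ l * (k+1) := Nat.mul_pos (by omega) (by omega)
      omega
    · rintro ⟨u, k⟩ h hn ⟨u', k'⟩ h' hn' he
      simp [show l ≠ 0 by omega] at he ⊢
      exact he
    · rintro ⟨u, b⟩ h hn
      have h1 := cf_ne (right_ne_zero_of_mul hn)
      simp only at hn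
      split_ifs at hn with hd
      · obtain ⟨k, rfl⟩ := hd
        simp at h h1
        have hk : k ≠ 0 := by rintro rfl; omega
        obtain ⟨k, rfl⟩ := Nat.exists_eq_succ_of_ne_zero hk
        have h3 : u * (l * (k + 1)) ≤ N := by zify; push_cast at h1; exact h1
        have h4 := Nat.le_mul_of_pos_right u (Nat.mul_pos (show 0 < l by omega) (Nat.succ_pos k))
        have h5 := Nat.le_mul_of_pos_left (l * (k+1)) (show 0 < u by omega)
        have h6 := Nat.le_mul_of_pos_left (k+1) (show 0 < l by omega)
        refine ⟨(u, k), ?_, ?_, rfl⟩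
        · simp; simp at h4; omega
        · convert hn using 3; push_cast; ring
      · simp at hn
    · rintro ⟨u, k⟩ h hn
      simp only
      rw [if_pos (Dvd.intro _ rfl)]; push_cast; congr 2; ring
  rw [Hs_L0 hg hp hB hK, add_mul, map_add, smul_mul_assoc, map_smul, ← eim, Finset.sum_mul, map_sum]
  rw [Finset.sum_add_distrib, Finset.sum_comm (t := PF), neg_add]
  congr 1
  · simp only [him, smul_eq_mul, Finset.mul_sum, Finset.sum_neg_distrib]
  · rw [← Finset.sum_neg_distrib]
    refine Finset.sum_congr rfl fun γ hγ => ?_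
    rw [← W_pair F l hl _ (hj γ hγ).2 (hj γ hγ).1 N K hN, ← Finset.sum_neg_distrib]
    refine Finset.sum_congr rfl fun u _ => ?_
    rw [neg_add, ← Finset.sum_neg_distrib, ← Finset.sum_neg_distrib]
    congr 1
    · exact Finset.sum_congr rfl fun k _ => hadd γ hγ u k
    · refine Finset.sum_congr rfl fun k _ => ?_
      by_cases hu : 1 ≤ u
      · rw [if_pos hu, if_pos hu]; exact hsub γ hγ u k hu
      · rw [if_neg hu, if_neg hu, neg_zero]
end KMW
namespace KMW
set_option linter.unusedVariables false
set_option linter.unusedSimpArgs false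
def anti (β : Q) : Prop := ∀ i, i ≠ 0 → rowE β i ≤ 0
lemma anti_neg {β x : Q} (h : anti β) (hx : 0 ≤ x) (h0 : x 0 = 0) : bb β x ≤ 0 := by
  rw [bb_comm, bb]
  refine Finset.sum_nonpos fun i _ => ?_
  by_cases hi : i = 0
  · subst hi; rw [h0]; simp
  · exact mul_nonpos_of_nonneg_of_nonpos (hx i) (h i hi)
lemma anti_j {β γ : Q} {l : ℕ} (h : anti β) (h0 : β 0 = l) (hγ : γ ∈ PF) : -(l:ℤ) ≤ bb β γ ∧ bb β γ ≤ 0 := by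
  obtain ⟨p0, p1, p2, p3⟩ := PF_prop hγ
  refine ⟨?_, anti_neg h p2 p0⟩
  have h1 : 0 ≤ (1:ℤ) • dl - γ := (mu_ne (by rw [PF_sub hγ]; simp)).1
  have h2 := anti_neg h h1 (by simp [dl0, p0])
  rw [bb_sub, bb_smul, bb_dl, h0] at h2
  linarith
lemma solve_cls (v : Q) {β : Q} (h0 : β 0 = v 0) (h : ∀ i, i ≠ 0 → rowE β i = rowE v i) : β = v + (β 1 - v 1) • dl := by
  refine solve_rows (by simp [h0, dl0]) (by simp [dl1]) ?_
  intro i hi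
  rw [← bb_al (_ + _), bb_add, bb_smul, bb_al, bb_dl, h i hi]
  simp [al, hi.symm]
lemma gen_ind {l c : ℤ} (hl : 0 < l) (F : PowerSeries ℤ) (g : Q → ℤ) (inv : ∀ β i, i ≠ 0 → β 0 = l → g (sr' i β) = g β)
    (hA : ∀ β z, β 0 = l → anti β → bb β β = 2 * (c - z) →
      (0 ≤ z → ∀ β' : Q, β' 0 = l → ∀ z' : ℤ, z' < z → bb β' β' = 2 * (c - z') → g β' = cf F z') → g β = cf F z) :
    ∀ β z, β 0 = l → bb β β = 2 * (c - z) → g β = cf F z := by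
  have key : ∀ z, (0 ≤ z → ∀ β' : Q, β' 0 = l → ∀ z' : ℤ, z' < z → bb β' β' = 2 * (c - z') → g β' = cf F z') →
      ∀ β, β 0 = l → bb β β = 2 * (c - z) → g β = cf F z := by
    intro z hz
    refine descent hl _ ?_ ?_
    · intro β i hi h0 h hn
      rw [← inv β i hi h0]
      exact h (by rw [sr'_norm, hn])
    · intro β h0 ha hn
      exact hA β z h0 ha hn hz
  have neg : ∀ z, z < 0 → ∀ β, β 0 = l → bb β β = 2 * (c - z) → g β = cf F z := fun z hz => key z (fun h => by omega)
  have pos : ∀ n : ℕ, ∀ β, β 0 = l → bb β β = 2 * (c - n) → g β = cf F n := by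
    intro n
    induction n using Nat.strong_induction_on with
    | _ n ih =>
      refine key n fun _ β' h0 z' hz hn => ?_
      by_cases h : z' < 0
      · exact neg z' h β' h0 hn
      · lift z' to ℕ using by omega
        exact ih z' (by omega) β' h0 hn
  intro β z
  by_cases h : z < 0
  · exact neg z h β
  · lift z to ℕ using by omega
    exact pos z β
lemma mu_sr (β : Q) (i : Fin 10) (hi : i ≠ 0) (h : β 0 ≠ 0) : mu (sr' i β) = mu β := mu_refl i ⟨0, hi.symm, h⟩
lemma m1_sr (β : Q) (i : Fin 10) (hi : i ≠ 0) : m1 (sr' i β) = m1 β := by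
  have := sr'_ne i 0 hi.symm β
  rw [m1, m1, this]
  split_ifs with h
  · exact mu_sr β i hi (by omega)
  · rfl
lemma DS_sym (P : ℕ → ℕ → Prop) [∀ a b, Decidable (P a b)] (h : ∀ a b, P a b ↔ P b a) :
    DS (fun k b => if P k b then (k:ℤ) + b else 0) = 2 • DS (fun k b => if P k b then (k:ℤ) else 0) := by
  have : (fun k b : ℕ => if P k b then (k:ℤ) + b else 0) = fun k b => (if P k b then (k:ℤ) else 0) + (if P k b then (b:ℤ) else 0) := by
    funext k b; split_ifs <;> simp
  rw [this, DS_add, two_nsmul]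
  congr 1
  rw [DS_swap]
  simp only [h]
/-- sigma series -/
noncomputable def S1 : PowerSeries ℤ := DS fun k _ => (k:ℤ)
theorem m1_val (F : PowerSeries ℤ) (hF0 : PowerSeries.coeff 0 F = 1) (hF : ∀ n : ℕ, (n:ℤ) * PowerSeries.coeff n F = 8 * PowerSeries.coeff n (S1 * F))
    (μ : Q) (z : ℤ) (h0 : μ 0 = 1) (hn : bb μ μ = 2 * (1 - z)) : m1 μ = cf F z := by
  refine gen_ind (l := 1) (c := 1) (by norm_num) F m1 (fun β i hi _ => m1_sr β i hi) ?_ μ z h0 hn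
  intro β z h0 ha hn hlow
  have hm := sum_marks β
  have a1 := ha 1 (by decide); have a2 := ha 2 (by decide); have a3 := ha 3 (by decide); have a4 := ha 4 (by decide)
  have a5 := ha 5 (by decide); have a6 := ha 6 (by decide); have a7 := ha 7 (by decide); have a8 := ha 8 (by decide)
  have a9 := ha 9 (by decide)
  have hb : β = al 0 + (β 1) • dl := by
    have := solve_cls (al 0) (β := β) (by simp [h0, al]) ?_
    · simpa [-zsmul_eq_mul, al] using this
    intro i hi
    have r : ∀ i, rowE (al 0) i = ![2,-1,0,0,0,0,0,0,0,0] i := by decide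
    rw [r]
    fin_cases i
    · exact absurd rfl hi
    all_goals simp only [Fin.mk_one, Fin.reduceFinMk, Matrix.cons_val]; omega
  set n := β 1 with hnn
  have e1 : bb β β = 2 - 2 * n := by
    rw [hb, bb_add, bb_smul, bb_dl, add_bb, smul_bb, dl_bb, bb_al]
    simp [rowE, al, dl0]; ring
  have e2 : ht β = 1 + 30 * n := by rw [hb, ht_add, ht_smul, ht_dl, ht_al]; ring
  obtain rfl : z = n := by linarith
  rcases lt_trichotomy n 0 with h | h | h
  · rw [cf_neg F h]
    by_contra hne
    have := (m1_ne hne).2 1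
    simp at this; omega
  · rw [h] at hb ⊢
    rw [zero_smul, add_zero] at hb
    rw [hb, m1, if_pos (by simp [al]), mu_al]
    rw [show (0:ℤ) = ((0:ℕ):ℤ) by rfl, cf_nat, hF0]
  · have hp : 0 ≤ β := by
      rw [hb]; refine add_nonneg ?_ (smul_nonneg h.le dl_nonneg)
      exact Pi.single_nonneg.2 (by norm_num)
    obtain ⟨N, hN⟩ : ∃ N : ℕ, n = N := ⟨n.toNat, by omega⟩
    obtain ⟨K, hK⟩ : ∃ K : ℕ, ht β < K ∧ N < K := ⟨(ht β).toNat + 1 + N, by omega, by omega⟩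
    rw [hN] at hlow hn ⊢
    have ev := E1 (le_refl β) hK.1
    rw [Hs_eval F 1 le_rfl (fun β h => (m1_ne h).2) (by simpa using h0) hp le_rfl hK.1 hK.2 (fun γ hγ => anti_j ha (by simpa using h0) hγ) hn
      (fun β' h => hlow (by omega) β' (by simpa using h))] at ev
    have hs : (((8 * (1:ℕ) : ℤ) • DS (fun k b => if 1 ∣ b then (k:ℤ) else 0) +
      ∑ γ ∈ PF, DS (fun k b => if ((1:ℕ):ℤ) ∣ b - k + bb β γ then (k:ℤ) + b else 0)) * F) = (248:ℤ) • (S1 * F) := by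
      have := DS_sym (fun _ _ => True) (fun _ _ => Iff.rfl)
      simp only [if_true] at this
      simp only [Nat.cast_one, one_dvd, if_true, Finset.sum_const, PF_card, this]
      rw [← S1, ← smul_mul_assoc]; congr 1; module
    rw [hs, map_smul, smul_eq_mul] at ev
    rw [cf_nat]
    have hF' := hF N
    rw [qq, e1, e2] at ev
    have : (N:ℤ) * (m1 β - PowerSeries.coeff N F) = 0 := by rw [hN] at ev; linarith
    rcases mul_eq_zero.1 this with h' | h'
    · omega
    · linarith
end KMW
namespace KMW
set_option linter.unusedVariables false
set_option linter.unusedSimpArgs false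
lemma cv_ne {β : Q} (h : cv β ≠ 0) : 0 ≤ β := by
  obtain ⟨μ, hμ⟩ : ∃ μ, m1 μ * m1 (β - μ) ≠ 0 := by
    by_contra hh; push Not at hh; exact h (finsum_eq_zero_of_forall_eq_zero hh)
  have h1 := (m1_ne (left_ne_zero_of_mul hμ)).2
  have h2 := (m1_ne (right_ne_zero_of_mul hμ)).2
  simpa using add_nonneg h1 h2
lemma dd_ne {β : Q} (h : dd β ≠ 0) : 0 ≤ β := by
  rw [dd] at h; split_ifs at h with h1
  · rw [← h1]; exact smul_nonneg (by norm_num) (m1_ne h).2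
  · exact absurd rfl h
lemma YY_ne {β : Q} (h : YY β ≠ 0) : 0 ≤ β := by
  by_contra hn
  apply h
  have h1 : cv β = 0 := by by_contra h'; exact hn (cv_ne h')
  have h2 : dd β = 0 := by by_contra h'; exact hn (dd_ne h')
  have h3 : mu β = 0 := by by_contra h'; exact hn (mu_ne h').1
  rw [YY, h1, h2, h3]; rfl
lemma sr'_add (i) (x y : Q) : sr' i (x + y) = sr' i x + sr' i y := by
  simp only [sr', ← bb_al, bb_add]; module
lemma sr'_smul (i) (n : ℤ) (x : Q) : sr' i (n • x) = n • sr' i x := by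
  simp only [sr', ← bb_al, bb_smul]; module
lemma sr'_sub (i) (x y : Q) : sr' i (x - y) = sr' i x - sr' i y := by
  simp only [sr', ← bb_al, bb_sub]; module
lemma sr'_sr' (i) (x : Q) : sr' i (sr' i x) = x := by
  have : rowE (al i) i = 2 := by fin_cases i <;> rfl
  simp only [sr', ← bb_al, bb_sub, bb_smul]; rw [bb_al, bb_al, this]; module
def srE (i : Fin 10) : Q ≃ Q := ⟨sr' i, sr' i, sr'_sr' i, sr'_sr' i⟩
lemma cv_sr (β : Q) (i : Fin 10) (hi : i ≠ 0) : cv (sr' i β) = cv β := by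
  rw [cv, ← finsum_comp_equiv (srE i), cv]
  refine finsum_congr fun μ => ?_
  change m1 (sr' i μ) * m1 (sr' i β - sr' i μ) = _
  rw [← sr'_sub, m1_sr _ _ hi, m1_sr _ _ hi]
lemma dd_sr (β : Q) (i : Fin 10) (hi : i ≠ 0) : dd (sr' i β) = dd β := by
  by_cases h : (2:ℤ) • hf β = β
  · rw [← h, sr'_smul, dd_two, dd_two, m1_sr _ _ hi]
  · rw [dd, dd, if_neg h, if_neg]
    intro h'
    apply h
    refine (hf_iff (μ := sr' i (hf (sr' i β))).1 ?_).1
    rw [← sr'_smul, h', sr'_sr']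
lemma YY_sr (β : Q) (i : Fin 10) (hi : i ≠ 0) (h : β 0 = 2) : YY (sr' i β) = YY β := by
  rw [YY, YY, cv_sr _ _ hi, dd_sr _ _ hi, mu_sr _ _ hi (by omega)]
def vr : Q := ![2,1,0,0,0,0,0,0,0,0]
def v0 : Q := ![2,0,0,0,0,0,0,0,0,0]
def v4 : Q := ![2,2,2,2,2,2,2,1,0,1]
lemma anti_cls {β : Q} (h0 : β 0 = 2) (ha : anti β) : ∃ n : ℤ, β = vr + n • dl ∨ β = v0 + n • dl ∨ β = v4 + n • dl := by
  have hm := sum_marks β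
  have a1 := ha 1 (by decide); have a2 := ha 2 (by decide); have a3 := ha 3 (by decide); have a4 := ha 4 (by decide)
  have a5 := ha 5 (by decide); have a6 := ha 6 (by decide); have a7 := ha 7 (by decide); have a8 := ha 8 (by decide)
  have a9 := ha 9 (by decide)
  have r1 : ∀ i, rowE vr i = ![3,0,-1,0,0,0,0,0,0,0] i := by decide
  have r2 : ∀ i, rowE v0 i = ![4,-2,0,0,0,0,0,0,0,0] i := by decide
  have r3 : ∀ i, rowE v4 i = ![2,0,0,0,0,0,0,0,-1,0] i := by decide
  have z3 : rowE β 3 = 0 := by omega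
  have z4 : rowE β 4 = 0 := by omega
  have z5 : rowE β 5 = 0 := by omega
  have z6 : rowE β 6 = 0 := by omega
  have z7 : rowE β 7 = 0 := by omega
  have z9 : rowE β 9 = 0 := by omega
  have c : rowE β 2 = -1 ∨ rowE β 1 = -2 ∨ rowE β 8 = -1 := by omega
  rcases c with c | c | c
  · refine ⟨_, Or.inl (solve_cls vr h0 ?_)⟩
    intro i hi; rw [r1]
    fin_cases i
    · exact absurd rfl hi
    all_goals simp only [Fin.mk_one, Fin.reduceFinMk, Matrix.cons_val]; omega
  · refine ⟨_, Or.inr (Or.inl (solve_cls v0 h0 ?_))⟩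
    intro i hi; rw [r2]
    fin_cases i
    · exact absurd rfl hi
    all_goals simp only [Fin.mk_one, Fin.reduceFinMk, Matrix.cons_val]; omega
  · refine ⟨_, Or.inr (Or.inr (solve_cls v4 h0 ?_))⟩
    intro i hi; rw [r3]
    fin_cases i
    · exact absurd rfl hi
    all_goals simp only [Fin.mk_one, Fin.reduceFinMk, Matrix.cons_val]; omega
lemma cnt_r : (PF.filter (fun γ => 2 ∣ bb vr γ)).card = 64 := by decide +kernel
lemma cnt_0 : (PF.filter (fun γ => 2 ∣ bb v0 γ)).card = 120 := by decide +kernel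
lemma cnt_4 : (PF.filter (fun γ => 2 ∣ bb v4 γ)).card = 56 := by decide +kernel
/-- auxiliary divisor series -/
noncomputable def Y2 : PowerSeries ℤ := DS fun k b => if 2 ∣ b then (k:ℤ) else 0
noncomputable def Ee : PowerSeries ℤ := DS fun k b => if (2:ℤ) ∣ b - k then (k:ℤ) else 0
noncomputable def Oo : PowerSeries ℤ := DS fun k b => if ¬ (2:ℤ) ∣ b - k then (k:ℤ) else 0
lemma YY_step (F : PowerSeries ℤ) {v : Q} {n : ℤ} {N e : ℕ} (hv : v 0 = 2) (he : (PF.filter (fun γ => 2 ∣ bb v γ)).card = e)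
    (ha : anti (v + n • dl)) (hp : 0 ≤ v + n • dl) (hn : bb (v + n • dl) (v + n • dl) = 2 * (3 - N))
    (hlow : ∀ β' : Q, β' 0 = 2 → ∀ z' : ℤ, z' < N → bb β' β' = 2 * (3 - z') → YY β' = cf F z') :
    - qq (v + n • dl) * YY (v + n • dl) =
      32 * PowerSeries.coeff N (Y2 * F) + 4 * e * PowerSeries.coeff N (Ee * F) + 4 * (120 - e) * PowerSeries.coeff N (Oo * F) := by
  set β := v + n • dl with hβ
  have h0 : β 0 = 2 := by rw [hβ]; simp [dl0, hv]
  obtain ⟨K, hK⟩ : ∃ K : ℕ, ht β < K ∧ N < K := ⟨(ht β).toNat + 1 + N, by omega, by omega⟩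
  have ev := YY_eq h0 hp le_rfl hK.1
  rw [Hs_eval F 2 (by norm_num) (fun β h => YY_ne h) h0 hp le_rfl (by push_cast; omega) (show N < 2 * K by omega) (fun γ hγ => anti_j ha h0 hγ) hn hlow] at ev
  have hs : ∑ γ ∈ PF, DS (fun k b => if ((2:ℕ):ℤ) ∣ b - k + bb β γ then (k:ℤ) + b else 0) = (2 * e : ℤ) • Ee + (2 * (120 - e) : ℤ) • Oo := by
    have h1 := DS_sym (fun k b => (2:ℤ) ∣ b - k) (fun a b => by rw [← dvd_neg, neg_sub])
    have h2 := DS_sym (fun k b => ¬ (2:ℤ) ∣ b - k) (fun a b => by rw [← dvd_neg, neg_sub])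
    have h3 : ∀ γ ∈ PF, DS (fun k b => if ((2:ℕ):ℤ) ∣ b - k + bb β γ then (k:ℤ) + b else 0) = if 2 ∣ bb v γ then 2 • Ee else 2 • Oo := by
      intro γ hγ
      have : bb β γ = bb v γ := by rw [hβ, add_bb, smul_bb, dl_bb, (PF_prop hγ).1]; ring
      rw [this]
      split_ifs with h
      · rw [Ee, ← h1]; congr 1; funext k b
        refine if_congr ?_ rfl rfl
        push_cast; omega
      · rw [Oo, ← h2]; congr 1; funext k b
        refine if_congr ?_ rfl rfl
        push_cast; omega
    rw [Finset.sum_congr rfl h3, Finset.sum_ite, Finset.sum_const, Finset.sum_const, he]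
    have h4 := Finset.card_filter_add_card_filter_not (s := PF) (fun γ => 2 ∣ bb v γ)
    rw [he, PF_card] at h4
    have h5 : ((PF.filter (fun γ => ¬ 2 ∣ bb v γ)).card : ℤ) = 120 - e := by omega
    rw [← h5]; module
  rw [hs, ← Y2] at ev
  simp only [add_mul, smul_mul_assoc, map_add] at ev
  rw [map_smul, map_smul, map_smul] at ev
  simp only [smul_eq_mul] at ev
  push_cast at ev
  linarith
lemma YY_base : YY vr = 2 := by
  have ma : m1 (al 0) = 1 := by rw [m1, if_pos (by simp [al]), mu_al]
  have mb : m1 ![1,1,0,0,0,0,0,0,0,0] = 1 := by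
    have := m1_sr (al 0) 1 (by decide)
    rwa [ma, show sr' 1 (al 0) = ![1,1,0,0,0,0,0,0,0,0] by decide] at this
  have hc : cv vr = 2 := by
    rw [cv, finsum_eq_sum_of_support_subset (s := {al 0, ![1,1,0,0,0,0,0,0,0,0]})]
    · rw [Finset.sum_pair (by decide), show vr - al 0 = ![1,1,0,0,0,0,0,0,0,0] by decide,
        show vr - ![1,1,0,0,0,0,0,0,0,0] = al 0 by decide, ma, mb]; rfl
    · intro μ h
      obtain ⟨a1, a2⟩ := m1_ne (left_ne_zero_of_mul h)
      obtain ⟨b1, b2⟩ := m1_ne (right_ne_zero_of_mul h)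
      have hh : ∀ i : Fin 10, 0 ≤ μ i ∧ μ i ≤ vr i := fun i => ⟨a2 i, sub_nonneg.1 (b2 i)⟩
      have h1 := hh 1; have h2 := hh 2; have h3 := hh 3; have h4 := hh 4; have h5 := hh 5; have h6 := hh 6; have h7 := hh 7
      have h8 := hh 8; have h9 := hh 9
      simp [vr] at h1 h2 h3 h4 h5 h6 h7 h8 h9
      rw [Finset.mem_coe, Finset.mem_insert, Finset.mem_singleton]
      have : μ 1 = 0 ∨ μ 1 = 1 := by omega
      rcases this with h | h
      · left; funext i; fin_cases i <;> simp [al, a1] <;> omega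
      · right; funext i; fin_cases i <;> simp [al, a1] <;> omega
  have hd : dd vr = 0 := by rw [dd, if_neg]; decide
  have hm : mu vr = 0 := by
    rw [← mu_refl 0 ⟨1, by decide, by decide⟩]
    by_contra h
    have := (mu_ne h).1 0
    revert this; decide
  rw [YY, hc, hd, hm]; rfl
lemma YY_v0 : YY v0 = 0 := by
  have e := YY_eq (β := v0) (B := v0) (by decide) (by intro i; fin_cases i <;> simp [v0]) le_rfl (K := 3) (by decide)
  have : Hs v0 (2 * 3) YY v0 = 0 := by
    refine Finset.sum_eq_zero fun α hα => Finset.sum_eq_zero fun k _ => ?_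
    rw [Finset.mem_filter, Finset.mem_Icc] at hα
    have : α = 0 := by
      funext i
      have a := hα.1.1 i; have b := hα.1.2 i
      by_cases hi : i = 0
      · subst hi; exact hα.2
      · have : v0 i = 0 := by clear a b; revert hi; revert i; decide
        exact le_antisymm (b.trans this.le) a
    rw [this, mu_zero, zero_mul]
  rw [this, show qq v0 = 4 by decide] at e
  omega
theorem YY_val (F : PowerSeries ℤ) (hF0 : PowerSeries.coeff 0 F = 2)
    (hr : ∀ n : ℕ, 32 * ((2*n:ℕ):ℤ) * PowerSeries.coeff (2*n) F = 32 * PowerSeries.coeff (2*n) (Y2 * F) + 256 * PowerSeries.coeff (2*n) (Ee * F)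
      + 224 * PowerSeries.coeff (2*n) (Oo * F))
    (h0 : ∀ n : ℕ, (32 * ((2*n+1:ℕ):ℤ) + 28) * PowerSeries.coeff (2*n+1) F = 32 * PowerSeries.coeff (2*n+1) (Y2 * F)
      + 480 * PowerSeries.coeff (2*n+1) (Ee * F))
    (h4 : ∀ n : ℕ, (32 * ((2*n+1:ℕ):ℤ) - 4) * PowerSeries.coeff (2*n+1) F = 32 * PowerSeries.coeff (2*n+1) (Y2 * F)
      + 224 * PowerSeries.coeff (2*n+1) (Ee * F) + 256 * PowerSeries.coeff (2*n+1) (Oo * F))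
    (β : Q) (z : ℤ) (hβ : β 0 = 2) (hn : bb β β = 2 * (3 - z)) : YY β = cf F z := by
  refine gen_ind (l := 2) (c := 3) (by norm_num) F YY (fun β i hi h => YY_sr β i hi h) ?_ β z hβ hn
  clear hn hβ z β
  intro β z hβ ha hn hlow
  have nrm : ∀ (v : Q) (n : ℤ), v 0 = 2 → bb (v + n • dl) (v + n • dl) = bb v v - 4 * n := by
    intro v n hv
    rw [bb_add, bb_smul, bb_dl, add_bb, smul_bb, dl_bb]; simp [hv, dl0]; ring
  have hq : ∀ (v : Q) (n : ℤ), v 0 = 2 → qq (v + n • dl) = bb v v - 2 * ht v - 64 * n := by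
    intro v n hv
    rw [qq, nrm v n hv, ht_add, ht_smul, ht_dl]; ring
  have pos : ∀ (v : Q) (n : ℤ), 0 ≤ v → 0 ≤ n → 0 ≤ v + n • dl := fun v n hv hn => add_nonneg hv (smul_nonneg hn dl_nonneg)
  obtain ⟨n, rfl | rfl | rfl⟩ := anti_cls hβ ha
  · have e := nrm vr n rfl
    rw [show bb vr vr = 6 by decide] at e
    obtain rfl : z = 2 * n := by linarith
    rcases lt_trichotomy n 0 with h | h | h
    · rw [cf_neg F (by omega)]
      by_contra hne
      have := YY_ne hne 2
      simp [vr, dl] at this; omega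
    · rw [h, zero_smul, add_zero, YY_base, mul_zero]
      rw [show (0:ℤ) = ((0:ℕ):ℤ) by rfl, cf_nat, hF0]
    · lift n to ℕ using h.le
      have ev := YY_step F (N := 2 * n) rfl cnt_r ha (pos _ _ (by intro i; fin_cases i <;> simp [vr]) h.le) (by push_cast; exact hn) (by push_cast; exact hlow (by omega))
      rw [hq vr _ rfl, show bb vr vr = 6 by decide, show ht vr = 3 by decide] at ev
      have := hr n
      rw [show (2:ℤ) * n = ((2 * n : ℕ) : ℤ) by push_cast; rfl, cf_nat]
      push_cast at ev this
      have h' : (n:ℤ) * (YY (vr + (n:ℤ) • dl) - PowerSeries.coeff (2*n) F) = 0 := by linarith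
      rcases mul_eq_zero.1 h' with h' | h'
      · omega
      · linarith
  · have e := nrm v0 n rfl
    rw [show bb v0 v0 = 8 by decide] at e
    obtain rfl : z = 2 * n - 1 := by linarith
    rcases lt_trichotomy n 0 with h | h | h
    · rw [cf_neg F (by omega)]
      by_contra hne
      have := YY_ne hne 2
      simp [v0, dl] at this; omega
    · rw [h, zero_smul, add_zero, YY_v0, cf_neg F (by norm_num)]
    · obtain ⟨m, rfl⟩ : ∃ m : ℕ, n = m + 1 := ⟨(n-1).toNat, by omega⟩
      have hz : 2 * ((m:ℤ) + 1) - 1 = ((2 * m + 1 : ℕ) : ℤ) := by push_cast; ring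
      rw [hz] at hn hlow ⊢
      have ev := YY_step F (N := 2 * m + 1) rfl cnt_0 ha (pos _ _ (by intro i; fin_cases i <;> simp [v0]) h.le) hn (hlow (by omega))
      rw [hq v0 _ rfl, show bb v0 v0 = 8 by decide, show ht v0 = 2 by decide] at ev
      have := h0 m
      rw [cf_nat]
      push_cast at ev this
      have h' : (64 * (m:ℤ) + 60) * (YY (v0 + (m+1:ℤ) • dl) - PowerSeries.coeff (2*m+1) F) = 0 := by linarith
      rcases mul_eq_zero.1 h' with h' | h'
      · omega
      · linarith
  · have e := nrm v4 n rfl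
    rw [show bb v4 v4 = 4 by decide] at e
    obtain rfl : z = 2 * n + 1 := by linarith
    rcases lt_or_ge n 0 with h | h
    · rw [cf_neg F (by omega)]
      by_contra hne
      have := YY_ne hne 8
      simp [v4, dl] at this; omega
    · lift n to ℕ using h
      have hz : 2 * (n:ℤ) + 1 = ((2 * n + 1 : ℕ) : ℤ) := by push_cast; ring
      rw [hz] at hn hlow ⊢
      have ev := YY_step F (N := 2 * n + 1) rfl cnt_4 ha (pos _ _ (by intro i; fin_cases i <;> simp [v4]) (by omega)) hn (hlow (by omega))
      rw [hq v4 _ rfl, show bb v4 v4 = 4 by decide, show ht v4 = 16 by decide] at ev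
      have := h4 n
      rw [cf_nat]
      push_cast at ev this
      have h' : (64 * (n:ℤ) + 28) * (YY (v4 + (n:ℤ) • dl) - PowerSeries.coeff (2*n+1) F) = 0 := by linarith
      rcases mul_eq_zero.1 h' with h' | h'
      · omega
      · linarith
end KMW
namespace KQ
set_option linter.unusedVariables false
set_option linter.unusedSimpArgs false
open PowerSeries
open KMW hiding X
abbrev PS := PowerSeries ℤ
noncomputable def fp (n : ℕ) : PS := ∏ k ∈ Finset.range n, (1 - X ^ (k + 1))
noncomputable def fI : PS := mk fun n => coeff n (fp n)
noncomputable def fP : PS := mk fun n => (p n : ℤ)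
noncomputable abbrev ex : PS →ₐ[ℤ] PS := expand 2 two_ne_zero
lemma ex_dvd {n m : ℕ} {A : PS} (h : X ^ n ∣ A) (hm : m ≤ 2 * n) : X ^ m ∣ ex A := by
  have := map_dvd ex h
  rw [map_pow, expand_X, ← pow_mul] at this
  exact (pow_dvd_pow X hm).trans this
lemma ps_ext {A B : PS} (h : ∀ n, X ^ (n + 1) ∣ A - B) : A = B := by
  ext n
  have := X_pow_dvd_iff.1 (h n) n (by omega)
  rwa [map_sub, sub_eq_zero] at this
lemma md {n : ℕ} {A B C D : PS} (h : X ^ n ∣ A - B) (h' : X ^ n ∣ C - D) : X ^ n ∣ A * C - B * D := by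
  rw [show A * C - B * D = (A - B) * C + B * (C - D) by ring]
  exact dvd_add (h.mul_right _) (h'.mul_left _)
lemma fp_c {n m : ℕ} (h : n ≤ m) : X ^ (n + 1) ∣ fp m - fp n := by
  induction m, h using Nat.le_induction with
  | base => simp
  | succ m h ih =>
    rw [fp, Finset.prod_range_succ, ← fp, show fp m * (1 - X ^ (m + 1)) - fp n = (fp m - fp n) - X ^ (m + 1) * fp m by ring]
    exact dvd_sub ih ((pow_dvd_pow X (by omega)).mul_right _)
lemma fI_c {n m : ℕ} (h : n ≤ m) : X ^ (n + 1) ∣ fI - fp m := by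
  rw [X_pow_dvd_iff]
  intro k hk
  rw [fI, map_sub, coeff_mk, sub_eq_zero]
  have := X_pow_dvd_iff.1 (fp_c (show k ≤ m by omega)) k (by omega)
  rw [map_sub, sub_eq_zero] at this; exact this.symm
open scoped PowerSeries.WithPiTopology in
lemma fPI : fP * fI = 1 := by
  have h1 := Nat.Partition.hasProd_powerSeriesMk_card_restricted ℤ (fun _ => True)
  have h2 := (WithPiTopology.multipliable_one_sub_X_pow ℤ).hasProd
  have h3 := h1.mul h2
  have h4 : ∀ i : ℕ, (if True then ∑' j : ℕ, (X : PS) ^ ((i + 1) * j) else 1) * (1 - X ^ (i + 1)) = 1 := by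
    intro i
    rw [if_pos trivial]
    simp_rw [pow_mul]
    exact WithPiTopology.tsum_pow_mul_one_sub_of_constantCoeff_eq_zero (by simp)
  simp_rw [h4] at h3
  have h5 := h3.unique hasProd_one
  have h6 : (∏' n : ℕ, ((1:PS) - X ^ (n + 1))) = fI := by
    ext n
    have t := ((WithPiTopology.continuous_coeff ℤ n).tendsto _).comp h2.tendsto_prod_nat
    refine tendsto_nhds_unique t (tendsto_const_nhds.congr' ?_)
    filter_upwards [Filter.eventually_ge_atTop n] with m hm
    have := X_pow_dvd_iff.1 (fI_c hm) n (by omega)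
    rw [map_sub, sub_eq_zero] at this
    exact this
  rw [h6] at h5
  convert h5 using 2
  ext n
  simp [fP, p, Nat.Partition.restricted]
lemma fI0 : coeff 0 fI = 1 := by simp [fI, fp]
lemma fP0 : coeff 0 fP = 1 := by simp [fP, p]
lemma pC (n l : ℕ) : (pColored l n : ℤ) = coeff n (fP ^ l) := by
  have : fP ^ l = ∏ i : Fin l, fP := by simp
  rw [this, coeff_prod]
  simp only [pColored, fP, coeff_mk]
  push_cast
  refine Finset.sum_bij' (fun k _ => Finsupp.equivFunOnFinite.symm k) (fun l _ => l) ?_ ?_ ?_ ?_ ?_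
  · intro k hk; simpa [Finset.Nat.mem_antidiagonalTuple] using hk
  · intro k hk; simpa [Finset.Nat.mem_antidiagonalTuple] using hk
  · intro k hk; rfl
  · intro k hk; ext; rfl
  · intro k hk; rfl
end KQ
namespace KQ
set_option linter.unusedVariables false
set_option linter.unusedSimpArgs false
open PowerSeries
open KMW hiding X
noncomputable def vt (F : PS) : PS := X * derivative ℤ F
lemma vt_c (F : PS) (n : ℕ) : coeff n (vt F) = n * coeff n F := by
  rcases n with _ | n
  · simp [vt]
  · rw [vt, coeff_succ_X_mul, coeff_derivative, mul_comm]; push_cast; ring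
lemma vt_mul (F H : PS) : vt (F * H) = vt F * H + F * vt H := by
  simp only [vt, Derivation.leibniz, smul_eq_mul]; ring
lemma vt_sub (F H : PS) : vt (F - H) = vt F - vt H := by simp only [vt, map_sub, mul_sub]
lemma vt_pow (F : PS) (n : ℕ) : vt (F ^ n) = n * F ^ (n - 1) * vt F := by
  simp only [vt, Derivation.leibniz_pow, smul_eq_mul, nsmul_eq_mul]; ring
lemma vt_one : vt 1 = 0 := by simp [vt]
lemma vt_ex (F : PS) : vt (ex F) = 2 * ex (vt F) := by
  ext n
  rw [vt_c, show (2:PS) * ex (vt F) = (2:ℤ) • ex (vt F) by rw [zsmul_eq_mul]; norm_num, map_smul, coeff_expand, coeff_expand]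
  split_ifs with h
  · obtain ⟨m, rfl⟩ := h
    rw [vt_c]; simp; ring
  · simp
lemma vt_dvd {n : ℕ} {A : PS} (h : X ^ n ∣ A) : X ^ n ∣ vt A := by
  rw [X_pow_dvd_iff] at h ⊢
  intro m hm; rw [vt_c, h m hm, mul_zero]
noncomputable def Lk (k : ℕ) : PS := (k:PS) * (X ^ k * mk fun m => if k ∣ m then 1 else 0)
lemma Lk_mul (k : ℕ) (hk : k ≠ 0) : (1 - X ^ k) * Lk k = (k:PS) * X ^ k := by
  have h1 : (mk fun m => if k ∣ m then 1 else 0 : PS) = expand k hk (mk 1) := by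
    ext n; simp [coeff_expand]
  have h2 := congrArg (expand k hk) (mk_one_mul_one_sub_eq_one ℤ)
  rw [map_mul, map_sub, map_one, expand_X] at h2
  rw [Lk, h1]; linear_combination (k:PS) * X ^ k * h2
lemma vt_fp (n : ℕ) : vt (fp n) = - (∑ k ∈ Finset.range n, Lk (k + 1)) * fp n := by
  induction n with
  | zero => simp [fp, vt_one]
  | succ n ih =>
    have h := Lk_mul (n + 1) (by omega)
    have h2 : vt (X : PS) = X := by simp [vt]
    rw [fp, Finset.prod_range_succ, ← fp, vt_mul, ih, Finset.sum_range_succ, vt_sub, vt_one, vt_pow, h2]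
    simp only [Nat.add_sub_cancel]
    linear_combination fp n * h
lemma S1_c (n : ℕ) : X ^ (n + 1) ∣ S1 - ∑ k ∈ Finset.range n, Lk (k + 1) := by
  rw [X_pow_dvd_iff]
  intro m hm
  rw [map_sub, sub_eq_zero, map_sum, S1, DS, coeff_mk, Nat.sum_divisorsAntidiagonal (f := fun k _ => (k:ℤ))]
  have : ∀ k, coeff m (Lk (k + 1)) = if k + 1 ∣ m ∧ m ≠ 0 then ((k + 1 : ℕ) : ℤ) else 0 := by
    intro k
    rw [Lk, show ((k + 1 : ℕ) : PS) = C ((k+1 : ℕ) : ℤ) by simp, coeff_C_mul, coeff_X_pow_mul', coeff_mk]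
    by_cases h : k + 1 ≤ m
    · rw [if_pos h]
      have : k + 1 ∣ m - (k + 1) ↔ k + 1 ∣ m := by
        rw [Nat.dvd_sub_iff_left h dvd_rfl]
      have h0 : m ≠ 0 := by omega
      simp [this, h0]
    · rw [if_neg h, if_neg, mul_zero]
      rintro ⟨h1, h2⟩; exact h (Nat.le_of_dvd (by omega) h1)
  simp_rw [this]
  rw [Finset.sum_ite, Finset.sum_const_zero, add_zero]
  symm
  refine Finset.sum_bij (fun k _ => k + 1) ?_ ?_ ?_ ?_
  · intro k hk; simp at hk ⊢; exact hk.2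
  · intro k _ j _ h; simpa using h
  · intro k hk; simp at hk
    have := Nat.le_of_dvd (by omega) hk.1
    have := Nat.pos_of_dvd_of_pos hk.1 (by omega)
    exact ⟨k - 1, by simp; refine ⟨by omega, ?_, hk.2⟩; rw [Nat.sub_add_cancel this]; exact hk.1, by omega⟩
  · intros; rfl
lemma vt_fI : vt fI = - S1 * fI := by
  refine ps_ext fun n => ?_
  have h1 := vt_dvd (fI_c (le_refl n))
  rw [vt_sub, vt_fp] at h1
  have h2 := md (S1_c n) (fI_c (le_refl n))
  have := dvd_add h1 h2
  convert this using 1; ring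
lemma vt_fP : vt fP = S1 * fP := by
  have h := congrArg vt fPI
  rw [vt_mul, vt_fI, vt_one] at h
  linear_combination (fP) * h + (S1 * fP - vt fP) * fPI
lemma ex_DS (w : ℕ → ℕ → ℤ) : ex (DS w) = DS fun k b => if 2 ∣ b then w k (b / 2) else 0 := by
  ext n
  rw [coeff_expand]
  simp only [DS, coeff_mk]
  split_ifs with h
  · obtain ⟨m, rfl⟩ := h
    rw [Nat.mul_div_cancel_left _ two_pos]
    refine Finset.sum_bij_ne_zero (fun x _ _ => (x.1, 2 * x.2)) ?_ ?_ ?_ ?_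
    · rintro ⟨k, b⟩ h _; simp at h ⊢; rw [← h.1]; exact ⟨by ring, by rw [h.1]; exact h.2⟩
    · rintro ⟨k, b⟩ _ _ ⟨k', b'⟩ _ _ h; simpa using h
    · rintro ⟨k, b⟩ h hn
      simp only at hn
      split_ifs at hn with hb
      · obtain ⟨c, rfl⟩ := hb
        rw [Nat.mul_div_cancel_left _ two_pos] at hn
        refine ⟨(k, c), ?_, hn, rfl⟩
        simp at h ⊢; exact ⟨by linarith [h.1], h.2⟩
      · simp at hn
    · rintro ⟨k, b⟩ h _; simp
  · symm
    refine Finset.sum_eq_zero ?_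
    rintro ⟨k, b⟩ hx
    simp at hx
    rw [if_neg]
    rintro hb; exact h (hx.1 ▸ hb.mul_left k)
lemma Y2_eq : Y2 = ex S1 := by rw [S1, ex_DS, Y2]
lemma ev_DS : DS (fun k _ => if 2 ∣ k then (k:ℤ) else 0) = 2 * ex S1 := by
  rw [S1, DS_swap (fun k _ => (k:ℤ)), ex_DS, DS_swap, two_mul, ← DS_add]
  congr 1; funext k b
  split_ifs with h <;> omega
lemma EO : Ee + Oo = S1 := by
  rw [Ee, Oo, ← DS_add, S1]; congr 1; funext k b; split_ifs <;> simp
lemma Oo_eq : Oo + 4 * ex (ex S1) = 3 * ex S1 := by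
  have h := congrArg ex ev_DS
  rw [ex_DS, map_mul] at h
  have e2 : ex 2 = 2 := map_ofNat ex 2
  rw [e2] at h
  rw [show (4:PS) * ex (ex S1) = 2 * ex (ex S1) + 2 * ex (ex S1) by ring, ← h,
    show (3:PS) * ex S1 = Y2 + 2 * ex S1 by rw [Y2_eq]; ring, ← ev_DS, Oo, Y2, ← DS_add, ← DS_add, ← DS_add]
  congr 1; funext k b
  split_ifs <;> omega
end KQ
namespace KQ
set_option linter.unusedVariables false
set_option linter.unusedSimpArgs false
open PowerSeries
open KMW hiding X
variable {ι κ : Type*}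
def good (e : ι → ℤ) : Prop := (∀ t, 0 ≤ e t) ∧ ∀ n : ℤ, {t | e t ≤ n}.Finite
open Classical in
noncomputable def TH (w e : ι → ℤ) : PS := mk fun n => ∑ᶠ t, if e t = n then w t else 0
open Classical in
lemma TH_c (w e : ι → ℤ) (n : ℕ) : coeff n (TH w e) = ∑ᶠ t, if e t = n then w t else 0 := by rw [TH, coeff_mk]
lemma good_supp {e : ι → ℤ} (he : good e) {f : ι → ℤ} (n : ℤ) (h : ∀ t, f t ≠ 0 → e t ≤ n) : (Function.support f).Finite :=
  (he.2 n).subset fun t ht => h t ht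
open Classical in
lemma cf_TH {e : ι → ℤ} (he : good e) (w : ι → ℤ) (z : ℤ) : cf (TH w e) z = ∑ᶠ t, if e t = z then w t else 0 := by
  rw [cf]
  split_ifs with h
  · rw [TH, coeff_mk, Int.toNat_of_nonneg h]
  · symm; refine finsum_eq_zero_of_forall_eq_zero fun t => if_neg fun h' => h (by rw [← h']; exact he.1 t)
lemma TH_mul {e : ι → ℤ} (he : good e) (w : ι → ℤ) (F : PS) (n : ℕ) : coeff n (TH w e * F) = ∑ᶠ t, w t * cf F (n - e t) := by
  classical
  have hf := he.2 n
  rw [finsum_eq_sum_of_support_subset (s := hf.toFinset), coeff_mul]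
  · have : ∀ x ∈ Finset.HasAntidiagonal.antidiagonal n, coeff x.1 (TH w e) * coeff x.2 F = ∑ t ∈ hf.toFinset, if e t = x.1 then w t * coeff x.2 F else 0 := by
      rintro ⟨i, j⟩ hx
      rw [Finset.HasAntidiagonal.mem_antidiagonal] at hx
      simp only at hx ⊢
      rw [TH, coeff_mk, finsum_eq_sum_of_support_subset (s := hf.toFinset), Finset.sum_mul]
      · simp only [ite_mul, zero_mul]
      · intro t ht; simp at ht ⊢; omega
    rw [Finset.sum_congr rfl this, Finset.sum_comm]
    refine Finset.sum_congr rfl fun t ht => ?_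
    simp at ht
    have h0 := he.1 t
    rw [Finset.sum_eq_single ((e t).toNat, n - (e t).toNat)]
    · rw [if_pos (by simp [h0]), show (n:ℤ) - e t = ((n - (e t).toNat : ℕ) : ℤ) by omega, cf_nat]
    · rintro ⟨i, j⟩ hx hne
      rw [if_neg]
      rintro h; simp at hx h
      apply hne; ext <;> simp <;> omega
    · intro h; simp at h; omega
  · intro t ht
    simp at ht ⊢
    have := cf_ne ht.2; omega
lemma TH_mul_cf {e : ι → ℤ} (he : good e) (w : ι → ℤ) (F : PS) (n : ℤ) : cf (TH w e * F) n = ∑ᶠ t, w t * cf F (n - e t) := by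
  rcases lt_or_ge n 0 with h | h
  · rw [cf_neg _ h]; symm
    refine finsum_eq_zero_of_forall_eq_zero fun t => ?_
    rw [cf_neg _ (by have := he.1 t; omega), mul_zero]
  · lift n to ℕ using h
    rw [cf_nat, TH_mul he]
lemma good_prod {e : ι → ℤ} {e' : κ → ℤ} (he : good e) (he' : good e') : good fun t : ι × κ => e t.1 + e' t.2 := by
  refine ⟨fun t => add_nonneg (he.1 _) (he'.1 _), fun n => ((he.2 n).prod (he'.2 n)).subset ?_⟩
  rintro ⟨a, b⟩ h; simp at h ⊢
  have := he.1 a; have := he'.1 b; omega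
lemma TH_TH {e : ι → ℤ} {e' : κ → ℤ} (he : good e) (he' : good e') (w : ι → ℤ) (w' : κ → ℤ) :
    TH w e * TH w' e' = TH (fun t : ι × κ => w t.1 * w' t.2) (fun t => e t.1 + e' t.2) := by
  classical
  ext n
  rw [TH_mul he, TH_c, finsum_curry]
  · refine finsum_congr fun t => ?_
    rw [cf_TH he', mul_finsum']
    · refine finsum_congr fun s => ?_
      rw [mul_ite, mul_zero]; congr 1; simp only [eq_iff_iff]; omega
    · exact good_supp he' (n - e t) (by intro s hs; simp at hs; omega)
  · exact good_supp (good_prod he he') n (by intro s hs; simp at hs ⊢; omega)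
lemma TH_equiv (σ : ι ≃ κ) (w e : κ → ℤ) : TH (fun t => w (σ t)) (fun t => e (σ t)) = TH w e := by
  classical
  ext n; rw [TH, TH, coeff_mk, coeff_mk]
  exact finsum_comp_equiv σ (f := fun t => if e t = n then w t else 0)
lemma TH_split {e : ι → ℤ} (he : good e) (w : ι → ℤ) (f g : κ → ι) (hf : Function.Injective f) (hg : Function.Injective g)
    (hfg : ∀ a b, f a ≠ g b) (hu : ∀ t, (∃ a, f a = t) ∨ ∃ a, g a = t) :
    TH w e = TH (fun t => w (f t)) (fun t => e (f t)) + TH (fun t => w (g t)) (fun t => e (g t)) := by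
  classical
  ext n
  rw [map_add, TH, TH, TH, coeff_mk, coeff_mk, coeff_mk]
  rw [← finsum_mem_range (f := fun t => if e t = n then w t else 0) hf, ← finsum_mem_range (f := fun t => if e t = n then w t else 0) hg,
    ← finsum_mem_union' (by rw [Set.disjoint_left]; rintro _ ⟨a, rfl⟩ ⟨b, hb⟩; exact hfg a b hb.symm), ← finsum_mem_univ]
  · congr 1; funext t; rw [show (t ∈ Set.univ) = (t ∈ Set.range f ∪ Set.range g) by simpa using hu t]
  all_goals exact (good_supp he n (by intro s hs; simp at hs; omega)).subset Set.inter_subset_right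
lemma ex_TH {e : ι → ℤ} (he : good e) (w : ι → ℤ) : ex (TH w e) = TH w fun t => 2 * e t := by
  classical
  ext n
  rw [coeff_expand, TH, TH, coeff_mk, coeff_mk]
  split_ifs with h
  · obtain ⟨m, rfl⟩ := h
    refine finsum_congr fun t => ?_
    congr 1; simp only [eq_iff_iff]; push_cast; omega
  · symm; exact finsum_eq_zero_of_forall_eq_zero fun t => if_neg (by omega)
lemma X_TH {e : ι → ℤ} (he : good e) (w : ι → ℤ) : X * TH w e = TH w fun t => e t + 1 := by
  classical
  ext n
  rcases n with _ | n
  · rw [coeff_zero_X_mul, TH_c]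
    symm; exact finsum_eq_zero_of_forall_eq_zero fun t => if_neg (by have := he.1 t; push_cast; omega)
  · rw [coeff_succ_X_mul, TH, TH, coeff_mk, coeff_mk]
    refine finsum_congr fun t => ?_
    congr 1; simp only [eq_iff_iff]; push_cast; omega
lemma TH_neg (w e : ι → ℤ) : TH (fun t => - w t) e = - TH w e := by
  classical
  ext n
  rw [map_neg, TH, TH, coeff_mk, coeff_mk, ← finsum_neg_distrib]
  refine finsum_congr fun t => ?_
  split_ifs <;> simp
lemma good_pi {e : ℤ → ℤ} (he : good e) (k : ℕ) : good fun t : Fin k → ℤ => ∑ i, e (t i) := by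
  refine ⟨fun t => Finset.sum_nonneg fun i _ => he.1 _, fun n => (Set.Finite.pi' fun i : Fin k => he.2 n).subset fun t ht i => ?_⟩
  exact (Finset.single_le_sum (fun j _ => he.1 (t j)) (Finset.mem_univ i)).trans ht
lemma TH_pow {e : ℤ → ℤ} (he : good e) (w : ℤ → ℤ) (k : ℕ) :
    TH w e ^ k = TH (fun t : Fin k → ℤ => ∏ i, w (t i)) (fun t => ∑ i, e (t i)) := by
  classical
  induction k with
  | zero =>
    ext n
    rw [pow_zero, TH, coeff_mk, coeff_one, finsum_eq_single _ (fun i => i.elim0)]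
    · simp [eq_comm]
    · intro t ht; exact absurd (Subsingleton.elim _ _) ht
  | succ k ih =>
    rw [pow_succ', ih, TH_TH he (good_pi he k), ← TH_equiv (Fin.consEquiv fun _ => ℤ)]
    simp [Fin.consEquiv, Fin.prod_univ_succ, Fin.sum_univ_succ]
lemma good_of {e : ℤ → ℤ} (h : ∀ t, t ≤ e t + 1 ∧ - t ≤ e t + 1 ∧ 0 ≤ e t) : good e := by
  refine ⟨fun t => (h t).2.2, fun n => (Set.finite_Icc (-(n + 1)) (n + 1)).subset fun t ht => ?_⟩
  have := h t
  simp at ht ⊢; omega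
end KQ
namespace KQ
set_option linter.unusedVariables false
set_option linter.unusedSimpArgs false
open PowerSeries
open KMW hiding X
def sg (t : ℤ) : ℤ := if 2 ∣ t then 1 else -1
def es (t : ℤ) : ℤ := t * t
def ep (t : ℤ) : ℤ := t * t + t
def eq2 (t : ℤ) : ℤ := 2 * (t * t) + t
lemma gs : good es := good_of fun t => by simp only [es]; refine ⟨?_, ?_, ?_⟩ <;> nlinarith [sq_nonneg (t-1), sq_nonneg (t+1), sq_nonneg t]
lemma tt (t : ℤ) : 0 ≤ t * t + t := by
  rcases lt_or_ge t 0 with h | h <;> nlinarith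
lemma gp : good ep := good_of fun t => by simp only [ep]; have := tt t; refine ⟨?_, ?_, ?_⟩ <;> nlinarith [sq_nonneg (t-1), sq_nonneg (t+1), sq_nonneg t]
lemma gq : good eq2 := good_of fun t => by simp only [eq2]; have := tt t; refine ⟨?_, ?_, ?_⟩ <;> nlinarith [sq_nonneg (t-1), sq_nonneg (t+1), sq_nonneg t]
noncomputable def t3 : PS := TH (fun _ => 1) es
noncomputable def t4 : PS := TH sg es
noncomputable def tp : PS := TH (fun _ => 1) ep
noncomputable def ps : PS := TH (fun _ => 1) eq2
lemma tp_eq : tp = 2 * ex ps := by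
  rw [tp, TH_split gp _ (fun t : ℤ => 2 * t) (fun t : ℤ => - (2 * t) - 1), two_mul, ps, ex_TH gq]
  · congr 2 <;> funext t <;> simp only [ep, eq2] <;> ring
  · intro a b h; simpa using h
  · intro a b h; simpa using h
  · intro a b h; omega
  · intro t; rcases Int.even_or_odd' t with ⟨k, h | h⟩
    · exact Or.inl ⟨k, h.symm⟩
    · exact Or.inr ⟨-k-1, by omega⟩
lemma split2 {e : ℤ × ℤ → ℤ} (he : good e) (w : ℤ × ℤ → ℤ) :
    TH w e = TH (fun t : ℤ × ℤ => w (t.1 + t.2, t.1 - t.2)) (fun t => e (t.1 + t.2, t.1 - t.2))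
      + TH (fun t : ℤ × ℤ => w (t.1 + t.2 + 1, t.1 - t.2)) (fun t => e (t.1 + t.2 + 1, t.1 - t.2)) := by
  refine TH_split he w (fun t : ℤ × ℤ => (t.1 + t.2, t.1 - t.2)) (fun t : ℤ × ℤ => (t.1 + t.2 + 1, t.1 - t.2)) ?_ ?_ ?_ ?_
  · rintro ⟨a, b⟩ ⟨c, d⟩ h; simp at h ⊢; omega
  · rintro ⟨a, b⟩ ⟨c, d⟩ h; simp at h ⊢; omega
  · rintro ⟨a, b⟩ ⟨c, d⟩; simp; omega
  · rintro ⟨a, b⟩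
    rcases Int.even_or_odd' (a + b) with ⟨k, h | h⟩
    · exact Or.inl ⟨(k, a - k), by ext <;> simp; omega⟩
    · exact Or.inr ⟨(k, a - k - 1), by ext <;> simp <;> omega⟩
lemma sg_mul (a b : ℤ) : sg a * sg b = sg (a + b) := by
  simp only [sg]; split_ifs <;> omega
lemma sg_even {a : ℤ} (h : 2 ∣ a) : sg a = 1 := if_pos h
lemma sg_odd {a : ℤ} (h : ¬ 2 ∣ a) : sg a = -1 := if_neg h
lemma I2 : t3 ^ 2 = ex t3 ^ 2 + X * ex tp ^ 2 := by
  rw [sq, sq, sq, ← map_mul, ← map_mul, t3, tp, TH_TH gs gs, TH_TH gp gp, ex_TH (good_prod gs gs), ex_TH (good_prod gp gp), X_TH, split2 (good_prod gs gs)]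
  · congr 2 <;> funext t <;> simp only [es, ep] <;> ring
  · exact ⟨fun t => mul_nonneg two_pos.le ((good_prod gp gp).1 t), fun n => ((good_prod gp gp).2 n).subset fun t ht => by
      have := (good_prod gp gp).1 t; simp at ht ⊢ this; omega⟩
lemma I3 : t4 ^ 2 = ex t3 ^ 2 - X * ex tp ^ 2 := by
  rw [sq, sq, sq, ← map_mul, ← map_mul, t3, t4, tp, TH_TH gs gs, TH_TH gp gp, TH_TH gs gs, ex_TH (good_prod gs gs), ex_TH (good_prod gp gp), X_TH, split2 (good_prod gs gs),
    sub_eq_add_neg, ← TH_neg]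
  · congr 2 <;> funext t <;> simp only [es, ep, sg_mul]
    · rw [sg_even (by omega)]; rfl
    · ring
    · rw [sg_odd (by omega)]; rfl
    · ring
  · exact ⟨fun t => mul_nonneg two_pos.le ((good_prod gp gp).1 t), fun n => ((good_prod gp gp).2 n).subset fun t ht => by
      have := (good_prod gp gp).1 t; simp at ht ⊢ this; omega⟩
lemma I4 : tp ^ 2 = 2 * (ex t3 * ex tp) := by
  rw [sq, ← map_mul, two_mul, t3, tp, TH_TH gp gp, TH_TH gs gp, ex_TH (good_prod gs gp), split2 (good_prod gp gp)]
  congr 1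
  · rw [← TH_equiv (Equiv.prodComm ℤ ℤ)]
    congr 1; funext t; simp [es, ep]; ring
  · rw [← TH_equiv (Equiv.prodCongr (Equiv.subRight 1) (Equiv.refl ℤ))]
    congr 1; funext t; simp [es, ep]; ring
lemma nz (n : ℕ) [n.AtLeastTwo] : (OfNat.ofNat n : PS) ≠ 0 := fun h => by
  have := congrArg constantCoeff h; rw [map_ofNat, map_zero] at this; exact OfNat.ofNat_ne_zero n this
lemma I5 : t3 * t4 = ex t4 ^ 2 := by
  rw [sq, ← map_mul, t3, t4, TH_TH gs gs, TH_TH gs gs, ex_TH (good_prod gs gs), split2 (good_prod gs gs)]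
  have h : ∀ W : PS, W = - W → W = 0 := fun W hW => by
    have : (2:PS) * W = 0 := by linear_combination hW
    exact (mul_eq_zero.1 this).resolve_left (nz 2)
  rw [h (TH _ (fun t : ℤ × ℤ => es (t.1 + t.2 + 1, t.1 - t.2).1 + es (t.1 + t.2 + 1, t.1 - t.2).2)), add_zero]
  · congr 1 <;> funext t <;> simp only [es, sg_mul]
    · rw [one_mul]; simp only [sg]; split_ifs <;> omega
    · ring
  · rw [← TH_neg]
    rw [← TH_equiv (Equiv.prodCongr (Equiv.refl ℤ) (Equiv.subLeft (-1)))]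
    congr 1 <;> funext t <;> simp [es]
    · simp only [sg]; split_ifs <;> omega
    · ring
lemma ex_inj {A B : PS} (h : ex A = ex B) : A = B := by
  ext n
  have := congrArg (coeff (2 * n)) h
  rwa [coeff_expand_mul, coeff_expand_mul] at this
lemma ex2 : ex 2 = 2 := map_ofNat ex 2
lemma I4' : ps ^ 2 = t3 * ex ps := by
  refine ex_inj ?_
  have h := I4
  rw [tp_eq, map_mul, ex2] at h
  rw [map_pow, map_mul]
  have h2 : (4:PS) * (ex ps ^ 2 - ex t3 * ex (ex ps)) = 0 := by linear_combination h
  exact sub_eq_zero.1 ((mul_eq_zero.1 h2).resolve_left (nz 4))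
lemma I2' : t3 ^ 2 = ex t3 ^ 2 + 4 * X * ex (ex ps) ^ 2 := by
  rw [I2, tp_eq, map_mul, ex2]; ring
lemma I3' : t4 ^ 2 = ex t3 ^ 2 - 4 * X * ex (ex ps) ^ 2 := by
  rw [I3, tp_eq, map_mul, ex2]; ring
lemma I4e : ex ps ^ 2 = ex t3 * ex (ex ps) := by rw [← map_pow, I4', map_mul]
lemma JJ : t3 ^ 4 - t4 ^ 4 = 16 * X * ex ps ^ 4 := by
  rw [show t3 ^ 4 - t4 ^ 4 = (t3 ^ 2) ^ 2 - (t4 ^ 2) ^ 2 by ring, I2', I3', show ex ps ^ 4 = (ex ps ^ 2) ^ 2 by ring, I4e]; ring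
lemma KK : t3 ^ 8 - t4 ^ 8 + X ^ 2 * tp ^ 8 = 32 * X * ps ^ 8 := by
  rw [tp_eq, show ps ^ 8 = (ps ^ 2) ^ 4 by ring, I4']
  linear_combination (t3 ^ 4 + t4 ^ 4 - 16 * X * ex ps ^ 4) * JJ
/-- dissection of the eighth power -/
lemma LL : ∃ E, ps ^ 8 = ex E + 8 * X * ex (ps ^ 8) := by
  refine ⟨(t3 ^ 4 + 16 * X * ex ps ^ 4) * ps ^ 4, ?_⟩
  have h1 : ps ^ 8 = (ex t3 ^ 2 + 4 * X * ex (ex ps) ^ 2) ^ 2 * ex ps ^ 4 := by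
    rw [← I2', show ps ^ 8 = (ps ^ 2) ^ 4 by ring, I4']; ring
  rw [map_pow, h1]
  have e16 : ex 16 = 16 := map_ofNat ex 16
  simp only [map_mul, map_add, map_pow, e16, expand_X]
  have h4 : ex ps ^ 4 = ex t3 ^ 2 * ex (ex ps) ^ 2 := by
    rw [show ex ps ^ 4 = (ex ps ^ 2) ^ 2 by ring, I4e]; ring
  have h8 : ex ps ^ 8 = ex ps ^ 4 * (ex t3 ^ 2 * ex (ex ps) ^ 2) := by rw [← h4]; ring
  rw [h8]; ring
end KQ
namespace KQ
set_option linter.unusedVariables false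
set_option linter.unusedSimpArgs false
open PowerSeries
open KMW hiding X
noncomputable def evp (s n : ℕ) : PS := ∏ k ∈ Finset.Ico s n, (1 - X ^ (2 * (k + 1)))
noncomputable def odp (n : ℕ) : PS := ∏ k ∈ Finset.range n, (1 - X ^ (2 * k + 1))
noncomputable def Sn (n : ℕ) : PS := ∑ k ∈ Finset.range n, (X ^ (2 * (k * k) + k) + X ^ ((k + 1) * (2 * k + 1)))
lemma odp_s (n : ℕ) : odp (n + 1) = odp n * (1 - X ^ (2 * n + 1)) := by rw [odp, Finset.prod_range_succ, ← odp]
lemma evp_s {s n : ℕ} (h : s ≤ n) : evp s (n + 1) = evp s n * (1 - X ^ (2 * (n + 1))) := by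
  rw [evp, Finset.prod_Ico_succ_top h, ← evp]
lemma evp_b {s n : ℕ} (h : s < n) : evp s n = (1 - X ^ (2 * (s + 1))) * evp (s + 1) n := by
  rw [evp, Finset.prod_eq_prod_Ico_succ_bot h, ← evp]
lemma shank_aux (n m : ℕ) (h : m ≤ n) :
    ∑ s ∈ Finset.range m, evp s n * odp s * (X ^ (s * (2 * n + 3)) * (1 - X ^ (2 * (n + 1))) - (1 - X ^ (2 * n + 1)) * X ^ (s * (2 * n + 1)))
      = evp m n * (1 - X ^ (2 * m)) * odp m * X ^ (m * (2 * n + 1)) := by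
  induction m with
  | zero => simp
  | succ m ih =>
    rw [Finset.sum_range_succ, ih (by omega), evp_b (show m < n by omega), odp_s]
    ring
lemma shank (n : ℕ) : Sn n * odp n = ∑ s ∈ Finset.range n, evp s n * odp s * X ^ (s * (2 * n + 1)) := by
  induction n with
  | zero => simp [Sn]
  | succ n ih =>
    have h := shank_aux n n le_rfl
    simp only [mul_sub, Finset.sum_sub_distrib] at h
    rw [Finset.sum_range_succ, Finset.sum_congr rfl (g := fun s => evp s n * odp s * (X ^ (s * (2 * n + 3)) * 1) - evp s n * odp s * (X ^ (s * (2 * n + 3)) * X ^ (2 * (n + 1))))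
      (fun s hs => by rw [evp_s (by simp at hs; omega)]; ring), Finset.sum_sub_distrib, evp_s le_rfl, Sn, Finset.sum_range_succ, ← Sn, odp_s]
    have h2 : ∑ s ∈ Finset.range n, evp s n * odp s * ((1 - X ^ (2 * n + 1)) * X ^ (s * (2 * n + 1))) = (1 - X ^ (2 * n + 1)) * (Sn n * odp n) := by
      rw [ih, Finset.mul_sum]; exact Finset.sum_congr rfl fun s _ => by ring
    rw [h2] at h
    have e1 : evp n n = 1 := by simp [evp]
    rw [e1] at h ⊢
    linear_combination (-1:PS) * h
lemma ps_c (n : ℕ) : X ^ (n + 1) ∣ ps - Sn (n + 1) := by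
  classical
  rw [X_pow_dvd_iff]
  intro m hm
  rw [map_sub, sub_eq_zero, ps, TH_split gq _ (fun k : ℕ => (k:ℤ)) (fun k : ℕ => -((k:ℤ) + 1)), Sn, map_add, Finset.sum_add_distrib, map_add, map_sum, map_sum, TH_c, TH_c]
  · congr 1
    · rw [finsum_eq_sum_of_support_subset (s := Finset.range (n + 1))]
      · refine Finset.sum_congr rfl fun k _ => ?_
        rw [coeff_X_pow]; congr 1; simp only [eq2, eq_iff_iff]; rw [eq_comm]; norm_cast
      · intro k hk
        have hk' : eq2 k = m := by by_contra h; exact hk (if_neg h)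
        simp [eq2] at hk' ⊢; zify; nlinarith
    · rw [finsum_eq_sum_of_support_subset (s := Finset.range (n + 1))]
      · refine Finset.sum_congr rfl fun k _ => ?_
        rw [coeff_X_pow]; congr 1; simp only [eq2, eq_iff_iff]; rw [eq_comm, ← @Nat.cast_inj ℤ]; push_cast; ring_nf
      · intro k hk; simp [eq2] at hk ⊢; nlinarith
  · intro a b h; simpa using h
  · intro a b h; simpa using h
  · intro a b h; omega
  · intro t; rcases lt_or_ge t 0 with h | h
    · exact Or.inr ⟨(-t-1).toNat, by omega⟩
    · exact Or.inl ⟨t.toNat, by omega⟩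
lemma fp_2 (n : ℕ) : fp (2 * n) = odp n * evp 0 n := by
  induction n with
  | zero => simp [fp, odp, evp]
  | succ n ih =>
    rw [show 2 * (n + 1) = 2 * n + 1 + 1 by ring, fp, Finset.prod_range_succ, Finset.prod_range_succ, ← fp, ih, odp_s, evp_s (by omega)]
    ring
lemma ex_fp (n : ℕ) : ex (fp n) = evp 0 n := by
  rw [fp, evp, map_prod, Finset.range_eq_Ico]
  refine Finset.prod_congr rfl fun k _ => ?_
  rw [map_sub, map_pow, expand_X, map_one, ← pow_mul]
lemma GG : ps * fI = ex fI ^ 2 := by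
  refine ps_ext fun n => ?_
  have h1 := md (ps_c n) (fI_c (show n ≤ 2 * (n + 1) by omega))
  have h2 : X ^ (n + 1) ∣ ex fI - evp 0 (n + 1) := by
    rw [← ex_fp, ← map_sub]; exact ex_dvd (fI_c (le_refl (n + 1))) (by omega)
  have h3 : X ^ (n + 1) ∣ Sn (n + 1) * fp (2 * (n + 1)) - evp 0 (n + 1) * evp 0 (n + 1) := by
    rw [fp_2, ← mul_assoc, shank, ← sub_mul, Finset.sum_range_succ']
    refine Dvd.dvd.mul_right ?_ _
    simp only [zero_mul, pow_zero, mul_one, odp, Finset.range_zero, Finset.prod_empty, add_sub_cancel_right]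
    refine Finset.dvd_sum fun s _ => Dvd.dvd.mul_left (pow_dvd_pow X ?_) _
    nlinarith
  rw [sq]
  have := dvd_sub (dvd_add h1 h3) (md h2 h2)
  convert this using 1; ring
/-- reciprocal -/
lemma fIP : fI * fP = 1 := by rw [mul_comm, fPI]
lemma exIP : ex fI * ex fP = 1 := by rw [← map_mul, fIP, map_one]
lemma exIP' : ex (ex fI) * ex (ex fP) = 1 := by rw [← map_mul, exIP, map_one]
lemma ps_eq : ps = ex fI ^ 2 * fP := by linear_combination fP * GG - ps * fIP
lemma t3_eq : t3 * ex (ex fI) ^ 2 = ex fI ^ 5 * fP ^ 2 := by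
  have h := I4'
  rw [ps_eq, map_mul, map_pow] at h
  linear_combination (- ex fI) * h + (-t3 * ex (ex fI) ^ 2) * exIP
lemma w_one {w : PS} (h : w = ex w ^ 2) (h0 : coeff 0 w = 1) : w = 1 := by
  refine ps_ext fun n => ?_
  induction n with
  | zero => rw [X_pow_dvd_iff]; intro m hm; obtain rfl : m = 0 := by omega
            simp at h0 ⊢; rw [h0]; rfl
  | succ n ih =>
    have h1 : X ^ (n + 1 + 1) ∣ ex w - 1 := by
      have := ex_dvd ih (show n + 1 + 1 ≤ 2 * (n + 1) by omega)
      rwa [map_sub, map_one] at this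
    rw [h]
    rw [show ex w ^ 2 - 1 = (ex w - 1) * (ex w + 1) by ring]
    exact h1.mul_right _
lemma t4_0 : coeff 0 t4 = 1 := by
  classical
  rw [t4, TH_c, finsum_eq_single _ 0]
  · simp [es, sg]
  · intro t ht; rw [if_neg]; simpa [es] using ht
lemma t4_eq : t4 = ex fP * fI ^ 2 := by
  have hw : t4 * ex fI * fP ^ 2 = 1 := by
    refine w_one ?_ ?_
    · have h := t3_eq
      have h5 := I5
      rw [map_mul, map_mul, map_pow]
      have e1 : t4 * t3 * (ex (ex fI)) ^ 2 * ex fP ^ 4 = t4 * ex fI * fP ^ 2 := by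
        calc _ = t4 * ex fP ^ 4 * (t3 * ex (ex fI) ^ 2) := by ring
          _ = t4 * ex fI * fP ^ 2 * (ex fI * ex fP) ^ 4 := by rw [h]; ring
          _ = _ := by rw [exIP]; ring
      rw [← e1]; linear_combination (ex (ex fI) ^ 2 * ex fP ^ 4) * h5
    · simp only [coeff_zero_eq_constantCoeff, map_mul, map_pow, constantCoeff_expand]
      have a := t4_0; have b := fI0; have c := fP0
      simp only [coeff_zero_eq_constantCoeff] at a b c
      rw [a, b, c]; norm_num
  calc t4 = t4 * (ex fI * ex fP) * (fI * fP) ^ 2 := by rw [exIP, fIP]; ring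
    _ = (t4 * ex fI * fP ^ 2) * (ex fP * fI ^ 2) := by ring
    _ = _ := by rw [hw, one_mul]
lemma ps8 : ps ^ 8 * ex fP ^ 16 = fP ^ 8 := by
  rw [ps_eq, show (ex fI ^ 2 * fP) ^ 8 * ex fP ^ 16 = (ex fI * ex fP) ^ 16 * fP ^ 8 by ring, exIP, one_pow, one_mul]
lemma t48 : t4 ^ 8 * fP ^ 16 = ex fP ^ 8 := by
  rw [t4_eq, show (ex fP * fI ^ 2) ^ 8 * fP ^ 16 = ex fP ^ 8 * (fI * fP) ^ 16 by ring, fIP, one_pow, mul_one]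
end KQ
namespace KQ
set_option linter.unusedVariables false
set_option linter.unusedSimpArgs false
open PowerSeries
open KMW hiding X
noncomputable def OO : PS := ps ^ 8 * fP ^ 16
lemma ex8 : ex 8 = 8 := map_ofNat ex 8
lemma dis : ∃ E, fP ^ 8 = ex E + 8 * X * ex OO := by
  obtain ⟨E, hE⟩ := LL
  refine ⟨E * fP ^ 16, ?_⟩
  rw [← ps8, hE, OO]; simp only [map_mul, map_pow, map_add]; ring
lemma vt_add (F H : PS) : vt (F + H) = vt F + vt H := by simp only [vt, map_add, mul_add]
lemma vt_OO : vt OO = (24 * S1 - 32 * ex S1) * OO := by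
  have h : OO = ex fI ^ 16 * fP ^ 24 := by rw [OO, ps_eq]; ring
  rw [h, vt_mul, vt_pow, vt_pow, vt_ex, vt_fI, vt_fP, map_mul, map_neg]; push_cast; ring
noncomputable def U0 : PS := fI * ex fP
noncomputable def ff : PS := fP ^ 8 * ex U0
lemma vt_ff : vt ff = (8 * S1 - 2 * ex S1 + 4 * ex (ex S1)) * ff := by
  rw [ff, vt_mul, vt_pow, vt_fP, vt_ex, U0, vt_mul, vt_fI, vt_ex, vt_fP]
  simp only [map_mul, map_add, map_neg, ex2]; push_cast; ring
lemma odd_ff : ∃ V, (1 - 8 * S1 + 48 * ex S1 - 64 * ex (ex S1)) * ff = ex V := by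
  obtain ⟨E, hE⟩ := dis
  have h : vt (fP ^ 8) = 8 * S1 * fP ^ 8 := by rw [vt_pow, vt_fP]; push_cast; ring
  have hX : vt (8 * X : PS) = 8 * X := by
    rw [vt_mul, show vt (8:PS) = 0 by rw [vt, show (8:PS) = ((8:ℕ):PS) from rfl, Derivation.map_natCast, mul_zero], show vt (X:PS) = X by simp [vt]]; ring
  have e48 : ex 48 = 48 := map_ofNat ex 48
  have e64 : ex 64 = 64 := map_ofNat ex 64
  have h2 : vt (fP ^ 8) = 2 * ex (vt E) + 8 * X * ex OO + 8 * X * (2 * ((24 * ex S1 - 32 * ex (ex S1)) * ex OO)) := by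
    rw [hE, vt_add, vt_mul, vt_ex, vt_ex, vt_OO, hX]
    have e24 : ex 24 = 24 := map_ofNat ex 24
    have e32 : ex 32 = 32 := map_ofNat ex 32
    simp only [map_mul, map_sub, e24, e32]; ring
  refine ⟨((1 + 48 * S1 - 64 * ex S1) * E - 2 * vt E) * U0, ?_⟩
  simp only [map_mul, map_sub, map_add, map_one, e48, e64, ex2]
  rw [ff]
  linear_combination (1 + 48 * ex S1 - 64 * ex (ex S1)) * ex U0 * hE + ex U0 * h - ex U0 * h2
lemma Oo' : Oo = 3 * ex S1 - 4 * ex (ex S1) := by linear_combination Oo_eq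
lemma Ee' : Ee = S1 - 3 * ex S1 + 4 * ex (ex S1) := by linear_combination EO - Oo_eq
lemma z_of {A : PS} {m : ℕ} (h : A = 0) : coeff m A = 0 := by rw [h, map_zero]
lemma odd_ff' (n : ℕ) : coeff (2 * n + 1) ((1 - 8 * S1 + 48 * ex S1 - 64 * ex (ex S1)) * ff) = 0 := by
  obtain ⟨V, hV⟩ := odd_ff
  rw [hV, coeff_expand_of_not_dvd _ _ _ (by omega)]
noncomputable def f2 : PS := (2:ℤ) • ff
lemma cs (k : ℤ) (A : PS) (m : ℕ) : coeff m (k • A) = k * coeff m A := by rw [map_smul, smul_eq_mul]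
lemma f2_c (m : ℕ) : coeff m f2 = 2 * coeff m ff := cs 2 ff m
lemma f2_r (n : ℕ) : 32*((2*n:ℕ):ℤ)*coeff (2*n) f2 = 32*coeff (2*n) (Y2*f2)+256*coeff (2*n) (Ee*f2)+224*coeff (2*n) (Oo*f2) := by
  have h : (64:ℤ) • vt ff - (32:ℤ) • (Y2 * f2) - (256:ℤ) • (Ee * f2) - (224:ℤ) • (Oo * f2) = 0 := by
    rw [vt_ff, Y2_eq, Ee', Oo', f2]; simp only [zsmul_eq_mul]; push_cast; ring
  have := z_of (m := 2 * n) h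
  simp only [map_sub, cs, vt_c] at this
  rw [f2_c]; linarith
lemma f2_0 (n : ℕ) : (32*((2*n+1:ℕ):ℤ)+28)*coeff (2*n+1) f2 = 32*coeff (2*n+1) (Y2*f2)+480*coeff (2*n+1) (Ee*f2) := by
  have h : (64:ℤ) • vt ff + (56:ℤ) • ff - (32:ℤ) • (Y2 * f2) - (480:ℤ) • (Ee * f2) - (56:ℤ) • ((1 - 8 * S1 + 48 * ex S1 - 64 * ex (ex S1)) * ff) = 0 := by
    rw [vt_ff, Y2_eq, Ee', f2]; simp only [zsmul_eq_mul]; push_cast; ring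
  have := z_of (m := 2 * n + 1) h
  simp only [map_sub, map_add, cs, vt_c, odd_ff'] at this
  rw [f2_c]; linarith
lemma f2_4 (n : ℕ) : (32*((2*n+1:ℕ):ℤ)-4)*coeff (2*n+1) f2 = 32*coeff (2*n+1) (Y2*f2)+224*coeff (2*n+1) (Ee*f2)+256*coeff (2*n+1) (Oo*f2) := by
  have h : (64:ℤ) • vt ff - (8:ℤ) • ff - (32:ℤ) • (Y2 * f2) - (224:ℤ) • (Ee * f2) - (256:ℤ) • (Oo * f2) + (8:ℤ) • ((1 - 8 * S1 + 48 * ex S1 - 64 * ex (ex S1)) * ff) = 0 := by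
    rw [vt_ff, Y2_eq, Ee', Oo', f2]; simp only [zsmul_eq_mul]; push_cast; ring
  have := z_of (m := 2 * n + 1) h
  simp only [map_sub, map_add, cs, vt_c, odd_ff'] at this
  rw [f2_c]; linarith
lemma f2_z : coeff 0 f2 = 2 := by
  have b := fI0; have c := fP0
  simp only [coeff_zero_eq_constantCoeff] at b c
  rw [f2, map_smul, ff, U0]
  simp only [coeff_zero_eq_constantCoeff, map_mul, map_pow, constantCoeff_expand, b, c]; norm_num
lemma YY_f2 (β : Q) (z : ℤ) (h0 : β 0 = 2) (hb : bb β β = 2 * (3 - z)) : YY β = cf f2 z :=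
  YY_val f2 f2_z f2_r f2_0 f2_4 β z h0 hb
lemma m1_fP (μ : Q) (z : ℤ) (h0 : μ 0 = 1) (hb : bb μ μ = 2 * (1 - z)) : m1 μ = cf (fP ^ 8) z := by
  refine m1_val (fP ^ 8) ?_ ?_ μ z h0 hb
  · have c := fP0
    simp only [coeff_zero_eq_constantCoeff] at c ⊢
    rw [map_pow, c, one_pow]
  · intro n
    rw [← vt_c, vt_pow, vt_fP]
    rw [← smul_eq_mul (8:ℤ), ← map_smul, zsmul_eq_mul]; congr 1; push_cast; ring
/-- the alternating product -/
lemma prod_c (n : ℕ) : ex (odp n) = ∑ s ∈ (Finset.range n).powerset, (-1) ^ s.card * X ^ (∑ k ∈ s, (4 * k + 2)) := by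
  rw [odp, map_prod]
  simp only [map_sub, map_one, map_pow, expand_X, ← pow_mul]
  rw [Finset.prod_sub]
  refine Finset.sum_congr rfl fun s _ => ?_
  rw [Finset.prod_const_one, mul_one, Finset.prod_pow_eq_pow_sum]
  congr 2; exact Finset.sum_congr rfl fun k _ => by ring
lemma U0_c (n : ℕ) : X ^ (n + 1) ∣ ex U0 - ex (odp n) := by
  rw [← map_sub]
  refine ex_dvd (n := n + 1) ?_ (by omega)
  have h1 : U0 * ex fI = fI := by rw [U0, mul_assoc, mul_comm (ex fP), exIP, mul_one]
  have h2 : X ^ (n + 1) ∣ fI - fp (2 * n) := fI_c (by omega)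
  have h3 : X ^ (n + 1) ∣ ex fI - evp 0 n := by
    rw [← ex_fp, ← map_sub]; exact ex_dvd (fI_c (le_refl n)) (by omega)
  have h4 : X ^ (n + 1) ∣ (U0 - odp n) * ex fI := by
    have := dvd_sub h2 (h3.mul_left (odp n))
    convert this using 1; rw [fp_2]; linear_combination h1
  have h5 := h4.mul_right (ex fP)
  rwa [mul_assoc, exIP, mul_one] at h5
lemma cC (m : ℕ) : coeff m (ex U0) = (if m = 0 then 1 else 0) - cCoeff m := by
  have h := X_pow_dvd_iff.1 (U0_c m) m (by omega)
  rw [map_sub, sub_eq_zero] at h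
  rw [h, prod_c, map_sum]
  by_cases hm : m = 0
  · subst hm; simp [cCoeff]
  · rw [if_neg hm, cCoeff, if_neg hm, zero_sub, ← Finset.sum_neg_distrib]
    have e : ∀ s : Finset ℕ, coeff m ((-1) ^ s.card * X ^ (∑ k ∈ s, (4 * k + 2)) : PS) = if ∑ k ∈ s, (4 * k + 2) = m then (-1) ^ s.card else 0 := by
      intro s
      rw [show ((-1) ^ s.card : PS) = C ((-1:ℤ) ^ s.card) by simp, coeff_C_mul, coeff_X_pow]; simp [eq_comm]
    simp_rw [e]
    rw [← Finset.sum_filter]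
    have inj : Function.Injective (fun k : ℕ => 4 * k + 2) := fun a b h => by simpa using h
    refine Finset.sum_bij (fun s _ => s.image fun k => 4 * k + 2) ?_ ?_ ?_ ?_
    · intro s hs
      simp only [Finset.mem_filter, Finset.mem_powerset] at hs ⊢
      have hsum : (s.image fun k => 4 * k + 2).sum id = m := by
        rw [Finset.sum_image inj.injOn]; exact hs.2
      refine ⟨fun x hx => ?_, fun x hx => ?_, hsum⟩
      · have := Finset.single_le_sum (f := id) (fun _ _ => Nat.zero_le _) hx
        rw [hsum] at this; simp at this ⊢; omega
      · obtain ⟨k, _, rfl⟩ := Finset.mem_image.1 hx; omega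
    · intro s _ t _ h; exact Finset.image_injective inj h
    · intro t ht
      simp only [Finset.mem_filter, Finset.mem_powerset] at ht
      have hi : (t.image fun x => x / 4).image (fun k => 4 * k + 2) = t := by
        rw [Finset.image_image]
        ext x; simp only [Finset.mem_image, Function.comp]
        constructor
        · rintro ⟨y, hy, rfl⟩; have := ht.2.1 y hy; rwa [show 4 * (y / 4) + 2 = y by omega]
        · intro hx; exact ⟨x, hx, by have := ht.2.1 x hx; omega⟩
      refine ⟨t.image fun x => x / 4, ?_, hi⟩
      simp only [Finset.mem_filter, Finset.mem_powerset]
      constructor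
      · intro k hk
        obtain ⟨x, hx, rfl⟩ := Finset.mem_image.1 hk
        have := ht.1 hx; have := ht.2.1 x hx; simp at *; omega
      · have := Finset.sum_image (f := id) (s := t.image fun x => x / 4) (g := fun k => 4 * k + 2) inj.injOn
        rw [hi] at this; exact this.symm.trans ht.2.2
    · intro s _
      rw [Finset.card_image_of_injective _ inj, pow_succ]; ring
lemma xi_eq (n : ℕ) : xi n = coeff n (fP ^ 8 - ff) := by
  have h : fP ^ 8 - ff = (1 - ex U0) * fP ^ 8 := by rw [ff]; ring
  rw [h, coeff_mul, Finset.Nat.sum_antidiagonal_eq_sum_range_succ_mk, xi]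
  refine Finset.sum_congr rfl fun m _ => ?_
  rw [pC, map_sub, cC, coeff_one]; ring
end KQ
namespace KQ
set_option linter.unusedVariables false
set_option linter.unusedSimpArgs false
open PowerSeries
open KMW hiding X
lemma cf_add (F H : PS) (z : ℤ) : cf (F + H) z = cf F z + cf H z := by rw [cf, cf, cf]; split_ifs <;> simp
lemma cf_sub (F H : PS) (z : ℤ) : cf (F - H) z = cf F z - cf H z := by rw [cf, cf, cf]; split_ifs <;> simp
lemma cf_smul (k : ℤ) (F : PS) (z : ℤ) : cf (k • F) z = k * cf F z := by rw [cf, cf]; split_ifs <;> simp only [cs, mul_zero]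
lemma cf_X (F : PS) (z : ℤ) : cf (X * F) z = cf F (z - 1) := by
  rcases lt_trichotomy z 0 with h | h | h
  · rw [cf_neg _ h, cf_neg _ (by omega)]
  · rw [h, cf_neg F (z := 0 - 1) (by omega)]; simp [cf]
  · obtain ⟨n, rfl⟩ : ∃ n : ℕ, z = (n + 1 : ℕ) := ⟨(z-1).toNat, by omega⟩
    rw [cf_nat, mul_comm, coeff_succ_mul_X, show ((n+1:ℕ):ℤ) - 1 = n by push_cast; ring, cf_nat]
lemma cf_ex (F : PS) (z : ℤ) : cf (ex F) (2 * z) = cf F z := by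
  rcases lt_or_ge z 0 with h | h
  · rw [cf_neg _ h, cf_neg _ (by omega)]
  · lift z to ℕ using h
    rw [show 2 * (z:ℤ) = ((2 * z : ℕ) : ℤ) by push_cast; rfl, cf_nat, cf_nat]
    exact coeff_expand_mul 2 two_ne_zero F z
lemma cf_ex' (F : PS) {z : ℤ} (h : ¬ 2 ∣ z) : cf (ex F) z = 0 := by
  by_contra h'
  have := cf_ne h'
  lift z to ℕ using this
  rw [cf_nat, ex, coeff_expand_of_not_dvd _ _ _ (by omega)] at h'
  exact h' rfl
lemma conv (F : PS) (n a b : ℤ) : ∑ᶠ m : ℤ, cf F (m - a) * cf F (n - m - b) = cf (F * F) (n - (a + b)) := by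
  have hg : good (fun m : ℕ => (m:ℤ)) := ⟨fun t => by simp, fun n => (Set.finite_Iic n.toNat).subset fun t ht => by simp at ht ⊢; omega⟩
  have hF : F = TH (fun m : ℕ => coeff m F) (fun m : ℕ => (m:ℤ)) := by
    ext n; rw [TH_c, finsum_eq_single _ n fun m hm => if_neg (by exact_mod_cast hm), if_pos rfl]
  nth_rw 3 [hF]
  rw [TH_mul_cf hg]
  rw [← finsum_comp_equiv (Equiv.addRight a)]
  have : ∀ m : ℤ, cf F (Equiv.addRight a m - a) * cf F (n - Equiv.addRight a m - b) = cf F m * cf F (n - (a + b) - m) := by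
    intro m; simp only [Equiv.coe_addRight]; congr 2 <;> ring
  rw [finsum_congr this, ← finsum_mem_univ (fun i : ℕ => _)]
  have hi : Set.InjOn (fun m : ℕ => (m:ℤ)) Set.univ := fun a _ b _ h => by simpa using h
  have := finsum_mem_image (f := fun m : ℤ => cf F m * cf F (n - (a + b) - m)) hi
  simp only [cf_nat] at this
  rw [← this, ← finsum_mem_univ]
  rw [← finsum_mem_inter_support, ← finsum_mem_inter_support (_) ((fun m : ℕ => (m:ℤ)) '' _)]
  refine finsum_congr fun m => finsum_congr_Prop (propext ?_) fun _ => rfl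
  simp only [Set.mem_inter_iff, Set.mem_univ, true_and, Function.mem_support, Set.image_univ, Set.mem_range]
  exact ⟨fun h => ⟨⟨m.toNat, Int.toNat_of_nonneg (cf_ne (left_ne_zero_of_mul h))⟩, h⟩, fun h => h.2⟩
def EE (s : ℤ) (t : Fin 8 → ℤ) (m : ℤ) : Q :=
  ![1, m, 2*(m+s) + (∑ i, t i)/2, 3*(m+s) + (t 0 + t 1 + t 2 + t 3 + t 4 + t 5), 4*(m+s) + ((∑ i, t i)/2 + t 0 + t 1 + t 2 + t 3 + t 4 - t 7),
   5*(m+s) + (2*t 0+2*t 1+2*t 2+2*t 3+t 4+t 5+t 6-t 7), 6*(m+s) + ((∑ i, t i)/2+2*t 0+2*t 1+2*t 2+t 3+t 4+t 5+t 6-2*t 7),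
   4*(m+s) + (2*t 0+2*t 1+t 2+t 3+t 4+t 5+t 6-t 7), 2*(m+s) + ((∑ i, t i)/2+t 0-t 7), 3*(m+s) + ((∑ i, t i)/2+t 0+t 1+t 2-t 7)]
lemma X_EE (s t m) (h : 2 ∣ ∑ i, t i) (i) : KMW.X (EE s t m) i = 2 * t i + s := by
  obtain ⟨k, hk⟩ := h
  have h2 : (∑ i, t i)/2 = k := by omega
  have h3 := Fin.sum_univ_eight t
  rw [hk] at h3
  simp only [EE, KMW.X, h2]
  fin_cases i <;> simp <;> linarith
lemma X_sub (x y : Q) (i) : KMW.X (x - y) i = KMW.X x i - KMW.X y i := by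
  fin_cases i <;> simp [KMW.X] <;> ring
lemma EE_sur (μ : Q) (h0 : μ 0 = 1) : ∃ (s : Bool) (t : Fin 8 → ℤ), 2 ∣ ∑ i, t i ∧ EE s.toNat t (μ 1) = μ := by
  have hs : ∃ s : Bool, 2 ∣ (μ 1 + μ 6 + μ 9) - s.toNat := by
    rcases Int.emod_two_eq_zero_or_one (μ 1 + μ 6 + μ 9) with h | h
    · exact ⟨false, by simp; omega⟩
    · exact ⟨true, by simp; omega⟩
  obtain ⟨s, k, hk⟩ := hs
  refine ⟨s, ![-μ 1-μ 6+μ 8+k, -μ 1-μ 6+μ 7-μ 8+k, -μ 1-μ 7+k, μ 5-k-s.toNat, μ 4-μ 5+μ 6-k-s.toNat, μ 3-μ 4+μ 6-k-s.toNat,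
    μ 2-μ 3+μ 6-k-s.toNat, μ 2-μ 1-μ 6+k], ?_⟩
  generalize (s.toNat : ℤ) = s' at hk
  have e : ∑ i, ![-μ 1-μ 6+μ 8+k, -μ 1-μ 6+μ 7-μ 8+k, -μ 1-μ 7+k, μ 5-k-s', μ 4-μ 5+μ 6-k-s', μ 3-μ 4+μ 6-k-s',
    μ 2-μ 3+μ 6-k-s', μ 2-μ 1-μ 6+k] i = 2 * (-2*μ 1+μ 2-2*s') := by simp [Fin.sum_univ_eight]; ring
  refine ⟨⟨_, e⟩, ?_⟩
  rw [EE, e, Int.mul_ediv_cancel_left _ two_ne_zero]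
  funext i
  fin_cases i <;> simp <;> linarith
lemma m1_EE (s t m) (h : 2 ∣ ∑ i, t i) : m1 (EE s t m) = cf (fP ^ 8) (m - (∑ i, (2 * t i + s)^2)/8) := by
  refine m1_fP _ _ rfl ?_
  have h1 := X_form (EE s t m)
  obtain ⟨k, hk⟩ := bb_even (EE s t m)
  simp only [X_EE s t m h] at h1
  rw [show EE s t m 0 = 1 from rfl, show EE s t m 1 = m from rfl] at h1
  omega
lemma m1_EE' (β : Q) (hβ : β 0 = 2) (s t m) (h : 2 ∣ ∑ i, t i) :
    m1 (β - EE s t m) = cf (fP ^ 8) (β 1 - m - (∑ i, (KMW.X β i - (2 * t i + s))^2)/8) := by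
  have e0 : (β - EE s t m) 0 = 1 := by rw [Pi.sub_apply, hβ]; rfl
  have e1 : (β - EE s t m) 1 = β 1 - m := rfl
  refine m1_fP _ _ e0 ?_
  have h1 := X_form (β - EE s t m)
  obtain ⟨k, hk⟩ := bb_even (β - EE s t m)
  simp only [X_sub, X_EE s t m h] at h1
  rw [e0, e1] at h1
  omega
lemma cv_W (β : Q) (hβ : β 0 = 2) : cv β = ∑ s : Bool, ∑ᶠ t : Fin 8 → ℤ, if 2 ∣ ∑ i, t i then
    cf (fP ^ 16) (β 1 - ((∑ i, (2 * t i + s.toNat)^2)/8 + (∑ i, (KMW.X β i - (2 * t i + s.toNat))^2)/8)) else 0 := by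
  classical
  let T := Bool × ((Fin 8 → ℤ) × ℤ)
  let Φ : T → Q := fun x => EE x.1.toNat x.2.1 x.2.2
  let S : Set T := {x | 2 ∣ ∑ i, x.2.1 i}
  let f : Q → ℤ := fun μ => m1 μ * m1 (β - μ)
  have inj : Set.InjOn Φ S := by
    rintro ⟨s, t, m⟩ h ⟨s', t', m'⟩ h' e
    have hx : ∀ i, 2 * t i + s.toNat = 2 * t' i + s'.toNat := fun i => by
      rw [← X_EE _ _ m h, ← X_EE _ _ m' h']; exact congrFun (congrArg KMW.X e) i
    obtain rfl : m = m' := congrFun e 1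
    obtain rfl : s = s' := by
      have := hx 0
      cases s <;> cases s' <;> simp at this ⊢ <;> omega
    obtain rfl : t = t' := funext fun i => by have := hx i; omega
    rfl
  have bij : Set.BijOn Φ S {μ | μ 0 = 1} := by
    refine ⟨fun x _ => rfl, inj, fun μ hμ => ?_⟩
    obtain ⟨s, t, h1, h2⟩ := EE_sur μ hμ
    exact ⟨(s, t, μ 1), h1, h2⟩
  have e1 : cv β = ∑ᶠ x ∈ S, f (Φ x) := by
    rw [finsum_mem_eq_of_bijOn Φ bij (g := f) fun _ _ => rfl, cv]
    refine (finsum_mem_univ f).symm.trans (finsum_mem_inter_support_eq' f _ _ fun μ h => ?_)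
    simpa using (m1_ne (left_ne_zero_of_mul h)).1
  have fin : (Function.support (S.indicator fun x => f (Φ x))).Finite := by
    refine Set.Finite.of_finite_image ((fs1' β).subset ?_) (inj.mono (s₁ := _) ?_) (f := Φ)
    · rintro _ ⟨x, hx, rfl⟩
      exact (Set.indicator_apply_ne_zero.1 hx).2
    · exact fun x hx => (Set.indicator_apply_ne_zero.1 hx).1
  rw [e1, finsum_mem_def, finsum_curry₃ _ fin, finsum_eq_sum_of_fintype]
  refine Finset.sum_congr rfl fun s _ => finsum_congr fun t => ?_
  split_ifs with h
  · rw [show fP ^ 16 = fP ^ 8 * fP ^ 8 by ring, ← conv]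
    refine finsum_congr fun m => ?_
    rw [Set.indicator_of_mem (show (s, t, m) ∈ S from h), ← m1_EE _ _ _ h, ← m1_EE' β hβ _ _ _ h]
  · exact finsum_eq_zero_of_forall_eq_zero fun m => Set.indicator_of_notMem (show (s, t, m) ∉ S from h) _
/-- coordinatewise affine change -/
def af (ε δ : Fin 8 → ℤ) (h : ∀ i, ε i * ε i = 1) : (Fin 8 → ℤ) ≃ (Fin 8 → ℤ) where
  toFun t i := ε i * t i + δ i
  invFun t i := ε i * (t i - δ i)
  left_inv t := by funext i; linear_combination t i * h i
  right_inv t := by funext i; linear_combination (t i - δ i) * h i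
lemma W_ps (A : Fin 8 → ℤ) (s B d z : ℤ) (ε δ : Fin 8 → ℤ) (h : ∀ i, ε i * ε i = 1) (hz : z = 2 * B - d)
    (h1 : ∀ t : Fin 8 → ℤ, ∑ i, (2 * t i + s)^2 + ∑ i, (A i - (2 * t i + s))^2 = 4 * ∑ i, eq2 (ε i * t i + δ i) + 4 * d)
    (h2 : ∀ t : Fin 8 → ℤ, 2 ∣ ∑ i, t i ↔ 2 ∣ z - ∑ i, (ε i * t i + δ i))
    (h3 : ∀ t : Fin 8 → ℤ, 2 ∣ ∑ i, t i → 8 ∣ ∑ i, (2 * t i + s)^2) :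
    ∑ᶠ t : Fin 8 → ℤ, (if 2 ∣ ∑ i, t i then
      cf (fP ^ 16) (B - ((∑ i, (2 * t i + s)^2)/8 + (∑ i, (A i - (2 * t i + s))^2)/8)) else 0) = cf (fP ^ 8) z := by
  rw [← ps8, ps, TH_pow gq, TH_mul_cf (good_pi gq 8)]
  refine Eq.trans (finsum_congr fun t => ?_) (finsum_comp_equiv (af ε δ h))
  simp only [Finset.prod_const_one, one_mul]
  have e := h1 t
  have e2 : ∑ i, eq2 (ε i * t i + δ i) = 2 * ∑ i, (ε i * t i + δ i) * (ε i * t i + δ i) + ∑ i, (ε i * t i + δ i) := by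
    rw [Finset.mul_sum, ← Finset.sum_add_distrib]; rfl
  have e3 := h2 t
  change _ = cf _ (z - ∑ i, eq2 (ε i * t i + δ i))
  split_ifs with h
  · obtain ⟨k, hk⟩ := e3.1 h
    have := h3 t h
    rw [show ex fP ^ 16 = ex (fP ^ 16) by rw [map_pow], show z - ∑ i, eq2 (ε i * t i + δ i) = 2 * (k - ∑ i, (ε i * t i + δ i) * (ε i * t i + δ i)) by omega, cf_ex]
    congr 1; omega
  · rw [show ex fP ^ 16 = ex (fP ^ 16) by rw [map_pow], cf_ex']; omega
lemma h3s (s : Bool) (t : Fin 8 → ℤ) (h : 2 ∣ ∑ i, t i) : 8 ∣ ∑ i, (2 * t i + s.toNat)^2 := by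
  have h1 := X_form (EE s.toNat t 0)
  obtain ⟨k, hk⟩ := bb_even (EE s.toNat t 0)
  simp only [X_EE _ t 0 h] at h1
  rw [show EE s.toNat t 0 0 = 1 from rfl, show EE s.toNat t 0 1 = 0 from rfl] at h1
  omega
lemma cv_r (n : ℤ) : cv (vr + n • dl) = 2 * cf (fP ^ 8) (2 * n) := by
  have hX : ∀ i, KMW.X (vr + n • dl) i = -1 := by
    intro i; fin_cases i <;> simp [KMW.X, vr, dl, -zsmul_eq_mul] <;> ring
  rw [cv_W _ (by simp [vr, dl]), Fintype.sum_bool, two_mul]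
  simp only [hX]
  congr 1
  · refine W_ps (fun _ => -1) _ _ 2 _ (fun _ => -1) (fun _ => -1) (by simp) (by simp [vr, dl]; ring) (fun t => ?_) (fun t => ?_) (h3s true)
    · simp [Fin.sum_univ_eight, eq2]; ring
    · simp only [Fin.sum_univ_eight]; omega
  · refine W_ps (fun _ => -1) _ _ 2 _ (fun _ => 1) (fun _ => 0) (by simp) (by simp [vr, dl]; ring) (fun t => ?_) (fun t => ?_) (h3s false)
    · simp [Fin.sum_univ_eight, eq2]; ring
    · simp only [Fin.sum_univ_eight]; omega
lemma cv_4 (n : ℤ) : cv (v4 + n • dl) = 2 * cf (fP ^ 8) (2 * n + 1) := by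
  have hX : KMW.X (v4 + n • dl) = ![-3,-1,-1,-1,-1,-1,-1,1] := by
    funext i; fin_cases i <;> simp [KMW.X, v4, dl, -zsmul_eq_mul] <;> ring
  rw [cv_W _ (by simp [v4, dl]), Fintype.sum_bool, two_mul]
  rw [hX]
  congr 1
  · refine W_ps _ _ _ 3 _ ![1,-1,-1,-1,-1,-1,-1,1] ![1,-1,-1,-1,-1,-1,-1,0] (by decide) (by simp [v4, dl]; ring) (fun t => ?_) (fun t => ?_) (h3s true)
    · simp [Fin.sum_univ_eight, eq2]; ring
    · simp [Fin.sum_univ_eight]; omega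
  · refine W_ps _ _ _ 3 _ ![-1,1,1,1,1,1,1,-1] ![-1,0,0,0,0,0,0,0] (by decide) (by simp [v4, dl]; ring) (fun t => ?_) (fun t => ?_) (h3s false)
    · simp [Fin.sum_univ_eight, eq2]; ring
    · simp [Fin.sum_univ_eight]; omega
end KQ
namespace KQ
set_option linter.unusedVariables false
set_option linter.unusedSimpArgs false
open PowerSeries
open KMW hiding X
lemma sg_prod (t : Fin 8 → ℤ) : ∏ i, sg (t i) = sg (∑ i, t i) := by
  simp only [Fin.prod_univ_eight, Fin.sum_univ_eight, sg_mul]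
lemma W0 (F : PS) (n : ℤ) : 2 * ∑ᶠ t : Fin 8 → ℤ, (if 2 ∣ ∑ i, t i then cf F (n - ∑ i, es (t i)) else 0) = cf (t3 ^ 8 * F) n + cf (t4 ^ 8 * F) n := by
  have g := good_pi gs 8
  rw [t3, t4, TH_pow gs, TH_pow gs, TH_mul_cf g, TH_mul_cf g, ← finsum_add_distrib, mul_finsum']
  · refine finsum_congr fun t => ?_
    rw [sg_prod]; split_ifs with h
    · rw [sg_even h]; simp; ring
    · rw [sg_odd h]; simp
  · refine good_supp g n fun t h => ?_
    have := cf_ne (ite_ne_right_iff.1 h).2; linarith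
  all_goals
    refine good_supp g n fun t h => ?_
    have := cf_ne (right_ne_zero_of_mul h); linarith
lemma W1 (F : PS) (n : ℤ) : 2 * ∑ᶠ t : Fin 8 → ℤ, (if 2 ∣ ∑ i, t i then cf F (n - ∑ i, ep (t i)) else 0) = cf (tp ^ 8 * F) n := by
  have g := good_pi gp 8
  have e : ∑ᶠ t : Fin 8 → ℤ, (if ¬ 2 ∣ ∑ i, t i then cf F (n - ∑ i, ep (t i)) else 0) = ∑ᶠ t : Fin 8 → ℤ, (if 2 ∣ ∑ i, t i then cf F (n - ∑ i, ep (t i)) else 0) := by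
    refine Eq.trans (finsum_congr fun t => ?_) (finsum_comp_equiv (af ![-1,1,1,1,1,1,1,1] ![-1,0,0,0,0,0,0,0] (by decide)))
    congr 1
    · simp only [af, Equiv.coe_fn_mk, Fin.sum_univ_eight]; simp; omega
    · congr 2; simp only [af, Equiv.coe_fn_mk, Fin.sum_univ_eight, ep]; simp; ring
  rw [two_mul]
  nth_rw 1 [← e]
  rw [tp, TH_pow gp, TH_mul_cf g, ← finsum_add_distrib]
  · refine finsum_congr fun t => ?_
    split_ifs with h <;> simp
  all_goals
    refine good_supp g n fun t h => ?_
    have := cf_ne (ite_ne_right_iff.1 h).2; linarith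
lemma dd_0 (n : ℤ) : dd (v0 + n • dl) = cf (ex (fP ^ 8)) n := by
  by_cases h : 2 ∣ n
  · obtain ⟨k, rfl⟩ := h
    rw [cf_ex, show v0 + (2 * k) • dl = (2:ℤ) • (al 0 + k • dl) by rw [smul_add, mul_smul]; congr 1; decide, dd_two]
    refine m1_fP _ _ (by simp [al, dl]) ?_
    rw [bb_add, bb_smul, bb_dl, add_bb, smul_bb, dl_bb, show bb (al 0) (al 0) = 2 by decide]; simp [al, dl]; ring
  · rw [cf_ex' _ h, dd, if_neg]
    intro h'
    have := congrFun h' 1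
    simp [v0, dl] at this; omega
lemma cv_0 (n : ℤ) : cv (v0 + n • dl) - dd (v0 + n • dl) = 2 * cf (fP ^ 8) (2 * n - 1) := by
  have hX : ∀ i, KMW.X (v0 + n • dl) i = 0 := by
    intro i; fin_cases i <;> simp [KMW.X, v0, dl, -zsmul_eq_mul] <;> ring
  have h1 : (v0 + n • dl) 1 = n := by simp [v0, dl]
  have c := cv_W (v0 + n • dl) (by simp [v0, dl])
  simp only [Fintype.sum_bool, hX, h1] at c
  have a := W0 (fP ^ 16) n
  have b := W1 (fP ^ 16) (n - 1 - 1)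
  rw [← cf_X, ← cf_X] at b
  have a' : ∀ t : Fin 8 → ℤ, n - ((∑ i, (2 * t i + (false.toNat:ℤ))^2)/8 + (∑ i, (0 - (2 * t i + (false.toNat:ℤ)))^2)/8) = n - ∑ i, es (t i) ∨ ¬ 2 ∣ ∑ i, t i := by
    intro t
    by_cases h : 2 ∣ ∑ i, t i
    · left
      have h3 := h3s false t h
      have : ∑ i, (2 * t i + (false.toNat:ℤ))^2 = 4 * ∑ i, es (t i) := by rw [Finset.mul_sum]; exact Finset.sum_congr rfl fun i _ => by simp [es]; ring
      simp only [zero_sub, neg_sq]; omega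
    · exact Or.inr h
  have b' : ∀ t : Fin 8 → ℤ, n - ((∑ i, (2 * t i + (true.toNat:ℤ))^2)/8 + (∑ i, (0 - (2 * t i + (true.toNat:ℤ)))^2)/8) = n - 1 - 1 - ∑ i, ep (t i) ∨ ¬ 2 ∣ ∑ i, t i := by
    intro t
    by_cases h : 2 ∣ ∑ i, t i
    · left
      have h3 := h3s true t h
      have : ∑ i, (2 * t i + (true.toNat:ℤ))^2 = 4 * ∑ i, ep (t i) + 8 := by simp [Fin.sum_univ_eight, ep]; ring
      simp only [zero_sub, neg_sq]; omega
    · exact Or.inr h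
  have ca : ∀ (F : PS) (t : Fin 8 → ℤ) (x y : ℤ), x = y ∨ ¬ 2 ∣ ∑ i, t i → (if 2 ∣ ∑ i, t i then cf F x else 0) = if 2 ∣ ∑ i, t i then cf F y else 0 := by
    rintro F t x y (rfl | h)
    · rfl
    · rw [if_neg h, if_neg h]
  rw [finsum_congr fun t => ca _ t _ _ (a' t), finsum_congr fun t => ca _ t _ _ (b' t)] at c
  obtain ⟨E, hE⟩ := dis
  have d : cf (t4 ^ 8 * fP ^ 16) n = dd (v0 + n • dl) := by rw [dd_0, t48, map_pow]
  have k : cf (t3 ^ 8 * fP ^ 16) n - cf (t4 ^ 8 * fP ^ 16) n + cf (X * (X * (tp ^ 8 * fP ^ 16))) n = 32 * cf OO (n - 1) := by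
    rw [← cf_X, ← cf_smul, ← cf_sub, ← cf_add, OO, zsmul_eq_mul]; congr 1; push_cast; linear_combination fP ^ 16 * KK
  have l : cf (fP ^ 8) (2 * n - 1) = 8 * cf OO (n - 1) := by
    rw [hE, cf_add, cf_ex' E (by omega), show 8 * X * ex OO = (8:ℤ) • (X * ex OO) by rw [zsmul_eq_mul]; push_cast; ring, cf_smul, cf_X,
      show 2 * n - 1 - 1 = 2 * (n - 1) by ring, cf_ex, zero_add]
  rw [l]; linarith
lemma cvdd (β : Q) (z : ℤ) (h0 : β 0 = 2) (hb : bb β β = 2 * (3 - z)) : cv β - dd β = cf ((2:ℤ) • fP ^ 8) z := by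
  refine gen_ind (l := 2) (c := 3) (by norm_num) _ (fun β => cv β - dd β) (fun β i hi _ => by rw [cv_sr β i hi, dd_sr β i hi]) ?_ β z h0 hb
  clear hb h0 z β
  intro β z h0 ha hn _
  have nrm : ∀ (v : Q) (n : ℤ), v 0 = 2 → bb (v + n • dl) (v + n • dl) = bb v v - 4 * n := by
    intro v n hv
    rw [bb_add, bb_smul, bb_dl, add_bb, smul_bb, dl_bb]; simp [hv, dl0]; ring
  rw [cf_smul]
  obtain ⟨n, rfl | rfl | rfl⟩ := anti_cls h0 ha
  · have e := nrm vr n rfl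
    rw [show bb vr vr = 6 by decide] at e
    obtain rfl : z = 2 * n := by linarith
    rw [cv_r, dd, if_neg, sub_zero]
    intro h'
    have := congrFun h' 1; have h2 := congrFun h' 3
    simp [vr, dl] at this h2; omega
  · have e := nrm v0 n rfl
    rw [show bb v0 v0 = 8 by decide] at e
    obtain rfl : z = 2 * n - 1 := by linarith
    exact cv_0 n
  · have e := nrm v4 n rfl
    rw [show bb v4 v4 = 4 by decide] at e
    obtain rfl : z = 2 * n + 1 := by linarith
    rw [cv_4, dd, if_neg, sub_zero]
    intro h'
    have := congrFun h' 7
    simp [v4, dl] at this; omega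
lemma mu_xi (β : Q) (n : ℕ) (h0 : β 0 = 2) (hb : bb β β = 2 * (3 - n)) : mu β = xi n := by
  have h1 := cvdd β n h0 hb
  have h2 := YY_f2 β n h0 hb
  rw [YY, f2, cf_smul] at h2
  rw [cf_smul] at h1
  rw [xi_eq, ← cf_nat, cf_sub]; linarith
end KQ
/-- **(Kac–Moody–Wakimoto, level 2 for `E₁₀`.)**  For every `c : Fin 10 → ℕ` with
`c 0 = 2` (level 2) and `(α|α) ≤ 0` where `α = ∑ c i • α i`, one has
`mult(α) = ξ(3 − (α|α)/2)`. -/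
theorem kac_moody_wakimoto_level_two (c : Fin 10 → ℕ)
    (hlevel : c 0 = 2)
    (hnorm : normE10 (fun i => (c i : ℤ)) ≤ 0) :
    (KacMoody.mult AE10 (fun i => (c i : ℤ)) : ℤ) =
      xi ((3 - normE10 (fun i => (c i : ℤ)) / 2).toNat) := by

  have he := KMW.bb_even fun i => (c i : ℤ)
  obtain ⟨k, hk⟩ := he
  rw [KMW.norm_bb, hk] at hnorm ⊢
  rw [KMW.mult_mu _ (fun i => by simp) (fun h => by have := congrFun h 0; simp [hlevel] at this)]
  refine KQ.mu_xi _ _ (by simp [hlevel]) ?_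
  rw [hk]; omega
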